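/- arXiv:1504.06683 — 2 statements merged into one kernel-verified Lean document; each statement's English description precedes it below -/
import Mathlib

section
/- Let $(\Omega,\mathcal F,P)$ be a complete probability space with a filtration $(\mathcal F_t)_{t=0}^T$ of complete sub-$\sigma$-algebras of $\mathcal F$, and write $E_t=E[\,\cdot\mid\mathcal F_t]$. The expectation of an extended-real-valued measurable function is defined to be $+\infty$ unless its positive part is integrable. Let $d\ge 0$, let $\mathcal N=\{x=(x_t)_{t=0}^T : x_t\in L^0(\Omega,\mathcal F_t,P;\mathbb R^d)\}$ be the space of adapted processes and $\mathcal N^\infty\subset\mathcal N$ the essentially bounded ones. For $t=0,\dots,T$ let $K_t:\mathbb R^d\times\mathbb R^d\times\Omega\to(-\infty,+\infty]$ be an $\mathcal F_t$-measurable convex normal integrand (i.e. $K_t$ is $\mathcal B(\mathbb R^d\times\mathbb R^d)\otimes\mathcal F_t$-measurable, $K_t(\cdot,\cdot,\omega)$ is convex, and $\omega\mapsto\operatorname{epi}K_t(\cdot,\cdot,\omega)$ is closed-valued and $\mathcal F_t$-measurable), and put $$f(x,u,\omega)=\sum_{t=0}^T K_t(x_t,\Delta x_t+u_t,\omega),\qquad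 Ef(x,u)=\int_\Omega f(x(\omega),u(\omega),\omega)\,dP(\omega),$$ where $\Delta x_t=x_t-x_{t-1}$ and $x_{-1}:=0$. Let $\operatorname{dom}_1K_t(\omega)=\{x\in\mathbb R^d : K_t(x,u,\omega)<\infty\text{ for some }u\}$ and $K_t^*(v,y,\omega)=\sup_{x,u\in\mathbb R^d}\{x\cdot v+u\cdot y-K_t(x,u,\omega)\}$. Let $\mathcal U,\mathcal Y\subset L^0(\Omega,\mathcal F,P;\mathbb R^{(T+1)d})$ be linear subspaces that are decomposable (a space $\mathcal S$ is decomposable if $1_Au+1_{\Omega\setminus A}u'\in\mathcal S$ whenever $A\in\mathcal F$, $u\in\mathcal S$, $u'\in L^\infty$), such that $u\cdot y$ is integrable for all $u\in\mathcal U$, $y\in\mathcal Y$ and $\langle u,y\rangle=E(u\cdot y)$ is a separating duality. Let $\operatorname{dom}_1Ef=\{x\in\mathcal N : Ef(x,u)<+\infty\text{ for some }u\in\mathcal U\}$, let $({}^au)_t=E_tu_t$ denote the adapted projection, and set $$\varphi(u)=\inf_{x\in\mathcal N}Ef(x,u),\qquad \tilde\varphi(u)=\inf_{x\in\mathcal N^\infty}Ef(x,u),$$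 $$\varphi^*(y)=\sup_{u\in\mathcal U}\{\langle u,y\rangle-\varphi(u)\},\qquad \tilde\varphi^*(y)=\sup_{u\in\mathcal U}\{\langle u,y\rangle-\tilde\varphi(u)\}.$$ Assume: (i) there is at least one $x\in\mathcal N^\infty$ with $x_t\in\operatorname{cl}\operatorname{dom}_1K_t$ a.s. for all $t$, and for every such $x$ there exists $\bar x\in\mathcal N^\infty$ with $\bar x_t\in\operatorname{ri}\operatorname{dom}_1K_t$ a.s. for all $t$ and $(1-\lambda)x+\lambda\bar x\in\operatorname{dom}_1Ef$ for all $\lambda\in(0,1]$; (ii) ${}^au\in\mathcal U$ and ${}^ay\in\mathcal Y$ for all $u\in\mathcal U$ and $y\in\mathcal Y$. Then, for every adapted $y\in\mathcal Y\cap\mathcal N$, $$\tilde\varphi^*(y)=\varphi^*(y)=E\sum_{t=0}^T K_t^*(E_t\Delta y_{t+1},y_t),$$ where $\Delta y_{t+1}=y_{t+1}-y_t$ and $y_{T+1}:=0$, and for every $y\in\mathcal Y$, $$\tilde\varphi^*({}^ay)\le\tilde\varphi^*(y).$$ -/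
open MeasureTheory
open scoped ENNReal

noncomputable section

/-- Expectation of an extended-real-valued function: `+∞` unless the positive part is
integrable, and `E φ⁺ - E φ⁻` otherwise (`EReal.toENNReal` is the positive part). -/
def EE {Ω : Type*} {mΩ : MeasurableSpace Ω} (P : Measure Ω) (φ : Ω → EReal) : EReal :=
  if ∫⁻ ω, (φ ω).toENNReal ∂P = ⊤ then ⊤
  else ((∫⁻ ω, (φ ω).toENNReal ∂P : ℝ≥0∞) : EReal) -
    ((∫⁻ ω, (-(φ ω)).toENNReal ∂P : ℝ≥0∞) : EReal)

/-- The scalar product on `ℝ^d`. -/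
def dotd {d : ℕ} (a b : Fin d → ℝ) : ℝ := ∑ i, a i * b i

/-- The scalar product on `ℝ^{(T+1)d}`. -/
def dotB {T d : ℕ} (a b : Fin (T + 1) → Fin d → ℝ) : ℝ := ∑ t, dotd (a t) (b t)

/-- `Δx_t = x_t − x_{t-1}` with the convention `x_{-1} := 0`. -/
def deltaX {T d : ℕ} (x : Fin (T + 1) → Fin d → ℝ) (t : Fin (T + 1)) : Fin d → ℝ :=
  x t - (if (t : ℕ) = 0 then 0 else
    x ⟨(t : ℕ) - 1, Nat.lt_of_le_of_lt (Nat.sub_le _ _) t.isLt⟩)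

/-- `Δy_{t+1} = y_{t+1} − y_t` with the convention `y_{T+1} := 0`. -/
def deltaNext {T d : ℕ} (y : Fin (T + 1) → Fin d → ℝ) (t : Fin (T + 1)) : Fin d → ℝ :=
  (if h : (t : ℕ) = T then 0 else
    y ⟨(t : ℕ) + 1, Nat.succ_lt_succ (Nat.lt_of_le_of_ne (Nat.lt_succ_iff.mp t.isLt) h)⟩) - y t

/-- `k : ℝ^d × ℝ^d × Ω → (−∞,+∞]` is a convex normal integrand with respect to the σ-algebra `m`:
it is `B(ℝ^d × ℝ^d) ⊗ m`-measurable, convex in its first two arguments, and its epigraph mapping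
`ω ↦ {((x,u),α) | k(x,u,ω) ≤ α}` is closed-valued (lower semicontinuity) and `m`-measurable (the
preimage of every open set belongs to `m`). -/
structure IsConvexNormalIntegrand {Ω : Type*} {d : ℕ} (m : MeasurableSpace Ω)
    (k : (Fin d → ℝ) → (Fin d → ℝ) → Ω → EReal) : Prop where
  ne_bot : ∀ x u ω, k x u ω ≠ ⊥
  measurable : @Measurable (((Fin d → ℝ) × (Fin d → ℝ)) × Ω) EReal
    (MeasurableSpace.prod inferInstance m) _ (fun p => k p.1.1 p.1.2 p.2)
  lsc : ∀ ω, LowerSemicontinuous (fun p : (Fin d → ℝ) × (Fin d → ℝ) => k p.1 p.2 ω)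
  measurable_epi : ∀ O : Set (((Fin d → ℝ) × (Fin d → ℝ)) × ℝ), IsOpen O →
    MeasurableSet[m] {ω | ∃ p ∈ O, k p.1.1 p.1.2 ω ≤ (p.2 : EReal)}
  convex : ∀ (ω : Ω) (a b : ℝ) (x₁ x₂ u₁ u₂ : Fin d → ℝ), 0 < a → 0 < b → a + b = 1 →
    k (a • x₁ + b • x₂) (a • u₁ + b • u₂) ω ≤ (a : EReal) * k x₁ u₁ ω + (b : EReal) * k x₂ u₂ ω

/-- `dom₁ k(ω) = {x | k(x,u,ω) < ∞ for some u}`. -/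
def dom1K {Ω : Type*} {d : ℕ} (k : (Fin d → ℝ) → (Fin d → ℝ) → Ω → EReal) (ω : Ω) :
    Set (Fin d → ℝ) :=
  {x | ∃ u, k x u ω < ⊤}

/-- The space `𝓝` of adapted processes. -/
def NBolza {Ω : Type*} {mΩ : MeasurableSpace Ω} {T : ℕ} (d : ℕ)
    (ℱ : Filtration (Fin (T + 1)) mΩ) : Set (Ω → Fin (T + 1) → Fin d → ℝ) :=
  {x | ∀ t, Measurable[ℱ t] (fun ω => x ω t)}

/-- The space `𝓝^∞` of essentially bounded adapted processes. -/
def NBolzaInf {Ω : Type*} {mΩ : MeasurableSpace Ω} {T : ℕ} (d : ℕ)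
    (ℱ : Filtration (Fin (T + 1)) mΩ) (P : Measure Ω) : Set (Ω → Fin (T + 1) → Fin d → ℝ) :=
  {x | x ∈ NBolza d ℱ ∧ ∃ M : ℝ, ∀ᵐ ω ∂P, ∀ t, ‖x ω t‖ ≤ M}

/-- The Bolza integrand `f(x,u,ω) = Σ_{t=0}^T K_t(x_t, Δx_t + u_t, ω)`. -/
def fBolza {Ω : Type*} {T d : ℕ} (K : Fin (T + 1) → (Fin d → ℝ) → (Fin d → ℝ) → Ω → EReal)
    (x u : Fin (T + 1) → Fin d → ℝ) (ω : Ω) : EReal :=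
  ∑ t, K t (x t) (deltaX x t + u t) ω

/-- `Ef(x,u)` for the Bolza problem. -/
def intFB {Ω : Type*} {mΩ : MeasurableSpace Ω} {T d : ℕ} (P : Measure Ω)
    (K : Fin (T + 1) → (Fin d → ℝ) → (Fin d → ℝ) → Ω → EReal)
    (x u : Ω → Fin (T + 1) → Fin d → ℝ) : EReal :=
  EE P fun ω => fBolza K (x ω) (u ω) ω

/-- The pairing `⟨u,y⟩ = E(u·y)`. -/
def pairB {Ω : Type*} {mΩ : MeasurableSpace Ω} {T d : ℕ} (P : Measure Ω)
    (u y : Ω → Fin (T + 1) → Fin d → ℝ) : ℝ :=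
  ∫ ω, dotB (u ω) (y ω) ∂P

/-- The value function `φ(u) = inf_{x∈𝓝} Ef(x,u)`. -/
def phiB {Ω : Type*} {mΩ : MeasurableSpace Ω} {T d : ℕ} (P : Measure Ω)
    (K : Fin (T + 1) → (Fin d → ℝ) → (Fin d → ℝ) → Ω → EReal)
    (ℱ : Filtration (Fin (T + 1)) mΩ) (u : Ω → Fin (T + 1) → Fin d → ℝ) : EReal :=
  ⨅ x ∈ NBolza d ℱ, intFB P K x u

/-- The auxiliary value function `φ̃(u) = inf_{x∈𝓝^∞} Ef(x,u)`. -/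
def phiBInf {Ω : Type*} {mΩ : MeasurableSpace Ω} {T d : ℕ} (P : Measure Ω)
    (K : Fin (T + 1) → (Fin d → ℝ) → (Fin d → ℝ) → Ω → EReal)
    (ℱ : Filtration (Fin (T + 1)) mΩ) (u : Ω → Fin (T + 1) → Fin d → ℝ) : EReal :=
  ⨅ x ∈ NBolzaInf d ℱ P, intFB P K x u

/-- Conjugate `g*(y) = sup_{u∈𝓤} {⟨u,y⟩ - g(u)}` of a function on `𝓤`. -/
def conjB {Ω : Type*} {mΩ : MeasurableSpace Ω} {T d : ℕ} (P : Measure Ω)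
    (𝓤 : Submodule ℝ (Ω → Fin (T + 1) → Fin d → ℝ))
    (g : (Ω → Fin (T + 1) → Fin d → ℝ) → EReal) (y : Ω → Fin (T + 1) → Fin d → ℝ) : EReal :=
  ⨆ u ∈ 𝓤, (((pairB P u y : ℝ) : EReal) - g u)

/-- `k*(v,y,ω) = sup_{x,u} {x·v + u·y − k(x,u,ω)}`. -/
def Kconj {Ω : Type*} {d : ℕ} (k : (Fin d → ℝ) → (Fin d → ℝ) → Ω → EReal)
    (v y : Fin d → ℝ) (ω : Ω) : EReal :=
  ⨆ (x : Fin d → ℝ) (u : Fin d → ℝ), (((dotd x v + dotd u y : ℝ) : EReal) - k x u ω)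

/-- The adapted projection `(ᵃu)_t = E_t u_t`. -/
def aProj {Ω : Type*} {mΩ : MeasurableSpace Ω} {T d : ℕ} (P : Measure Ω)
    (ℱ : Filtration (Fin (T + 1)) mΩ) (u : Ω → Fin (T + 1) → Fin d → ℝ) :
    Ω → Fin (T + 1) → Fin d → ℝ :=
  fun ω t => (P[fun ω' => u ω' t | ℱ t]) ω

/-- `E_t Δy_{t+1}`, the conditional expectation given `𝓕_t`. -/
def condDelta {Ω : Type*} {mΩ : MeasurableSpace Ω} {T d : ℕ} (P : Measure Ω)
    (ℱ : Filtration (Fin (T + 1)) mΩ) (y : Ω → Fin (T + 1) → Fin d → ℝ) (t : Fin (T + 1)) :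
    Ω → Fin d → ℝ :=
  P[fun ω => deltaNext (y ω) t | ℱ t]

/-- `dom₁ Ef = {x ∈ 𝓝 | Ef(x,u) < +∞ for some u ∈ 𝓤}`. -/
def dom1B {Ω : Type*} {mΩ : MeasurableSpace Ω} {T d : ℕ} (P : Measure Ω)
    (K : Fin (T + 1) → (Fin d → ℝ) → (Fin d → ℝ) → Ω → EReal)
    (ℱ : Filtration (Fin (T + 1)) mΩ) (𝓤 : Submodule ℝ (Ω → Fin (T + 1) → Fin d → ℝ)) :
    Set (Ω → Fin (T + 1) → Fin d → ℝ) :=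
  {x | x ∈ NBolza d ℱ ∧ ∃ u ∈ 𝓤, intFB P K x u < ⊤}

/-- A decomposable subspace of `L⁰(Ω,𝓕,P;ℝ^{(T+1)d})`, given by its measurable representatives:
`1_A u + 1_{Ω∖A} u'` belongs to it for `A ∈ 𝓕`, `u` in it and `u'` essentially bounded. (As `u'` is
arbitrary on null sets, the space is stable under measurable modifications on null sets.) -/
structure IsDecomposableB {Ω : Type*} {mΩ : MeasurableSpace Ω} {T d : ℕ} (P : Measure Ω)
    (S : Submodule ℝ (Ω → Fin (T + 1) → Fin d → ℝ)) : Prop where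
  measurable : ∀ u ∈ S, Measurable u
  decomposable : ∀ A : Set Ω, MeasurableSet A → ∀ u ∈ S, ∀ u' : Ω → Fin (T + 1) → Fin d → ℝ,
    Measurable u' → (∃ M : ℝ, ∀ᵐ ω ∂P, ‖u' ω‖ ≤ M) →
    (fun ω => A.indicator u ω + Aᶜ.indicator u' ω) ∈ S

end

section ExtendedExpectation

variable {Ω : Type*} {mΩ : MeasurableSpace Ω} {P : Measure Ω}

theorem EE_congr {φ ψ : Ω → EReal} (h : φ =ᵐ[P] ψ) : EE P φ = EE P ψ := by
  have h1 : ∫⁻ ω, (φ ω).toENNReal ∂P = ∫⁻ ω, (ψ ω).toENNReal ∂P :=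
    lintegral_congr_ae (h.mono fun ω hω => by simp only [hω])
  have h2 : ∫⁻ ω, (-(φ ω)).toENNReal ∂P = ∫⁻ ω, (-(ψ ω)).toENNReal ∂P :=
    lintegral_congr_ae (h.mono fun ω hω => by simp only [hω])
  simp only [EE, h1, h2]

theorem EE_lt_top_iff {φ : Ω → EReal} : EE P φ < ⊤ ↔ ∫⁻ ω, (φ ω).toENNReal ∂P < ⊤ := by
  unfold EE
  split_ifs with h
  · simp [h]
  · refine ⟨fun _ => lt_top_iff_ne_top.2 h, fun _ => ?_⟩
    generalize (∫⁻ ω, (φ ω).toENNReal ∂P) = a at h ⊢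
    generalize (∫⁻ ω, (-(φ ω)).toENNReal ∂P) = b
    lift a to NNReal using h
    rw [sub_eq_add_neg]
    refine EReal.add_lt_top (by simp) ?_
    intro hb
    rw [EReal.neg_eq_top_iff] at hb
    exact absurd hb (by simp)

theorem ae_lt_top_of_EE_lt_top {φ : Ω → EReal} (hφ : AEMeasurable φ P) (h : EE P φ < ⊤) :
    ∀ᵐ ω ∂P, φ ω < ⊤ := by
  rw [EE_lt_top_iff] at h
  filter_upwards [ae_lt_top' hφ.ereal_toENNReal h.ne] with ω hω
  exact lt_top_iff_ne_top.2 (EReal.toENNReal_ne_top_iff.1 hω.ne)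

theorem EE_of_integrable {φ : Ω → EReal} {r : Ω → ℝ} (h : ∀ᵐ ω ∂P, φ ω = (r ω : EReal))
    (hr : Integrable r P) : EE P φ = ((∫ ω, r ω ∂P : ℝ) : EReal) := by
  rw [EE_congr h]
  have h1 : ∫⁻ ω, ENNReal.ofReal (r ω) ∂P ≠ ⊤ :=
    (lt_of_le_of_lt (lintegral_ofReal_le_lintegral_enorm r) hr.2).ne
  have h2 : ∫⁻ ω, ENNReal.ofReal (-(r ω)) ∂P ≠ ⊤ :=
    (lt_of_le_of_lt (lintegral_ofReal_le_lintegral_enorm _) hr.neg.2).ne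
  simp only [EE, ← EReal.coe_neg, EReal.real_coe_toENNReal, h1, if_false]
  rw [integral_eq_lintegral_pos_part_sub_lintegral_neg_part hr, EReal.coe_sub]
  lift (∫⁻ ω, ENNReal.ofReal (r ω) ∂P) to NNReal using h1 with a
  lift (∫⁻ ω, ENNReal.ofReal (-(r ω)) ∂P) to NNReal using h2 with b
  rfl

theorem EE_lt_top_iff_exists_le {φ : Ω → EReal} {r : Ω → ℝ} (h : ∀ᵐ ω ∂P, φ ω = (r ω : EReal))
    (hr : AEMeasurable r P) : EE P φ < ⊤ ↔ ∃ g, Integrable g P ∧ ∀ᵐ ω ∂P, r ω ≤ g ω := by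
  rw [EE_congr h, EE_lt_top_iff]
  simp only [EReal.real_coe_toENNReal]
  constructor
  · intro hlt
    refine ⟨fun ω => max (r ω) 0, ⟨(hr.max aemeasurable_const).aestronglyMeasurable, ?_⟩,
      .of_forall fun ω => le_max_left _ _⟩
    refine lt_of_le_of_lt (lintegral_mono fun ω => ?_) hlt
    rw [Real.enorm_of_nonneg (le_max_right _ _)]
    simp
  · rintro ⟨g, hg, hle⟩
    exact lt_of_le_of_lt (lintegral_mono_ae (hle.mono fun ω hω => ENNReal.ofReal_le_ofReal hω))
      (lt_of_le_of_lt (lintegral_ofReal_le_lintegral_enorm g) hg.2)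

theorem integrable_of_EE_ne {φ : Ω → EReal} {r : Ω → ℝ} (h : ∀ᵐ ω ∂P, φ ω = (r ω : EReal))
    (hr : AEMeasurable r P) (htop : EE P φ < ⊤) (hbot : EE P φ ≠ ⊥) : Integrable r P := by
  have hpos := EE_lt_top_iff.1 htop
  rw [EE, if_neg hpos.ne] at hbot
  have hneg : ∫⁻ ω, (-(φ ω)).toENNReal ∂P < ⊤ := by
    rw [lt_top_iff_ne_top]
    intro hn
    rw [hn] at hbot
    apply hbot
    lift (∫⁻ ω, (φ ω).toENNReal ∂P) to NNReal using hpos.ne with a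
    simp
  refine ⟨hr.aestronglyMeasurable, ?_⟩
  refine lt_of_le_of_lt ?_ (ENNReal.add_lt_top.2 ⟨hpos, hneg⟩)
  rw [← lintegral_add_left' ]
  · refine lintegral_mono_ae (h.mono fun ω hω => ?_)
    simp only [hω, ← EReal.coe_neg, EReal.real_coe_toENNReal, ← ofReal_norm, Real.norm_eq_abs]
    rw [← max_zero_add_max_neg_zero_eq_abs_self,
      ENNReal.ofReal_add (le_max_right _ _) (le_max_right _ _)]
    simp
  · refine AEMeasurable.ereal_toENNReal ?_
    exact (hr.coe_real_ereal).congr (h.mono fun ω hω => hω.symm)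

end ExtendedExpectation

section Fatou

variable {Ω : Type*} {mΩ : MeasurableSpace Ω} {P : Measure Ω}

theorem integrable_of_ae_le_of_ae_le {f g h : Ω → ℝ} (hf : AEMeasurable f P) (hg : Integrable g P)
    (hh : Integrable h P) (h1 : ∀ᵐ ω ∂P, g ω ≤ f ω) (h2 : ∀ᵐ ω ∂P, f ω ≤ h ω) :
    Integrable f P := by
  refine Integrable.mono' (hg.abs.add hh.abs) hf.aestronglyMeasurable ?_
  filter_upwards [h1, h2] with ω a b
  simp only [Pi.add_apply, Real.norm_eq_abs]
  rw [abs_le]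
  constructor
  · linarith [neg_abs_le (g ω), abs_nonneg (h ω)]
  · linarith [le_abs_self (h ω), abs_nonneg (g ω)]

/-- Fatou's lemma for real functions bounded below by an integrable function. -/
theorem integrable_and_integral_le_of_tendsto {V : ℕ → Ω → ℝ} {W g : Ω → ℝ} {C : ℝ}
    (hg : Integrable g P) (hV : ∀ n, Integrable (V n) P) (hgV : ∀ n, ∀ᵐ ω ∂P, g ω ≤ V n ω)
    (hC : ∀ n, ∫ ω, V n ω ∂P ≤ C)
    (hlim : ∀ᵐ ω ∂P, Filter.Tendsto (fun n => V n ω) Filter.atTop (nhds (W ω))) :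
    Integrable W P ∧ ∫ ω, W ω ∂P ≤ C := by
  have hWm : AEMeasurable W P :=
    aemeasurable_of_tendsto_metrizable_ae _ (fun n => (hV n).aemeasurable) hlim
  have hgW : ∀ᵐ ω ∂P, g ω ≤ W ω := by
    filter_upwards [hlim, ae_all_iff.2 hgV] with ω h1 h2
    exact ge_of_tendsto' h1 h2
  have hFat : ∫⁻ ω, ENNReal.ofReal (W ω - g ω) ∂P ≤ ENNReal.ofReal (C - ∫ ω, g ω ∂P) := by
    calc ∫⁻ ω, ENNReal.ofReal (W ω - g ω) ∂P
        = ∫⁻ ω, Filter.liminf (fun n => ENNReal.ofReal (V n ω - g ω)) Filter.atTop ∂P := by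
          refine lintegral_congr_ae ?_
          filter_upwards [hlim] with ω h1
          exact ((ENNReal.tendsto_ofReal (h1.sub_const (g ω))).liminf_eq).symm
      _ ≤ Filter.liminf (fun n => ∫⁻ ω, ENNReal.ofReal (V n ω - g ω) ∂P) Filter.atTop :=
          lintegral_liminf_le' fun n => ((hV n).sub hg).aemeasurable.ennreal_ofReal
      _ ≤ ENNReal.ofReal (C - ∫ ω, g ω ∂P) := by
          refine Filter.liminf_le_of_le (by isBoundedDefault) ?_
          intro b hb
          obtain ⟨n, hn⟩ := hb.exists
          refine hn.trans ?_
          have hint : Integrable (fun ω => V n ω - g ω) P := (hV n).sub hg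
          rw [← ofReal_integral_eq_lintegral_ofReal hint
            ((hgV n).mono fun ω hω => sub_nonneg.2 hω), integral_sub (hV n) hg]
          exact ENNReal.ofReal_le_ofReal (by linarith [hC n])
  have hint : Integrable (fun ω => W ω - g ω) P := by
    refine ⟨(hWm.sub hg.aemeasurable).aestronglyMeasurable, ?_⟩
    refine lt_of_le_of_lt (le_of_eq ?_) (lt_of_le_of_lt hFat ENNReal.ofReal_lt_top)
    refine lintegral_congr_ae ?_
    filter_upwards [hgW] with ω h
    rw [Real.enorm_of_nonneg (sub_nonneg.2 h)]
  have hWi : Integrable W P := by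
    have := hint.add hg
    refine this.congr (.of_forall fun ω => ?_)
    simp
  refine ⟨hWi, ?_⟩
  rw [← ofReal_integral_eq_lintegral_ofReal hint (hgW.mono fun ω hω => sub_nonneg.2 hω),
    integral_sub hWi hg] at hFat
  have hCg : 0 ≤ C - ∫ ω, g ω ∂P := by
    have := integral_mono_ae hg (hV 0) (hgV 0)
    linarith [hC 0]
  have := (ENNReal.ofReal_le_ofReal_iff hCg).1 hFat
  linarith

end Fatou

section Dot

variable {d : ℕ}

theorem dotd_add_left (a b c : Fin d → ℝ) : dotd (a + b) c = dotd a c + dotd b c := by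
  simp [dotd, add_mul, Finset.sum_add_distrib]

theorem dotd_sub_left (a b c : Fin d → ℝ) : dotd (a - b) c = dotd a c - dotd b c := by
  simp [dotd, sub_mul, Finset.sum_sub_distrib]

theorem dotd_sub_right (a b c : Fin d → ℝ) : dotd a (b - c) = dotd a b - dotd a c := by
  simp [dotd, mul_sub, Finset.sum_sub_distrib]

theorem dotd_smul_left (r : ℝ) (a c : Fin d → ℝ) : dotd (r • a) c = r * dotd a c := by
  simp [dotd, Finset.mul_sum, mul_assoc]

theorem continuous_dotd : Continuous fun p : (Fin d → ℝ) × (Fin d → ℝ) => dotd p.1 p.2 := by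
  unfold dotd; fun_prop

theorem Measurable.dotd {Ω : Type*} {m : MeasurableSpace Ω} {a b : Ω → Fin d → ℝ}
    (ha : Measurable a) (hb : Measurable b) : Measurable fun ω => dotd (a ω) (b ω) :=
  continuous_dotd.measurable.comp (ha.prodMk hb)

end Dot

section Selection

variable {Ω : Type*} {m : MeasurableSpace Ω} {E : Type*} [PseudoMetricSpace E]
  [TopologicalSpace.SeparableSpace E] [MeasurableSpace E] [BorelSpace E]

theorem exists_measurable_refine {F : Ω → Set E}
    (hF : ∀ O : Set E, IsOpen O → MeasurableSet {ω | (F ω ∩ O).Nonempty})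
    {g : Ω → E} (hg : Measurable g) {r : ℝ} (hr : 0 < r)
    (h : ∀ ω, (F ω ∩ Metric.ball (g ω) r).Nonempty) :
    ∃ g' : Ω → E, Measurable g' ∧ (∀ ω, (F ω ∩ Metric.ball (g' ω) (r / 2)).Nonempty) ∧
      ∀ ω, dist (g ω) (g' ω) ≤ 2 * r := by
  classical
  rcases isEmpty_or_nonempty Ω with hΩ | ⟨⟨ω₀⟩⟩
  · exact ⟨g, hg, fun ω => (hΩ.false ω).elim, fun ω => (hΩ.false ω).elim⟩
  have : Nonempty E := ⟨g ω₀⟩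
  let q := TopologicalSpace.denseSeq E
  have hex : ∀ ω, ∃ j, (F ω ∩ Metric.ball (q j) (r / 2)).Nonempty ∧ dist (g ω) (q j) < 2 * r := by
    intro ω
    obtain ⟨p, hpF, hp⟩ := h ω
    obtain ⟨j, hj⟩ := (TopologicalSpace.denseRange_denseSeq E).exists_dist_lt p (half_pos hr)
    refine ⟨j, ⟨p, hpF, hj⟩, ?_⟩
    have := dist_triangle (g ω) p (q j)
    have h2 : dist (g ω) p < r := by rw [dist_comm]; exact hp
    linarith
  refine ⟨fun ω => q (Nat.find (hex ω)), ?_, fun ω => (Nat.find_spec (hex ω)).1,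
    fun ω => (Nat.find_spec (hex ω)).2.le⟩
  refine Measurable.find (f := fun j _ => q j) (fun _ => measurable_const) (fun j => ?_) hex
  exact (hF _ Metric.isOpen_ball).inter
    (measurableSet_lt (hg.dist measurable_const) measurable_const)

theorem exists_measurable_selection_near [CompleteSpace E] {F : Ω → Set E}
    (hcl : ∀ ω, IsClosed (F ω))
    (hF : ∀ O : Set E, IsOpen O → MeasurableSet {ω | (F ω ∩ O).Nonempty})
    {g : Ω → E} (hg : Measurable g) {r : ℝ} (hr : 0 < r)
    (h : ∀ ω, (F ω ∩ Metric.ball (g ω) r).Nonempty) :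
    ∃ f : Ω → E, Measurable f ∧ (∀ ω, f ω ∈ F ω) ∧ ∀ ω, dist (g ω) (f ω) ≤ 4 * r := by
  choose! N hN1 hN2 hN3 using fun (g : Ω → E) (hg : Measurable g) (r : ℝ) (hr : 0 < r)
    (h : ∀ ω, (F ω ∩ Metric.ball (g ω) r).Nonempty) => exists_measurable_refine hF hg hr h
  let G : ℕ → Ω → E := fun n => Nat.rec g (fun n f => N f (r / 2 ^ n)) n
  have hG0 : G 0 = g := rfl
  have hGs : ∀ n, G (n + 1) = N (G n) (r / 2 ^ n) := fun n => rfl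
  have hr' : ∀ n : ℕ, 0 < r / 2 ^ n := fun n => by positivity
  have hG : ∀ n, Measurable (G n) ∧ ∀ ω, (F ω ∩ Metric.ball (G n ω) (r / 2 ^ n)).Nonempty := by
    intro n
    induction n with
    | zero => simpa [hG0] using ⟨hg, h⟩
    | succ n ih =>
      rw [hGs]
      refine ⟨hN1 _ ih.1 _ (hr' n) ih.2, fun ω => ?_⟩
      have := hN2 _ ih.1 _ (hr' n) ih.2 ω
      rwa [div_div, ← pow_succ] at this
  have hd : ∀ ω n, dist (G n ω) (G (n + 1) ω) ≤ 4 * r / 2 / 2 ^ n := by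
    intro ω n
    rw [hGs]
    refine (hN3 _ (hG n).1 _ (hr' n) (hG n).2 ω).trans (le_of_eq ?_)
    ring
  choose f hf using fun ω => cauchySeq_tendsto_of_complete (cauchySeq_of_le_geometric_two (hd ω))
  refine ⟨f, measurable_of_tendsto_metrizable (fun n => (hG n).1) (tendsto_pi_nhds.2 hf), ?_, ?_⟩
  · intro ω
    choose p hp1 hp2 using fun n => (hG n).2 ω
    refine (hcl ω).mem_of_tendsto (b := Filter.atTop) (f := p) ?_ (.of_forall hp1)
    refine (hf ω).congr_dist ?_
    refine squeeze_zero (fun _ => dist_nonneg) (fun n => ?_)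
      (tendsto_const_nhds.div_atTop (tendsto_pow_atTop_atTop_of_one_lt (one_lt_two (α := ℝ))) :
        Filter.Tendsto (fun n : ℕ => r / 2 ^ n) Filter.atTop (nhds 0))
    rw [dist_comm]
    exact (hp2 n).le
  · intro ω
    exact dist_le_of_le_geometric_two_of_tendsto₀ (hd ω) (hf ω)

/-- Castaing representation of a closed-valued measurable multifunction. -/
theorem exists_castaing [CompleteSpace E] [Nonempty E] {F : Ω → Set E}
    (hcl : ∀ ω, IsClosed (F ω))
    (hF : ∀ O : Set E, IsOpen O → MeasurableSet {ω | (F ω ∩ O).Nonempty}) :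
    ∃ f : ℕ → Ω → E, (∀ n, Measurable (f n)) ∧ ∀ ω, (F ω).Nonempty →
      (∀ n, f n ω ∈ F ω) ∧ F ω ⊆ closure (Set.range fun n => f n ω) := by
  classical
  let F' : Ω → Set E := fun ω => if (F ω).Nonempty then F ω else Set.univ
  have hF'1 : ∀ ω, (F ω).Nonempty → F' ω = F ω := fun ω h => if_pos h
  have hF'2 : ∀ ω, ¬ (F ω).Nonempty → F' ω = Set.univ := fun ω h => if_neg h
  have hne : ∀ ω, (F' ω).Nonempty := by
    intro ω
    by_cases h : (F ω).Nonempty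
    · rwa [hF'1 ω h]
    · rw [hF'2 ω h]; exact Set.univ_nonempty
  have hcl' : ∀ ω, IsClosed (F' ω) := by
    intro ω
    by_cases h : (F ω).Nonempty
    · rw [hF'1 ω h]; exact hcl ω
    · rw [hF'2 ω h]; exact isClosed_univ
  have hF' : ∀ O : Set E, IsOpen O → MeasurableSet {ω | (F' ω ∩ O).Nonempty} := by
    intro O hO
    have hD := hF Set.univ isOpen_univ
    simp only [Set.inter_univ] at hD
    have : {ω | (F' ω ∩ O).Nonempty} =
        {ω | (F ω ∩ O).Nonempty} ∪ ({ω | (F ω).Nonempty}ᶜ ∩ {_ω | O.Nonempty}) := by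
      ext ω
      by_cases h : (F ω).Nonempty
      · simp [hF'1 ω h, h]
      · have h' := Set.not_nonempty_iff_eq_empty.1 h
        simp [hF'2 ω h, h']
    rw [this]
    exact (hF O hO).union (hD.compl.inter (MeasurableSet.const _))
  let q := TopologicalSpace.denseSeq E
  have hq := TopologicalSpace.denseRange_denseSeq E
  have hex : ∀ ω, ∃ j, (F' ω ∩ Metric.ball (q j) 1).Nonempty := by
    intro ω
    obtain ⟨p, hp⟩ := hne ω
    obtain ⟨j, hj⟩ := hq.exists_dist_lt p one_pos
    exact ⟨j, p, hp, hj⟩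
  obtain ⟨s, hs, hsF, -⟩ := exists_measurable_selection_near hcl' hF'
    (g := fun ω => q (Nat.find (hex ω)))
    (Measurable.find (f := fun j _ => q j) (fun _ => measurable_const)
      (fun j => hF' _ Metric.isOpen_ball) hex) one_pos (fun ω => Nat.find_spec (hex ω))
  have hsel : ∀ i k : ℕ, ∃ f : Ω → E, Measurable f ∧ (∀ ω, f ω ∈ F' ω) ∧
      ∀ ω, (F' ω ∩ Metric.ball (q i) (1 / (k + 1))).Nonempty →
        dist (q i) (f ω) ≤ 4 * (1 / (k + 1)) := by
    intro i k
    have hk : (0 : ℝ) < 1 / (k + 1) := Nat.one_div_pos_of_nat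
    let D := {ω | (F' ω ∩ Metric.ball (q i) (1 / ((k : ℝ) + 1))).Nonempty}
    obtain ⟨f, hf1, hf2, hf3⟩ := exists_measurable_selection_near hcl' hF'
      (g := D.piecewise (fun _ => q i) s)
      (Measurable.piecewise (hF' _ Metric.isOpen_ball) measurable_const hs) hk (fun ω => by
        by_cases h : ω ∈ D
        · rw [Set.piecewise_eq_of_mem _ _ _ h]; exact h
        · rw [Set.piecewise_eq_of_notMem _ _ _ h]
          exact ⟨s ω, hsF ω, Metric.mem_ball_self hk⟩)
    refine ⟨f, hf1, hf2, fun ω h => ?_⟩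
    have := hf3 ω
    rwa [Set.piecewise_eq_of_mem D _ _ h] at this
  choose f hf1 hf2 hf3 using hsel
  refine ⟨fun n => f n.unpair.1 n.unpair.2, fun n => hf1 _ _, fun ω hω => ?_⟩
  rw [← hF'1 ω hω]
  refine ⟨fun n => hf2 _ _ ω, fun p hp => ?_⟩
  rw [Metric.mem_closure_range_iff]
  intro ε hε
  obtain ⟨k, hk⟩ := exists_nat_one_div_lt (show 0 < ε / 5 by positivity)
  obtain ⟨i, hi⟩ := hq.exists_dist_lt p (Nat.one_div_pos_of_nat (α := ℝ) (n := k))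
  refine ⟨Nat.pair i k, ?_⟩
  have h1 := hf3 i k ω ⟨p, hp, hi⟩
  have h2 := dist_triangle p (q i) (f i k ω)
  simp only [Nat.unpair_pair]
  have hi' : dist p (q i) < 1 / ((k : ℝ) + 1) := hi
  linarith

end Selection

theorem exists_lt_of_dense_range {E : Type*} [TopologicalSpace E] {F : Set E} {f : ℕ → E}
    (hd : F ⊆ closure (Set.range f))
    {val : E → ℝ} (hval : Continuous val) {p : E} (hp : p ∈ F) {τ : ℝ} (hτ : τ < val p) :
    ∃ n, τ < val (f n) := by
  have hO : IsOpen {e | τ < val e} := isOpen_lt continuous_const hval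
  obtain ⟨e, he, n, rfl⟩ := mem_closure_iff.1 (hd hp) _ hO hτ
  exact ⟨n, he⟩

section SectionMeasurability

variable {Ω : Type*} {m : MeasurableSpace Ω} {A B : Type*} [PseudoMetricSpace A] [MetricSpace B]
  [MeasurableSpace A] [BorelSpace A] [SecondCountableTopology A]
  [MeasurableSpace B] [BorelSpace B] [Nonempty B]

theorem measurableSet_section_inter_compact {F : Ω → Set (A × B)} (hcl : ∀ ω, IsClosed (F ω))
    {f : ℕ → Ω → A × B} (hf : ∀ n, Measurable (f n)) (hD : MeasurableSet {ω | (F ω).Nonempty})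
    (hfF : ∀ ω, (F ω).Nonempty → (∀ n, f n ω ∈ F ω) ∧ F ω ⊆ closure (Set.range fun n => f n ω))
    {ξ : Ω → A} (hξ : Measurable ξ) {Q : Set B} (hQ : IsCompact Q) :
    MeasurableSet {ω | ∃ b ∈ Q, (ξ ω, b) ∈ F ω} := by
  rcases Q.eq_empty_or_nonempty with rfl | hQne
  · simp
  have heq : {ω | ∃ b ∈ Q, (ξ ω, b) ∈ F ω} = {ω | (F ω).Nonempty} ∩ ⋂ k : ℕ, ⋃ n : ℕ,
      {ω | dist (f n ω).1 (ξ ω) < 1 / (k + 1) ∧ Metric.infDist (f n ω).2 Q < 1 / (k + 1)} := by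
    ext ω
    simp only [Set.mem_ofPred_eq, Set.mem_inter_iff, Set.mem_iInter, Set.mem_iUnion]
    constructor
    · rintro ⟨b, hb, hbF⟩
      have hne : (F ω).Nonempty := ⟨_, hbF⟩
      refine ⟨hne, fun k => ?_⟩
      obtain ⟨n, hn⟩ := Metric.mem_closure_range_iff.1 ((hfF ω hne).2 hbF) _
        (Nat.one_div_pos_of_nat (α := ℝ) (n := k))
      rw [dist_comm, Prod.dist_eq, max_lt_iff] at hn
      exact ⟨n, hn.1, lt_of_le_of_lt (Metric.infDist_le_dist_of_mem hb) hn.2⟩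
    · rintro ⟨hne, h⟩
      choose n hn1 hn2 using h
      choose b hbQ hb using fun k => (Metric.infDist_lt_iff hQne).1 (hn2 k)
      obtain ⟨a, haQ, φ, hφ, ha⟩ := hQ.tendsto_subseq hbQ
      refine ⟨a, haQ, ?_⟩
      have hz : Filter.Tendsto (fun k : ℕ => 1 / ((φ k : ℝ) + 1)) Filter.atTop (nhds 0) :=
        tendsto_one_div_add_atTop_nhds_zero_nat.comp hφ.tendsto_atTop
      refine (hcl ω).mem_of_tendsto (b := Filter.atTop) (f := fun k => f (n (φ k)) ω) ?_
        (.of_forall fun k => (hfF ω hne).1 _)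
      suffices h : Filter.Tendsto (fun k => ((f (n (φ k)) ω).1, (f (n (φ k)) ω).2)) Filter.atTop
        (nhds (ξ ω, a)) from h
      refine Filter.Tendsto.prodMk_nhds ?_ ?_
      · rw [tendsto_iff_dist_tendsto_zero]
        exact squeeze_zero (fun _ => dist_nonneg) (fun k => (hn1 (φ k)).le) hz
      · refine ha.congr_dist ?_
        refine squeeze_zero (fun _ => dist_nonneg) (fun k => ?_) hz
        rw [dist_comm]
        exact (hb (φ k)).le
  rw [heq]
  refine hD.inter (MeasurableSet.iInter fun k => MeasurableSet.iUnion fun n => ?_)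
  refine (measurableSet_lt ((hf n).fst.dist hξ) measurable_const).inter ?_
  exact measurableSet_lt ((Metric.continuous_infDist_pt Q).measurable.comp (hf n).snd)
    measurable_const

theorem measurableSet_section_inter_open [ProperSpace B] {F : Ω → Set (A × B)}
    (hcl : ∀ ω, IsClosed (F ω))
    {f : ℕ → Ω → A × B} (hf : ∀ n, Measurable (f n)) (hD : MeasurableSet {ω | (F ω).Nonempty})
    (hfF : ∀ ω, (F ω).Nonempty → (∀ n, f n ω ∈ F ω) ∧ F ω ⊆ closure (Set.range fun n => f n ω))
    {ξ : Ω → A} (hξ : Measurable ξ) {O : Set B} (hO : IsOpen O) :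
    MeasurableSet {ω | ({b | (ξ ω, b) ∈ F ω} ∩ O).Nonempty} := by
  obtain ⟨G, hG1, hG2, hG3, -⟩ := hO.exists_iUnion_isClosed
  obtain ⟨b₀⟩ : Nonempty B := inferInstance
  have heq : {ω | ({b | (ξ ω, b) ∈ F ω} ∩ O).Nonempty} = ⋃ n : ℕ, ⋃ k : ℕ,
      {ω | ∃ b ∈ Metric.closedBall b₀ k ∩ G n, (ξ ω, b) ∈ F ω} := by
    ext ω
    simp only [Set.mem_ofPred_eq, Set.mem_iUnion]
    constructor
    · rintro ⟨b, hb, hbO⟩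
      rw [← hG3, Set.mem_iUnion] at hbO
      obtain ⟨n, hn⟩ := hbO
      obtain ⟨k, hk⟩ := exists_nat_ge (dist b b₀)
      exact ⟨n, k, b, ⟨hk, hn⟩, hb⟩
    · rintro ⟨n, k, b, ⟨-, hb⟩, hbF⟩
      exact ⟨b, hbF, hG2 n hb⟩
  rw [heq]
  exact MeasurableSet.iUnion fun n => MeasurableSet.iUnion fun k =>
    measurableSet_section_inter_compact hcl hf hD hfF hξ
      ((isCompact_closedBall b₀ k).inter_right (hG1 n))

end SectionMeasurability

section Epigraph

variable {Ω : Type*} {m : MeasurableSpace Ω} {d : ℕ}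
  {k : (Fin d → ℝ) → (Fin d → ℝ) → Ω → EReal}

/-- The epigraph of `k(·,·,ω)`, as a subset of `ℝ^d × (ℝ^d × ℝ)`. -/
def epiK (k : (Fin d → ℝ) → (Fin d → ℝ) → Ω → EReal) (ω : Ω) :
    Set ((Fin d → ℝ) × ((Fin d → ℝ) × ℝ)) :=
  {p | k p.1 p.2.1 ω ≤ (p.2.2 : EReal)}

theorem IsConvexNormalIntegrand.isClosed_epiK (hk : IsConvexNormalIntegrand m k) (ω : Ω) :
    IsClosed (epiK k ω) := by
  have h := (hk.lsc ω).isClosed_epigraph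
  have hc : Continuous fun p : (Fin d → ℝ) × ((Fin d → ℝ) × ℝ) =>
      (((p.1, p.2.1), (p.2.2 : EReal)) : ((Fin d → ℝ) × (Fin d → ℝ)) × EReal) := by
    have := continuous_coe_real_ereal
    fun_prop
  exact h.preimage hc

theorem IsConvexNormalIntegrand.measurableSet_epiK (hk : IsConvexNormalIntegrand m k)
    {O : Set ((Fin d → ℝ) × ((Fin d → ℝ) × ℝ))} (hO : IsOpen O) :
    MeasurableSet {ω | (epiK k ω ∩ O).Nonempty} := by
  have hc : Continuous fun p : ((Fin d → ℝ) × (Fin d → ℝ)) × ℝ => (p.1.1, (p.1.2, p.2)) := by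
    fun_prop
  convert hk.measurable_epi _ (hO.preimage hc) using 1
  ext ω
  constructor
  · rintro ⟨⟨x, u, a⟩, h1, h2⟩
    exact ⟨((x, u), a), h2, h1⟩
  · rintro ⟨⟨⟨x, u⟩, a⟩, h1, h2⟩
    exact ⟨(x, u, a), h2, h1⟩

theorem epiK_nonempty {ω : Ω} {x u : Fin d → ℝ} (h : k x u ω < ⊤) : (epiK k ω).Nonempty :=
  ⟨(x, u, (k x u ω).toReal), EReal.le_coe_toReal h.ne⟩

/-- Measurable affine-minorant data of the conjugate: a sequence of measurable points of the
epigraph that computes every linear supremum over the epigraph. -/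
theorem IsConvexNormalIntegrand.exists_seq (hk : IsConvexNormalIntegrand m k) :
    ∃ (x u : ℕ → Ω → Fin d → ℝ) (α : ℕ → Ω → ℝ),
      (∀ n, Measurable (x n)) ∧ (∀ n, Measurable (u n)) ∧ (∀ n, Measurable (α n)) ∧
      ∀ ω, (∃ x u, k x u ω < ⊤) → (∀ n, k (x n ω) (u n ω) ω ≤ α n ω) ∧
        ∀ a b v y τ, k a b ω < ⊤ → τ < dotd a v + dotd b y - (k a b ω).toReal →
          ∃ n, τ < dotd (x n ω) v + dotd (u n ω) y - α n ω := by
  obtain ⟨f, hf, hfF⟩ := exists_castaing hk.isClosed_epiK (fun O hO => hk.measurableSet_epiK hO)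
  refine ⟨fun n ω => (f n ω).1, fun n ω => (f n ω).2.1, fun n ω => (f n ω).2.2,
    fun n => (hf n).fst, fun n => (hf n).snd.fst, fun n => (hf n).snd.snd, ?_⟩
  rintro ω ⟨x, u, hxu⟩
  obtain ⟨h1, h2⟩ := hfF ω (epiK_nonempty hxu)
  refine ⟨h1, fun a b v y τ hab hτ => ?_⟩
  have hc : Continuous fun p : (Fin d → ℝ) × ((Fin d → ℝ) × ℝ) =>
      dotd p.1 v + dotd p.2.1 y - p.2.2 := by unfold dotd; fun_prop
  exact exists_lt_of_dense_range h2 hc (p := (a, b, (k a b ω).toReal))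
    (EReal.le_coe_toReal hab.ne) hτ

theorem IsConvexNormalIntegrand.exists_section_seq (hk : IsConvexNormalIntegrand m k)
    {ξ : Ω → Fin d → ℝ} (hξ : Measurable ξ) :
    ∃ (u : ℕ → Ω → Fin d → ℝ) (α : ℕ → Ω → ℝ),
      (∀ n, Measurable (u n)) ∧ (∀ n, Measurable (α n)) ∧
      ∀ ω, (∃ u, k (ξ ω) u ω < ⊤) → (∀ n, k (ξ ω) (u n ω) ω ≤ α n ω) ∧
        ∀ b y τ, k (ξ ω) b ω < ⊤ → τ < dotd b y - (k (ξ ω) b ω).toReal →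
          ∃ n, τ < dotd (u n ω) y - α n ω := by
  obtain ⟨f, hf, hfF⟩ := exists_castaing hk.isClosed_epiK (fun O hO => hk.measurableSet_epiK hO)
  have hD := hk.measurableSet_epiK isOpen_univ
  simp only [Set.inter_univ] at hD
  have hcl : ∀ ω, IsClosed {b | (ξ ω, b) ∈ epiK k ω} := fun ω =>
    (hk.isClosed_epiK ω).preimage (by fun_prop)
  obtain ⟨g, hg, hgF⟩ := exists_castaing hcl (fun O hO =>
    measurableSet_section_inter_open hk.isClosed_epiK hf hD hfF hξ hO)
  refine ⟨fun n ω => (g n ω).1, fun n ω => (g n ω).2, fun n => (hg n).fst, fun n => (hg n).snd, ?_⟩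
  rintro ω ⟨u, hu⟩
  obtain ⟨h1, h2⟩ := hgF ω ⟨(u, (k (ξ ω) u ω).toReal), EReal.le_coe_toReal hu.ne⟩
  refine ⟨h1, fun b y τ hb hτ => ?_⟩
  have hc : Continuous fun p : (Fin d → ℝ) × ℝ => dotd p.1 y - p.2 := by unfold dotd; fun_prop
  exact exists_lt_of_dense_range h2 hc (p := (b, (k (ξ ω) b ω).toReal))
    (EReal.le_coe_toReal hb.ne) hτ

end Epigraph

theorem exists_measurable_index {Ω : Type*} {m : MeasurableSpace Ω} {β : ℕ → Ω → ℝ}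
    (hβ : ∀ n, Measurable (β n)) {τ : Ω → ℝ} (hτ : Measurable τ) :
    ∃ J : Ω → ℕ, Measurable J ∧ ∀ ω, (∃ n, τ ω < β n ω) → τ ω < β (J ω) ω := by
  classical
  have hex : ∀ ω, ∃ n, τ ω < β n ω ∨ ¬ ∃ n, τ ω < β n ω := by
    intro ω
    by_cases h : ∃ n, τ ω < β n ω
    · obtain ⟨n, hn⟩ := h
      exact ⟨n, Or.inl hn⟩
    · exact ⟨0, Or.inr h⟩
  refine ⟨fun ω => Nat.find (hex ω), measurable_find hex fun n => ?_, fun ω hω => ?_⟩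
  · have h1 : MeasurableSet {ω | ∃ n, τ ω < β n ω} := by
      rw [Set.ofPred_exists]
      exact MeasurableSet.iUnion fun n => measurableSet_lt hτ (hβ n)
    exact (measurableSet_lt hτ (hβ n)).union h1.compl
  · exact (Nat.find_spec (hex ω)).resolve_right (not_not.2 hω)

theorem Measurable.comp_index {Ω E : Type*} {m : MeasurableSpace Ω} [MeasurableSpace E]
    {f : ℕ → Ω → E} (hf : ∀ n, Measurable (f n)) {J : Ω → ℕ} (hJ : Measurable J) :
    Measurable fun ω => f (J ω) ω :=
  (measurable_from_prod_countable_right (f := fun p : ℕ × Ω => f p.1 p.2) hf).comp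
    (hJ.prodMk measurable_id)

section Barycenter

theorem exists_linearMap_nonpos_of_notMem {E : Type*} [NormedAddCommGroup E]
    [NormedSpace ℝ E] [FiniteDimensional ℝ E] {D : Set E} (hD : Convex ℝ D) (hne : D.Nonempty)
    (h0 : (0 : E) ∉ D) : ∃ f : E →ₗ[ℝ] ℝ, f ≠ 0 ∧ ∀ c ∈ D, f c ≤ 0 := by
  rcases (interior D).eq_empty_or_nonempty with hi | hi
  · have h1 : affineSpan ℝ D ≠ ⊤ := by
      rw [Ne, ← hD.interior_nonempty_iff_affineSpan_eq_top, hi]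
      simp
    obtain ⟨c₀, hc₀⟩ := hne
    have h2 : (affineSpan ℝ D).direction < ⊤ := by
      rw [lt_top_iff_ne_top, Ne, AffineSubspace.direction_eq_top_iff_of_nonempty
        ⟨c₀, subset_affineSpan ℝ D hc₀⟩]
      exact h1
    obtain ⟨f, hf, hle⟩ := Submodule.exists_le_ker_of_lt_top _ h2
    have hconst : ∀ c ∈ D, f c = f c₀ := by
      intro c hc
      have : c -ᵥ c₀ ∈ (affineSpan ℝ D).direction :=
        AffineSubspace.vsub_mem_direction (subset_affineSpan ℝ D hc) (subset_affineSpan ℝ D hc₀)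
      have := hle this
      rw [LinearMap.mem_ker, vsub_eq_sub, map_sub] at this
      linarith
    rcases le_total (f c₀) 0 with h | h
    · exact ⟨f, hf, fun c hc => by rw [hconst c hc]; exact h⟩
    · refine ⟨-f, neg_ne_zero.2 hf, fun c hc => ?_⟩
      rw [LinearMap.neg_apply, hconst c hc]
      linarith
  · obtain ⟨f, hf⟩ := geometric_hahn_banach_open_point hD.interior isOpen_interior
      (fun h => h0 (interior_subset h))
    refine ⟨f, ?_, fun c hc => ?_⟩
    · rintro h
      obtain ⟨a, ha⟩ := hi
      have h1 := hf a ha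
      have h2 : f a = (f : E →ₗ[ℝ] ℝ) a := rfl
      rw [h2, h] at h1
      simp at h1
    · have hc' : c ∈ closure (interior D) := by
        rw [hD.closure_interior_eq_closure_of_nonempty_interior hi]
        exact subset_closure hc
      have hcl : IsClosed {e | f e ≤ 0} := isClosed_le f.continuous continuous_const
      refine hcl.closure_subset_iff.2 ?_ hc'
      intro a ha
      have := hf a ha
      rw [map_zero] at this
      exact this.le

/-- The barycenter of a probability measure carried by a convex subset (not necessarily closed) of
a finite-dimensional space belongs to that set. -/
theorem Convex.integral_id_mem {E : Type*} [NormedAddCommGroup E] [NormedSpace ℝ E]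
    [FiniteDimensional ℝ E] [MeasurableSpace E] [BorelSpace E] {μ : Measure E}
    [IsProbabilityMeasure μ] {D : Set E} (hD : Convex ℝ D) (hμ : ∀ᵐ η ∂μ, η ∈ D)
    (hint : Integrable (fun η : E => η) μ) : ∫ η, η ∂μ ∈ D := by
  set b := ∫ η, η ∂μ with hb
  suffices h : ∀ (n : ℕ) (V : Submodule ℝ E), Module.finrank ℝ V ≤ n →
      (∀ᵐ η ∂μ, η - b ∈ V) → b ∈ D from h _ ⊤ le_rfl (.of_forall fun _ => trivial)
  intro n
  induction n with
  | zero =>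
    intro V hV hη
    have hV0 : V = ⊥ := Submodule.finrank_eq_zero.1 (Nat.le_zero.1 hV)
    obtain ⟨η, h1, h2⟩ := (hη.and hμ).exists
    rw [hV0, Submodule.mem_bot, sub_eq_zero] at h1
    rwa [← h1]
  | succ n ih =>
    intro V hV hη
    by_contra hbD
    let D' : Set V := {v | b + (v : E) ∈ D}
    have hD' : Convex ℝ D' := by
      intro v hv w hw a c ha hc hac
      have : b + ((a • v + c • w : V) : E) = a • (b + (v : E)) + c • (b + (w : E)) := by
        have : b = a • b + c • b := by rw [← add_smul, hac, one_smul]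
        push_cast
        conv_lhs => rw [this]
        simp only [smul_add]
        abel
      change b + ((a • v + c • w : V) : E) ∈ D
      rw [this]
      exact hD hv hw ha hc hac
    have hne : D'.Nonempty := by
      obtain ⟨η, h1, h2⟩ := (hη.and hμ).exists
      exact ⟨⟨η - b, h1⟩, by simpa [D'] using h2⟩
    obtain ⟨f, hf0, hf⟩ := exists_linearMap_nonpos_of_notMem hD' hne
      (by simpa [D'] using hbD)
    obtain ⟨g, hg⟩ := f.exists_extend
    have hgf : ∀ v : V, g v = f v := fun v => by rw [← hg]; rfl
    let G : E →L[ℝ] ℝ := LinearMap.toContinuousLinearMap g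
    have hG : ∀ e, G e = g e := fun e => rfl
    have hle : ∀ᵐ η ∂μ, 0 ≤ G b - G η := by
      filter_upwards [hη, hμ] with η h1 h2
      have h3 := hf ⟨η - b, h1⟩ (by simpa [D'] using h2)
      rw [← hgf, map_sub] at h3
      rw [hG, hG]
      linarith
    have hGi : Integrable (fun η => G η) μ := G.integrable_comp hint
    have hint0 : ∫ η, (G b - G η) ∂μ = 0 := by
      rw [integral_sub (integrable_const _) hGi, G.integral_comp_comm hint]
      simp [hb]
    have heq := (integral_eq_zero_iff_of_nonneg_ae hle ((integrable_const _).sub hGi)).1 hint0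
    refine hbD (ih (V ⊓ LinearMap.ker g) ?_ ?_)
    · have hlt : V ⊓ LinearMap.ker g < V := by
        refine lt_of_le_of_ne inf_le_left fun h => hf0 ?_
        ext v
        have : (v : E) ∈ V ⊓ LinearMap.ker g := by rw [h]; exact v.2
        rw [← hgf]
        exact LinearMap.mem_ker.1 this.2
      have := Submodule.finrank_lt_finrank_of_lt hlt
      omega
    · filter_upwards [hη, heq] with η h1 h2
      refine Submodule.mem_inf.2 ⟨h1, ?_⟩
      rw [LinearMap.mem_ker, map_sub, ← hG, ← hG]
      have : G b - G η = 0 := h2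
      linarith

variable {Ω β : Type*} {mΩ : MeasurableSpace Ω} {P : Measure Ω} [IsProbabilityMeasure P] {d : ℕ}

theorem bddAbove_condExp_comap {mβ : MeasurableSpace β} {X : Ω → β} (hX : Measurable X)
    {w : ℕ → β → Fin d → ℝ} {α : ℕ → β → ℝ} (hw : ∀ n, Measurable (w n))
    (hα : ∀ n, Measurable (α n)) {y : Ω → Fin d → ℝ} (hy : Measurable y) (hyi : Integrable y P)
    (h : ∀ᵐ ω ∂P, BddAbove (Set.range fun n => dotd (w n (X ω)) (y ω) - α n (X ω))) :
    ∀ᵐ ω ∂P, BddAbove (Set.range fun n =>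
      dotd (w n (X ω)) ((P[y | mβ.comap X]) ω) - α n (X ω)) := by
  let D : β → Set (Fin d → ℝ) := fun b => {η | BddAbove (Set.range fun n => dotd (w n b) η - α n b)}
  have hDm : MeasurableSet {p : β × (Fin d → ℝ) | p.2 ∈ D p.1} :=
    measurableSet_bddAbove_range fun n =>
      (((hw n).comp measurable_fst).dotd measurable_snd).sub ((hα n).comp measurable_fst)
  have h1 : ∀ᵐ p ∂((P.map X).compProd (ProbabilityTheory.condDistrib y X P)), p.2 ∈ D p.1 := by
    rw [ProbabilityTheory.compProd_map_condDistrib hy.aemeasurable,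
      ae_map_iff (hX.prodMk hy).aemeasurable hDm]
    exact h
  have h2 := ae_of_ae_map hX.aemeasurable (Measure.ae_ae_of_ae_compProd h1)
  have h3 := ProbabilityTheory.condExp_ae_eq_integral_condDistrib hX hy.aemeasurable
    (f := fun η : Fin d → ℝ => η) stronglyMeasurable_id hyi
  have h4 : ∀ᵐ ω ∂P, Integrable (fun η : Fin d → ℝ => η)
      (ProbabilityTheory.condDistrib y X P (X ω)) := by
    have := Integrable.condDistrib_ae (μ := P) (X := X) (Y := y)
      (f := fun p : β × (Fin d → ℝ) => p.2)
      hX.aemeasurable hy.aemeasurable (by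
        rw [integrable_map_measure measurable_snd.aestronglyMeasurable (hX.prodMk hy).aemeasurable]
        exact hyi)
    exact this
  filter_upwards [h2, h3, h4] with ω a b c
  have hconv : Convex ℝ (D (X ω)) := by
    rintro η₁ ⟨M₁, h₁⟩ η₂ ⟨M₂, h₂⟩ s t hs ht hst
    refine ⟨s * M₁ + t * M₂, ?_⟩
    rintro _ ⟨n, rfl⟩
    have e₁ := mul_le_mul_of_nonneg_left (h₁ ⟨n, rfl⟩) hs
    have e₂ := mul_le_mul_of_nonneg_left (h₂ ⟨n, rfl⟩) ht
    have e₃ : dotd (w n (X ω)) (s • η₁ + t • η₂) =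
        s * dotd (w n (X ω)) η₁ + t * dotd (w n (X ω)) η₂ := by
      simp only [dotd, Pi.add_apply, Pi.smul_apply, smul_eq_mul, Finset.mul_sum,
        ← Finset.sum_add_distrib]
      exact Finset.sum_congr rfl fun i _ => by ring
    have e₄ : α n (X ω) = s * α n (X ω) + t * α n (X ω) := by rw [← add_mul, hst, one_mul]
    simp only [e₃] at e₁ e₂ ⊢
    nlinarith
  have := hconv.integral_id_mem a c
  rw [← b] at this
  exact this

/-- If a supremum of countably many `m`-measurable affine functions is finite at `y`, then it is
finite at the conditional expectation of `y`. -/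
theorem bddAbove_condExp {m : MeasurableSpace Ω} (hm : m ≤ mΩ)
    {w : ℕ → Ω → Fin d → ℝ} {α : ℕ → Ω → ℝ} (hw : ∀ n, Measurable[m] (w n))
    (hα : ∀ n, Measurable[m] (α n)) {y : Ω → Fin d → ℝ} (hy : Measurable[mΩ] y)
    (hyi : Integrable y P)
    (h : ∀ᵐ ω ∂P, BddAbove (Set.range fun n => dotd (w n ω) (y ω) - α n ω)) :
    ∀ᵐ ω ∂P, BddAbove (Set.range fun n => dotd (w n ω) ((P[y | m]) ω) - α n ω) := by
  have := bddAbove_condExp_comap (mβ := m) (X := id) (measurable_id'' hm) hw hα hy hyi h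
  rwa [MeasurableSpace.comap_id] at this

end Barycenter

section MartingaleTransform

variable {Ω : Type*} {mΩ : MeasurableSpace Ω} {P : Measure Ω}

theorem integrable_mul_condExp_sub [IsProbabilityMeasure P] {m : MeasurableSpace Ω} (hm : m ≤ mΩ)
    {f g : Ω → ℝ} (hf : StronglyMeasurable[m] f) {c : ℝ} (hc : ∀ ω, ‖f ω‖ ≤ c)
    (hg : Integrable g P) :
    Integrable (fun ω => f ω * ((P[g | m]) ω - g ω)) P ∧
      ∫ ω, f ω * ((P[g | m]) ω - g ω) ∂P = 0 := by
  have hfm : AEStronglyMeasurable[mΩ] f P := (hf.mono hm).aestronglyMeasurable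
  have h1 : Integrable (fun ω => f ω * (P[g | m]) ω) P :=
    integrable_condExp.bdd_mul hfm (.of_forall hc)
  have h2 : Integrable (fun ω => f ω * g ω) P := hg.bdd_mul hfm (.of_forall hc)
  simp only [mul_sub]
  refine ⟨h1.sub h2, ?_⟩
  rw [integral_sub h1 h2, sub_eq_zero]
  have h3 := condExp_stronglyMeasurable_mul_of_bound hm hf hg c (.of_forall hc)
  calc ∫ ω, f ω * (P[g | m]) ω ∂P = ∫ ω, (P[f * g | m]) ω ∂P :=
        integral_congr_ae (h3.mono fun ω hω => hω.symm)
    _ = ∫ ω, f ω * g ω ∂P := integral_condExp hm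

theorem condExp_apply_coord {m : MeasurableSpace Ω} {d : ℕ} {η : Ω → Fin d → ℝ}
    (hη : Integrable η P) (i : Fin d) :
    ∀ᵐ ω ∂P, (P[η | m]) ω i = (P[fun ω => η ω i | m]) ω :=
  (ContinuousLinearMap.proj (R := ℝ) (φ := fun _ : Fin d => ℝ) i).comp_condExp_comm hη

/-- The martingale-difference property of `x·(E[η|m] - η)` on `m`-measurable sets where the
`m`-measurable factor `x` is bounded. -/
theorem integrableOn_dotd_condExp_sub [IsProbabilityMeasure P] {m : MeasurableSpace Ω}
    (hm : m ≤ mΩ) {d : ℕ} {x η : Ω → Fin d → ℝ} (hx : Measurable[m] x) (hη : Integrable η P)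
    {B : Set Ω} (hB : MeasurableSet[m] B) {c : ℝ} (hc : ∀ ω ∈ B, ‖x ω‖ ≤ c) :
    IntegrableOn (fun ω => dotd (x ω) ((P[η | m]) ω - η ω)) B P ∧
      ∫ ω in B, dotd (x ω) ((P[η | m]) ω - η ω) ∂P = 0 := by
  have hηi : ∀ i, Integrable (fun ω => η ω i) P := fun i => hη.eval i
  have key : ∀ i, Integrable (fun ω => B.indicator x ω i * ((P[η | m]) ω i - η ω i)) P ∧
      ∫ ω, B.indicator x ω i * ((P[η | m]) ω i - η ω i) ∂P = 0 := by
    intro i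
    have hxi : Measurable[m] fun ω => B.indicator x ω i :=
      (measurable_pi_apply i).comp (hx.indicator hB)
    have hb : ∀ ω, ‖B.indicator x ω i‖ ≤ max c 0 := by
      intro ω
      by_cases h : ω ∈ B
      · rw [Set.indicator_of_mem h]
        exact ((norm_le_pi_norm (x ω) i).trans (hc ω h)).trans (le_max_left _ _)
      · simp [Set.indicator_of_notMem h]
    have h1 := integrable_mul_condExp_sub hm hxi.stronglyMeasurable hb (hηi i)
    have h2 : (fun ω => B.indicator x ω i * ((P[η | m]) ω i - η ω i)) =ᵐ[P]
        fun ω => B.indicator x ω i * ((P[fun ω => η ω i | m]) ω - η ω i) := by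
      filter_upwards [condExp_apply_coord (m := m) hη i] with ω hω
      rw [hω]
    exact ⟨h1.1.congr h2.symm, (integral_congr_ae h2).trans h1.2⟩
  have heq : B.indicator (fun ω => dotd (x ω) ((P[η | m]) ω - η ω)) =
      fun ω => ∑ i, B.indicator x ω i * ((P[η | m]) ω i - η ω i) := by
    ext ω
    by_cases h : ω ∈ B
    · simp [Set.indicator_of_mem h, dotd]
    · simp [Set.indicator_of_notMem h]
  constructor
  · rw [← integrable_indicator_iff (hm _ hB), heq]
    exact integrable_finsetSum _ fun i _ => (key i).1
  · rw [← integral_indicator (hm _ hB), heq, integral_finsetSum _ fun i _ => (key i).1]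
    exact Finset.sum_eq_zero fun i _ => (key i).2

/-- A finite sum of generalized (σ-integrable) submartingale differences whose positive part is
integrable is integrable and has nonnegative expectation. -/
theorem integrable_sum_of_localized {T : ℕ} (ℱ : Filtration (Fin (T + 1)) mΩ)
    {Z : Fin (T + 1) → Ω → ℝ} {A : Fin (T + 1) → ℕ → Set Ω}
    (hA : ∀ t n, MeasurableSet[ℱ t] (A t n)) (hmono : ∀ t, Monotone (A t))
    (hcov : ∀ t ω, ∃ n, ω ∈ A t n) (hi : ∀ t n, IntegrableOn (Z t) (A t n) P)
    (hpos : ∀ t n B, MeasurableSet[ℱ t] B → B ⊆ A t n → 0 ≤ ∫ ω in B, Z t ω ∂P)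
    {g : Ω → ℝ} (hg : Integrable g P) (hle : ∀ᵐ ω ∂P, ∑ t, Z t ω ≤ g ω) :
    Integrable (fun ω => ∑ t, Z t ω) P ∧ 0 ≤ ∫ ω, ∑ t, Z t ω ∂P := by
  classical
  suffices h : ∀ k s : ℕ, s + k = T + 1 → ∀ B : Set Ω, MeasurableSet B →
      (∀ t : Fin (T + 1), s ≤ t → MeasurableSet[ℱ t] B) →
      (∀ t : Fin (T + 1), (t : ℕ) < s → IntegrableOn (Z t) B P) →
      IntegrableOn (fun ω => ∑ t, Z t ω) B P ∧ ∫ ω in B,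
        ∑ t ∈ Finset.univ.filter (fun t : Fin (T + 1) => (t : ℕ) < s), Z t ω ∂P ≤
          ∫ ω in B, ∑ t, Z t ω ∂P by
    have := h (T + 1) 0 (by omega) Set.univ MeasurableSet.univ (fun t _ => MeasurableSet.univ)
      (fun t ht => by omega)
    simpa using this
  intro k
  induction k with
  | zero =>
    intro s hs B hB _ hBi
    have hsT : ∀ t : Fin (T + 1), (t : ℕ) < s := fun t => by omega
    refine ⟨integrable_finsetSum _ fun t _ => hBi t (hsT t), le_of_eq ?_⟩
    simp only [hsT, Finset.filter_true]
  | succ k ih =>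
    intro s hs B hB hBm hBi
    let ts : Fin (T + 1) := ⟨s, by omega⟩
    let S : Ω → ℝ := fun ω => ∑ t ∈ Finset.univ.filter (fun t : Fin (T + 1) => (t : ℕ) < s), Z t ω
    let G : Ω → ℝ := fun ω => ∑ t, Z t ω
    have hS : IntegrableOn S B P :=
      integrable_finsetSum _ fun t ht => hBi t (Finset.mem_filter.1 ht).2
    have hAm : ∀ n, MeasurableSet (A ts n) := fun n => ℱ.le ts _ (hA ts n)
    have hstep : ∀ n, IntegrableOn G (B ∩ A ts n) P ∧
        ∫ ω in B ∩ A ts n, S ω ∂P ≤ ∫ ω in B ∩ A ts n, G ω ∂P := by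
      intro n
      have hZs : IntegrableOn (Z ts) (B ∩ A ts n) P := (hi ts n).mono_set Set.inter_subset_right
      obtain ⟨h1, h2⟩ := ih (s + 1) (by omega) (B ∩ A ts n) (hB.inter (hAm n))
        (fun t ht => (hBm t (by omega)).inter
          (ℱ.mono (show ts ≤ t from Fin.le_def.2 (by simp only [ts]; omega)) _ (hA ts n)))
        (fun t ht => by
          rcases Nat.lt_succ_iff_lt_or_eq.1 ht with h | h
          · exact (hBi t h).mono_set Set.inter_subset_left
          · have : t = ts := Fin.ext h
            rw [this]; exact hZs)
      refine ⟨h1, le_trans ?_ h2⟩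
      have hsplit : ∀ ω,
          ∑ t ∈ Finset.univ.filter (fun t : Fin (T + 1) => (t : ℕ) < s + 1), Z t ω = Z ts ω + S ω := by
        intro ω
        have : Finset.univ.filter (fun t : Fin (T + 1) => (t : ℕ) < s + 1) =
            insert ts (Finset.univ.filter (fun t : Fin (T + 1) => (t : ℕ) < s)) := by
          ext t
          simp only [Finset.mem_filter, Finset.mem_univ, true_and, Finset.mem_insert, ts,
            Fin.ext_iff]
          omega
        rw [this, Finset.sum_insert (by simp [ts])]
      simp only [hsplit]
      rw [integral_add hZs (hS.mono_set Set.inter_subset_left)]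
      linarith [hpos ts n (B ∩ A ts n) ((hBm ts le_rfl).inter (hA ts n)) Set.inter_subset_right]
    have hfat := integrable_and_integral_le_of_tendsto (P := P.restrict B)
      (V := fun n => (A ts n).indicator fun ω => S ω - G ω) (W := fun ω => S ω - G ω)
      (g := fun ω => -(|S ω| + |g ω|)) (C := 0)
      ((hS.abs.add hg.integrableOn.abs).neg)
      (fun n => by
        rw [integrable_indicator_iff (hAm n), IntegrableOn, Measure.restrict_restrict (hAm n),
          Set.inter_comm]
        exact (IntegrableOn.mono_set hS Set.inter_subset_left).sub (hstep n).1)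
      (fun n => by
        filter_upwards [ae_restrict_of_ae hle] with ω hω
        by_cases h : ω ∈ A ts n
        · rw [Set.indicator_of_mem h]
          have hGg : G ω ≤ g ω := hω
          linarith [neg_abs_le (S ω), le_abs_self (g ω)]
        · rw [Set.indicator_of_notMem h]
          linarith [abs_nonneg (S ω), abs_nonneg (g ω)])
      (fun n => by
        rw [integral_indicator (hAm n), Measure.restrict_restrict (hAm n), Set.inter_comm,
          integral_sub (IntegrableOn.mono_set hS Set.inter_subset_left) (hstep n).1]
        linarith [(hstep n).2])
      (.of_forall fun ω => by
        obtain ⟨n, hn⟩ := hcov ts ω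
        refine tendsto_const_nhds.congr' ?_
        filter_upwards [Filter.eventually_ge_atTop n] with k hk
        rw [Set.indicator_of_mem (hmono ts hk hn)])
    have hGi : IntegrableOn G B P := by
      have := Integrable.sub hS hfat.1
      refine this.congr (.of_forall fun ω => ?_)
      simp
    refine ⟨hGi, ?_⟩
    have := hfat.2
    rw [integral_sub hS hGi] at this
    change ∫ ω in B, S ω ∂P ≤ ∫ ω in B, G ω ∂P
    linarith

/-- Expectation of a sum of generalized martingale differences `x_t·(E_t η_t - η_t)` with
integrable positive part. -/
theorem integrable_sum_dotd_condExp_sub [IsProbabilityMeasure P] {T d : ℕ}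
    (ℱ : Filtration (Fin (T + 1)) mΩ) {x η : Fin (T + 1) → Ω → Fin d → ℝ}
    (hx : ∀ t, Measurable[ℱ t] (x t)) (hη : ∀ t, Integrable (η t) P)
    {g : Ω → ℝ} (hg : Integrable g P)
    (hle : ∀ᵐ ω ∂P, ∑ t, dotd (x t ω) ((P[η t | ℱ t]) ω - η t ω) ≤ g ω) :
    Integrable (fun ω => ∑ t, dotd (x t ω) ((P[η t | ℱ t]) ω - η t ω)) P ∧
      0 ≤ ∫ ω, ∑ t, dotd (x t ω) ((P[η t | ℱ t]) ω - η t ω) ∂P := by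
  refine integrable_sum_of_localized ℱ (A := fun t n => {ω | ‖x t ω‖ ≤ n}) ?_ ?_ ?_ ?_ ?_ hg hle
  · intro t n
    exact measurableSet_le (measurable_norm.comp (hx t)) measurable_const
  · intro t a b hab ω hω
    exact le_trans (show ‖x t ω‖ ≤ a from hω) (by exact_mod_cast hab)
  · intro t ω
    exact exists_nat_ge ‖x t ω‖
  · intro t n
    exact (integrableOn_dotd_condExp_sub (ℱ.le t) (hx t) (hη t)
      (measurableSet_le (measurable_norm.comp (hx t)) measurable_const) (c := n)
      fun ω hω => hω).1
  · intro t n B hB hBs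
    exact (integrableOn_dotd_condExp_sub (ℱ.le t) (hx t) (hη t) hB (c := n)
      fun ω hω => hBs hω).2.ge

end MartingaleTransform

section DualGap

variable {Ω : Type*} {d T : ℕ}

/-- The real-valued Fenchel expression `x·v + w·y - k(x,w,ω)`. -/
def fenchelTerm (k : (Fin d → ℝ) → (Fin d → ℝ) → Ω → EReal) (v y x w : Fin d → ℝ) (ω : Ω) : ℝ :=
  dotd x v + dotd w y - (k x w ω).toReal

/-- The sum over time of the Fenchel expressions along the processes `x`, `w`. -/
def fenchelSum (K : Fin (T + 1) → (Fin d → ℝ) → (Fin d → ℝ) → Ω → EReal)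
    (v y x w : Ω → Fin (T + 1) → Fin d → ℝ) (ω : Ω) : ℝ :=
  ∑ t, fenchelTerm (K t) (v ω t) (y ω t) (x ω t) (w ω t) ω

/-- All stage costs are almost surely finite along `(x, w)`. -/
def StageFinite {mΩ : MeasurableSpace Ω} (P : Measure Ω)
    (K : Fin (T + 1) → (Fin d → ℝ) → (Fin d → ℝ) → Ω → EReal)
    (x w : Ω → Fin (T + 1) → Fin d → ℝ) : Prop :=
  ∀ t, ∀ᵐ ω ∂P, K t (x ω t) (w ω t) ω < ⊤

theorem fenchelSum_eq (K : Fin (T + 1) → (Fin d → ℝ) → (Fin d → ℝ) → Ω → EReal)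
    (v y x w : Ω → Fin (T + 1) → Fin d → ℝ) (ω : Ω) :
    fenchelSum K v y x w ω =
      dotB (x ω) (v ω) + dotB (w ω) (y ω) - ∑ t, (K t (x ω t) (w ω t) ω).toReal := by
  simp only [fenchelSum, fenchelTerm, dotB, Finset.sum_sub_distrib, Finset.sum_add_distrib]

theorem IsConvexNormalIntegrand.measurable_comp {m m' : MeasurableSpace Ω} (hmm : m ≤ m')
    {k : (Fin d → ℝ) → (Fin d → ℝ) → Ω → EReal} (hk : IsConvexNormalIntegrand m k)
    {x w : Ω → Fin d → ℝ} (hx : Measurable[m'] x) (hw : Measurable[m'] w) :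
    Measurable[m'] fun ω => k (x ω) (w ω) ω := by
  have h1 : Measurable[m', MeasurableSpace.prod inferInstance m]
      (fun ω => (((x ω, w ω), ω) : ((Fin d → ℝ) × (Fin d → ℝ)) × Ω)) :=
    @Measurable.prodMk _ m' _ _ _ m _ _ (hx.prodMk hw) (measurable_id'' hmm)
  exact hk.measurable.comp h1

theorem IsConvexNormalIntegrand.measurable_fenchelTerm {m m' : MeasurableSpace Ω} (hmm : m ≤ m')
    {k : (Fin d → ℝ) → (Fin d → ℝ) → Ω → EReal} (hk : IsConvexNormalIntegrand m k)
    {v y x w : Ω → Fin d → ℝ} (hv : Measurable[m'] v) (hy : Measurable[m'] y)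
    (hx : Measurable[m'] x) (hw : Measurable[m'] w) :
    Measurable[m'] fun ω => fenchelTerm k (v ω) (y ω) (x ω) (w ω) ω :=
  ((hx.dotd hv).add (hw.dotd hy)).sub (hk.measurable_comp hmm hx hw).ereal_toReal

theorem IsConvexNormalIntegrand.fenchelTerm_concave {m : MeasurableSpace Ω}
    {k : (Fin d → ℝ) → (Fin d → ℝ) → Ω → EReal} (hk : IsConvexNormalIntegrand m k)
    (v y : Fin d → ℝ) {x₁ x₂ w₁ w₂ : Fin d → ℝ} {ω : Ω} (h₁ : k x₁ w₁ ω < ⊤) (h₂ : k x₂ w₂ ω < ⊤)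
    {a b : ℝ} (ha : 0 < a) (hb : 0 < b) (hab : a + b = 1) :
    k (a • x₁ + b • x₂) (a • w₁ + b • w₂) ω < ⊤ ∧
      a * fenchelTerm k v y x₁ w₁ ω + b * fenchelTerm k v y x₂ w₂ ω ≤
        fenchelTerm k v y (a • x₁ + b • x₂) (a • w₁ + b • w₂) ω := by
  have hc := hk.convex ω a b x₁ x₂ w₁ w₂ ha hb hab
  rw [← EReal.coe_toReal h₁.ne (hk.ne_bot _ _ _), ← EReal.coe_toReal h₂.ne (hk.ne_bot _ _ _),
    ← EReal.coe_mul, ← EReal.coe_mul, ← EReal.coe_add] at hc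
  have hlt : k (a • x₁ + b • x₂) (a • w₁ + b • w₂) ω < ⊤ := lt_of_le_of_lt hc (EReal.coe_lt_top _)
  refine ⟨hlt, ?_⟩
  rw [← EReal.coe_toReal hlt.ne (hk.ne_bot _ _ _), EReal.coe_le_coe_iff] at hc
  simp only [fenchelTerm, dotd_add_left, dotd_smul_left]
  linarith

theorem EReal.sum_eq_coe_sum_toReal {ι : Type*} (s : Finset ι) {f : ι → EReal}
    (h1 : ∀ i ∈ s, f i ≠ ⊥) (h2 : ∀ i ∈ s, f i ≠ ⊤) :
    ∑ i ∈ s, f i = ((∑ i ∈ s, (f i).toReal : ℝ) : EReal) := by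
  induction s using Finset.cons_induction with
  | empty => simp
  | cons a s ha ih =>
    rw [Finset.sum_cons, Finset.sum_cons, EReal.coe_add, ih (fun i hi => h1 i (by simp [hi]))
      (fun i hi => h2 i (by simp [hi])), EReal.coe_toReal (h2 a (by simp)) (h1 a (by simp))]

theorem EReal.ne_top_of_sum_lt_top {ι : Type*} (s : Finset ι) {f : ι → EReal}
    (h1 : ∀ i ∈ s, f i ≠ ⊥) (h2 : ∑ i ∈ s, f i < ⊤) : ∀ i ∈ s, f i < ⊤ := by
  classical
  intro i hi
  rw [lt_top_iff_ne_top]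
  intro htop
  rw [← Finset.add_sum_erase s f hi, htop] at h2
  have hb : ∀ r ⊆ s, ∑ j ∈ r, f j ≠ ⊥ := by
    intro r
    induction r using Finset.cons_induction with
    | empty => simp
    | cons a r ha ih =>
      intro hr
      rw [Finset.sum_cons]
      rw [Ne, EReal.add_eq_bot_iff, not_or]
      exact ⟨h1 a (hr (by simp)), ih fun j hj => hr (by simp [hj])⟩
  rw [EReal.top_add_of_ne_bot (hb _ (Finset.erase_subset _ _))] at h2
  exact lt_irrefl _ h2

/-- Discrete integration by parts with `x_{-1} = 0` and `y_{T+1} = 0`. -/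
theorem sum_dotd_deltaX (x y : Fin (T + 1) → Fin d → ℝ) :
    ∑ t, dotd (deltaX x t) (y t) = -∑ t, dotd (x t) (deltaNext y t) := by
  have h1 : ∑ t : Fin (T + 1), dotd (if (t : ℕ) = 0 then 0 else
      x ⟨(t : ℕ) - 1, Nat.lt_of_le_of_lt (Nat.sub_le _ _) t.isLt⟩) (y t) =
      ∑ i : Fin T, dotd (x i.castSucc) (y i.succ) := by
    rw [Fin.sum_univ_succ]
    simp [dotd]
    rfl
  have h2 : ∑ t : Fin (T + 1), dotd (x t) (if h : (t : ℕ) = T then 0 else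
      y ⟨(t : ℕ) + 1, Nat.succ_lt_succ (Nat.lt_of_le_of_ne (Nat.lt_succ_iff.mp t.isLt) h)⟩) =
      ∑ i : Fin T, dotd (x i.castSucc) (y i.succ) := by
    rw [Fin.sum_univ_castSucc]
    have : ∀ i : Fin T, (i : ℕ) ≠ T := fun i => i.2.ne
    simp [dotd, this]
    rfl
  simp only [deltaX, deltaNext, dotd_sub_left, dotd_sub_right, Finset.sum_sub_distrib, h1, h2]
  ring

end DualGap

section Feasible

variable {Ω : Type*} {mΩ : MeasurableSpace Ω} {P : Measure Ω} {T d : ℕ}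
  {ℱ : Filtration (Fin (T + 1)) mΩ}
  {K : Fin (T + 1) → (Fin d → ℝ) → (Fin d → ℝ) → Ω → EReal}
  {𝓤 : Submodule ℝ (Ω → Fin (T + 1) → Fin d → ℝ)}
  {v y x w : Ω → Fin (T + 1) → Fin d → ℝ}

theorem NBolza.measurable (hx : x ∈ NBolza d ℱ) : Measurable x :=
  measurable_pi_iff.2 fun t => (hx t).mono (ℱ.le t) le_rfl

theorem measurable_fenchelSum (hK : ∀ t, IsConvexNormalIntegrand (ℱ t) (K t))
    (hv : Measurable v) (hy : Measurable y) (hx : Measurable x) (hw : Measurable w) :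
    Measurable (fenchelSum K v y x w) :=
  Finset.measurable_fun_sum _ fun t _ => (hK t).measurable_fenchelTerm (ℱ.le t)
    ((measurable_pi_apply t).comp hv) ((measurable_pi_apply t).comp hy)
    ((measurable_pi_apply t).comp hx) ((measurable_pi_apply t).comp hw)

theorem StageFinite.ae_sum_eq (hK : ∀ t, IsConvexNormalIntegrand (ℱ t) (K t))
    (h : StageFinite P K x w) :
    ∀ᵐ ω ∂P, ∑ t, K t (x ω t) (w ω t) ω =
      ((∑ t, (K t (x ω t) (w ω t) ω).toReal : ℝ) : EReal) := by
  filter_upwards [ae_all_iff.2 h] with ω hω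
  exact EReal.sum_eq_coe_sum_toReal _ (fun t _ => (hK t).ne_bot _ _ _) fun t _ => (hω t).ne

theorem measurable_sum_toReal (hK : ∀ t, IsConvexNormalIntegrand (ℱ t) (K t))
    (hx : Measurable x) (hw : Measurable w) :
    Measurable fun ω => ∑ t, (K t (x ω t) (w ω t) ω).toReal :=
  Finset.measurable_fun_sum _ fun t _ => ((hK t).measurable_comp (ℱ.le t)
    ((measurable_pi_apply t).comp hx) ((measurable_pi_apply t).comp hw)).ereal_toReal

theorem StageFinite.of_EE_lt_top (hK : ∀ t, IsConvexNormalIntegrand (ℱ t) (K t))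
    (hx : Measurable x) (hw : Measurable w)
    (h : EE P (fun ω => ∑ t, K t (x ω t) (w ω t) ω) < ⊤) : StageFinite P K x w := by
  have hm : Measurable fun ω => ∑ t, K t (x ω t) (w ω t) ω :=
    Finset.measurable_fun_sum _ fun t _ => (hK t).measurable_comp (ℱ.le t)
      ((measurable_pi_apply t).comp hx) ((measurable_pi_apply t).comp hw)
  intro t
  filter_upwards [ae_lt_top_of_EE_lt_top hm.aemeasurable h] with ω hω
  exact EReal.ne_top_of_sum_lt_top _ (fun t _ => (hK t).ne_bot _ _ _) hω t (Finset.mem_univ t)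

theorem IsDecomposableB.mem_of_bounded (h𝓤 : IsDecomposableB P 𝓤) (hw : Measurable w)
    (hb : ∃ M : ℝ, ∀ᵐ ω ∂P, ‖w ω‖ ≤ M) : w ∈ 𝓤 := by
  have := h𝓤.decomposable ∅ MeasurableSet.empty 0 𝓤.zero_mem w hw hb
  simpa using this

theorem measurable_deltaX (hx : Measurable x) : Measurable fun ω t => deltaX (x ω) t := by
  refine measurable_pi_iff.2 fun t => ?_
  unfold deltaX
  refine ((measurable_pi_apply t).comp hx).sub ?_
  split_ifs
  · exact measurable_const
  · exact (measurable_pi_apply _).comp hx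

theorem adapted_deltaX (hx : x ∈ NBolza d ℱ) : (fun ω t => deltaX (x ω) t) ∈ NBolza d ℱ := by
  intro t
  simp only [deltaX]
  refine (hx t).sub ?_
  split_ifs
  · exact measurable_const
  · exact (hx _).mono (ℱ.mono (Fin.le_def.2 (Nat.sub_le _ _))) le_rfl

theorem deltaX_bounded (hx : x ∈ NBolzaInf d ℱ P) :
    (fun ω t => deltaX (x ω) t) ∈ NBolzaInf d ℱ P := by
  refine ⟨adapted_deltaX hx.1, ?_⟩
  obtain ⟨M, hM⟩ := hx.2
  refine ⟨M + M, ?_⟩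
  filter_upwards [hM] with ω hω t
  have hM0 : 0 ≤ M := (norm_nonneg _).trans (hω 0)
  unfold deltaX
  refine (norm_sub_le _ _).trans (add_le_add (hω t) ?_)
  split_ifs
  · simpa using hM0
  · exact hω _

theorem deltaX_mem (h𝓤 : IsDecomposableB P 𝓤) (hx : x ∈ NBolzaInf d ℱ P) :
    (fun ω t => deltaX (x ω) t) ∈ 𝓤 := by
  obtain ⟨M, hM⟩ := (deltaX_bounded hx).2
  refine h𝓤.mem_of_bounded (measurable_deltaX (NBolza.measurable hx.1)) ⟨M, ?_⟩
  filter_upwards [hM] with ω hω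
  exact (pi_norm_le_iff_of_nonneg ((norm_nonneg _).trans (hω 0))).2 hω

theorem NBolzaInf.combination {x' : Ω → Fin (T + 1) → Fin d → ℝ} (hx : x ∈ NBolzaInf d ℱ P)
    (hx' : x' ∈ NBolzaInf d ℱ P) (a b : ℝ) : a • x + b • x' ∈ NBolzaInf d ℱ P := by
  obtain ⟨M, hM⟩ := hx.2
  obtain ⟨M', hM'⟩ := hx'.2
  refine ⟨fun t => ((hx.1 t).const_smul a).add ((hx'.1 t).const_smul b), |a| * M + |b| * M', ?_⟩
  filter_upwards [hM, hM'] with ω h h' t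
  refine (norm_add_le _ _).trans (add_le_add ?_ ?_)
  · change ‖a • x ω t‖ ≤ _
    rw [norm_smul]
    exact mul_le_mul_of_nonneg_left (h t) (norm_nonneg _)
  · change ‖b • x' ω t‖ ≤ _
    rw [norm_smul]
    exact mul_le_mul_of_nonneg_left (h' t) (norm_nonneg _)

/-- `C` bounds the integrals of the Fenchel expressions over bounded adapted `x` and `w ∈ 𝓤`. -/
structure FenchelBound (P : Measure Ω) (K : Fin (T + 1) → (Fin d → ℝ) → (Fin d → ℝ) → Ω → EReal)
    (ℱ : Filtration (Fin (T + 1)) mΩ) (𝓤 : Submodule ℝ (Ω → Fin (T + 1) → Fin d → ℝ))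
    (v y : Ω → Fin (T + 1) → Fin d → ℝ) (C : ℝ) : Prop where
  measurable_v : Measurable v
  measurable_y : Measurable y
  integrable_v : ∀ x ∈ NBolzaInf d ℱ P, Integrable (fun ω => dotB (x ω) (v ω)) P
  integrable_y : ∀ w ∈ 𝓤, Integrable (fun ω => dotB (w ω) (y ω)) P
  bound : ∀ x ∈ NBolzaInf d ℱ P, ∀ w ∈ 𝓤, StageFinite P K x w →
    (∃ g, Integrable g P ∧ ∀ᵐ ω ∂P, g ω ≤ fenchelSum K v y x w ω) →
    Integrable (fenchelSum K v y x w) P ∧ ∫ ω, fenchelSum K v y x w ω ∂P ≤ C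

theorem exists_of_mem_dom1B (hK : ∀ t, IsConvexNormalIntegrand (ℱ t) (K t))
    (h𝓤 : IsDecomposableB P 𝓤) (hx : x ∈ NBolzaInf d ℱ P) (hxd : x ∈ dom1B P K ℱ 𝓤) :
    ∃ w ∈ 𝓤, StageFinite P K x w ∧ EE P (fun ω => ∑ t, K t (x ω t) (w ω t) ω) < ⊤ := by
  obtain ⟨-, u, hu, hlt⟩ := hxd
  have hw : (fun ω t => deltaX (x ω) t) + u ∈ 𝓤 := 𝓤.add_mem (deltaX_mem h𝓤 hx) hu
  exact ⟨_, hw, StageFinite.of_EE_lt_top hK (NBolza.measurable hx.1) (h𝓤.measurable _ hw) hlt, hlt⟩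

theorem FenchelBound.exists_base {C : ℝ} (hB : FenchelBound P K ℱ 𝓤 v y C)
    (hK : ∀ t, IsConvexNormalIntegrand (ℱ t) (K t))
    (h𝓤 : IsDecomposableB P 𝓤) (hx : x ∈ NBolzaInf d ℱ P) (hxd : x ∈ dom1B P K ℱ 𝓤) :
    ∃ w ∈ 𝓤, StageFinite P K x w ∧ Integrable (fenchelSum K v y x w) P := by
  obtain ⟨w, hw, hfin, hlt⟩ := exists_of_mem_dom1B hK h𝓤 hx hxd
  rw [EE_lt_top_iff_exists_le (hfin.ae_sum_eq hK)
    (measurable_sum_toReal hK (NBolza.measurable hx.1) (h𝓤.measurable _ hw)).aemeasurable] at hlt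
  obtain ⟨g, hg, hle⟩ := hlt
  refine ⟨w, hw, hfin, (hB.bound x hx w hw hfin
    ⟨_, ((hB.integrable_v x hx).add (hB.integrable_y w hw)).sub hg, ?_⟩).1⟩
  filter_upwards [hle] with ω hω
  rw [fenchelSum_eq]
  simp only [Pi.sub_apply, Pi.add_apply]
  linarith

theorem FenchelBound.bound_of_mem_dom1B {C : ℝ} (hB : FenchelBound P K ℱ 𝓤 v y C)
    (hK : ∀ t, IsConvexNormalIntegrand (ℱ t) (K t))
    (h𝓤 : IsDecomposableB P 𝓤) (hx : x ∈ NBolzaInf d ℱ P) (hxd : x ∈ dom1B P K ℱ 𝓤)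
    (hw : Measurable w) (hfin : StageFinite P K x w)
    (hlow : ∃ g, Integrable g P ∧ ∀ᵐ ω ∂P, g ω ≤ fenchelSum K v y x w ω) :
    Integrable (fenchelSum K v y x w) P ∧ ∫ ω, fenchelSum K v y x w ω ∂P ≤ C := by
  obtain ⟨w₀, hw₀, hfin₀, hint₀⟩ := hB.exists_base hK h𝓤 hx hxd
  obtain ⟨g, hg, hgle⟩ := hlow
  let B : ℕ → Set Ω := fun n => {ω | ‖w ω‖ ≤ n}
  have hBm : ∀ n, MeasurableSet (B n) := fun n => measurableSet_le hw.norm measurable_const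
  let W : ℕ → Ω → Fin (T + 1) → Fin d → ℝ := fun n ω =>
    (B n)ᶜ.indicator w₀ ω + ((B n)ᶜ)ᶜ.indicator ((B n).indicator w) ω
  have hW𝓤 : ∀ n, W n ∈ 𝓤 := fun n =>
    h𝓤.decomposable _ (hBm n).compl w₀ hw₀ _ (hw.indicator (hBm n)) ⟨n, .of_forall fun ω => by
      by_cases h : ω ∈ B n
      · rw [Set.indicator_of_mem h]; exact h
      · simp [Set.indicator_of_notMem h]⟩
  have hW1 : ∀ n ω, ω ∈ B n → W n ω = w ω := fun n ω h => by simp [W, h]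
  have hW2 : ∀ n ω, ω ∉ B n → W n ω = w₀ ω := fun n ω h => by simp [W, h]
  have hH1 : ∀ n ω, ω ∈ B n → fenchelSum K v y x (W n) ω = fenchelSum K v y x w ω := fun n ω h => by
    simp only [fenchelSum, hW1 n ω h]
  have hH2 : ∀ n ω, ω ∉ B n → fenchelSum K v y x (W n) ω = fenchelSum K v y x w₀ ω :=
    fun n ω h => by simp only [fenchelSum, hW2 n ω h]
  have hWfin : ∀ n, StageFinite P K x (W n) := by
    intro n t
    filter_upwards [hfin t, hfin₀ t] with ω h1 h2
    by_cases h : ω ∈ B n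
    · rwa [hW1 n ω h]
    · rwa [hW2 n ω h]
  have hlowint : Integrable (fun ω => -(|g ω| + |fenchelSum K v y x w₀ ω|)) P :=
    (hg.abs.add hint₀.abs).neg
  have hlow : ∀ n, ∀ᵐ ω ∂P, -(|g ω| + |fenchelSum K v y x w₀ ω|) ≤ fenchelSum K v y x (W n) ω := by
    intro n
    filter_upwards [hgle] with ω hω
    by_cases h : ω ∈ B n
    · rw [hH1 n ω h]
      linarith [neg_abs_le (g ω), abs_nonneg (fenchelSum K v y x w₀ ω)]
    · rw [hH2 n ω h]
      linarith [neg_abs_le (fenchelSum K v y x w₀ ω), abs_nonneg (g ω)]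
  have hbd := fun n => hB.bound x hx (W n) (hW𝓤 n) (hWfin n) ⟨_, hlowint, hlow n⟩
  refine integrable_and_integral_le_of_tendsto hlowint (fun n => (hbd n).1) hlow
    (fun n => (hbd n).2) (.of_forall fun ω => ?_)
  obtain ⟨n, hn⟩ := exists_nat_ge ‖w ω‖
  refine tendsto_const_nhds.congr' ?_
  filter_upwards [Filter.eventually_ge_atTop n] with k hk
  exact (hH1 k ω (hn.trans (by exact_mod_cast hk))).symm

/-- The domain condition: every bounded adapted selection of the closed domains is a limit, along
a segment, of elements of `dom₁ Ef`. -/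
def SegmentCondition (P : Measure Ω)
    (K : Fin (T + 1) → (Fin d → ℝ) → (Fin d → ℝ) → Ω → EReal)
    (ℱ : Filtration (Fin (T + 1)) mΩ) (𝓤 : Submodule ℝ (Ω → Fin (T + 1) → Fin d → ℝ)) : Prop :=
  ∀ x ∈ NBolzaInf d ℱ P, (∀ t, ∀ᵐ ω ∂P, x ω t ∈ closure (dom1K (K t) ω)) →
    ∃ xbar ∈ NBolzaInf d ℱ P,
      ∀ lam : ℝ, 0 < lam → lam ≤ 1 → (1 - lam) • x + lam • xbar ∈ dom1B P K ℱ 𝓤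

theorem FenchelBound.bound_of_segmentCondition {C : ℝ} (hB : FenchelBound P K ℱ 𝓤 v y C)
    (hK : ∀ t, IsConvexNormalIntegrand (ℱ t) (K t))
    (h𝓤 : IsDecomposableB P 𝓤) (hdom : SegmentCondition P K ℱ 𝓤) (hx : x ∈ NBolzaInf d ℱ P)
    (hw : Measurable w) (hfin : StageFinite P K x w)
    (hlow : ∃ g, Integrable g P ∧ ∀ᵐ ω ∂P, g ω ≤ fenchelSum K v y x w ω) :
    Integrable (fenchelSum K v y x w) P ∧ ∫ ω, fenchelSum K v y x w ω ∂P ≤ C := by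
  obtain ⟨g, hg, hgle⟩ := hlow
  obtain ⟨xb, hxb, hseg⟩ := hdom x hx fun t => by
    filter_upwards [hfin t] with ω hω
    exact subset_closure ⟨_, hω⟩
  have hxbd : xb ∈ dom1B P K ℱ 𝓤 := by simpa using hseg 1 one_pos le_rfl
  obtain ⟨wb, hwb, hfinb, hintb⟩ := hB.exists_base hK h𝓤 hxb hxbd
  have hwbm := h𝓤.measurable _ hwb
  have hconc : ∀ lam : ℝ, 0 < lam → lam < 1 →
      StageFinite P K ((1 - lam) • x + lam • xb) ((1 - lam) • w + lam • wb) ∧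
      ∀ᵐ ω ∂P, (1 - lam) * fenchelSum K v y x w ω + lam * fenchelSum K v y xb wb ω ≤
        fenchelSum K v y ((1 - lam) • x + lam • xb) ((1 - lam) • w + lam • wb) ω := by
    intro lam h0 h1
    have key : ∀ᵐ ω ∂P, ∀ t, _ := ae_all_iff.2 fun t => (hfin t).and (hfinb t)
    constructor
    · intro t
      filter_upwards [key] with ω hω
      exact ((hK t).fenchelTerm_concave (v ω t) (y ω t) (hω t).1 (hω t).2 (sub_pos.2 h1) h0
        (by ring)).1
    · filter_upwards [key] with ω hω
      simp only [fenchelSum, Finset.mul_sum, ← Finset.sum_add_distrib]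
      exact Finset.sum_le_sum fun t _ => ((hK t).fenchelTerm_concave (v ω t) (y ω t) (hω t).1
        (hω t).2 (sub_pos.2 h1) h0 (by ring)).2
  have hbd : ∀ lam : ℝ, 0 < lam → lam < 1 →
      Integrable (fenchelSum K v y ((1 - lam) • x + lam • xb) ((1 - lam) • w + lam • wb)) P ∧
      ∫ ω, fenchelSum K v y ((1 - lam) • x + lam • xb) ((1 - lam) • w + lam • wb) ω ∂P ≤ C := by
    intro lam h0 h1
    refine hB.bound_of_mem_dom1B hK h𝓤 (NBolzaInf.combination hx hxb _ _) (hseg lam h0 h1.le)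
      ((hw.const_smul _).add (hwbm.const_smul _)) (hconc lam h0 h1).1
      ⟨_, (hg.const_mul (1 - lam)).add (hintb.const_mul lam), ?_⟩
    filter_upwards [(hconc lam h0 h1).2, hgle] with ω a b
    refine le_trans ?_ a
    simp only [Pi.add_apply]
    have := mul_le_mul_of_nonneg_left b (sub_nonneg.2 h1.le)
    linarith
  have hint : Integrable (fenchelSum K v y x w) P := by
    refine integrable_of_ae_le_of_ae_le (measurable_fenchelSum hK hB.measurable_v hB.measurable_y
      (NBolza.measurable hx.1) hw).aemeasurable hg
      (((hbd (1 / 2) (by norm_num) (by norm_num)).1.const_mul 2).sub hintb) hgle ?_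
    filter_upwards [(hconc (1 / 2) (by norm_num) (by norm_num)).2] with ω h
    simp only [Pi.sub_apply]
    linarith
  refine ⟨hint, ?_⟩
  have hlim : Filter.Tendsto (fun lam : ℝ => (1 - lam) * ∫ ω, fenchelSum K v y x w ω ∂P +
      lam * ∫ ω, fenchelSum K v y xb wb ω ∂P) (nhdsWithin 0 (Set.Ioi 0))
      (nhds ((1 - 0) * ∫ ω, fenchelSum K v y x w ω ∂P +
        0 * ∫ ω, fenchelSum K v y xb wb ω ∂P)) := by
    refine tendsto_nhdsWithin_of_tendsto_nhds (Continuous.tendsto ?_ 0)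
    fun_prop
  rw [sub_zero, one_mul, zero_mul, add_zero] at hlim
  refine le_of_tendsto hlim ?_
  filter_upwards [Ioo_mem_nhdsGT (one_pos (α := ℝ))] with lam hlam
  refine le_trans (le_of_eq ?_) ((integral_mono_ae ((hint.const_mul (1 - lam)).add
    (hintb.const_mul lam)) (hbd lam hlam.1 hlam.2).1 (hconc lam hlam.1 hlam.2).2).trans
      (hbd lam hlam.1 hlam.2).2)
  simp only [Pi.add_apply]
  rw [integral_add (hint.const_mul _) (hintb.const_mul _), integral_const_mul, integral_const_mul]

end Feasible

section Improvement

variable {Ω : Type*} {mΩ : MeasurableSpace Ω} {P : Measure Ω} {T d : ℕ}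
  {ℱ : Filtration (Fin (T + 1)) mΩ}
  {K : Fin (T + 1) → (Fin d → ℝ) → (Fin d → ℝ) → Ω → EReal}
  {𝓤 : Submodule ℝ (Ω → Fin (T + 1) → Fin d → ℝ)}
  {v y x w : Ω → Fin (T + 1) → Fin d → ℝ}

theorem measure_eq_zero_of_forall_nat [IsProbabilityMeasure P] {G : Set Ω} (hG : MeasurableSet G)
    {H : Ω → ℝ} (hH : Integrable H P) {C : ℝ}
    (h : ∀ N : ℕ, ∃ H' : Ω → ℝ, Integrable H' P ∧ ∫ ω, H' ω ∂P ≤ C ∧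
      ∀ᵐ ω ∂P, H ω + G.indicator (fun _ => (N : ℝ)) ω ≤ H' ω) : P G = 0 := by
  have key : ∀ N : ℕ, (N : ℝ) * P.real G ≤ C - ∫ ω, H ω ∂P := by
    intro N
    obtain ⟨H', hi, hC, hle⟩ := h N
    have hind : Integrable (G.indicator fun _ => (N : ℝ)) P := (integrable_const _).indicator hG
    have := integral_mono_ae (hH.add hind) hi hle
    simp only [Pi.add_apply] at this
    rw [integral_add hH hind, integral_indicator hG, setIntegral_const, smul_eq_mul] at this
    linarith
  by_contra hne
  have hpos : 0 < P.real G := by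
    rw [measureReal_def]
    exact ENNReal.toReal_pos hne (measure_ne_top _ _)
  obtain ⟨N, hN⟩ := exists_nat_gt ((C - ∫ ω, H ω ∂P) / P.real G)
  rw [div_lt_iff₀ hpos] at hN
  linarith [key N]

theorem fenchelSum_update_le {x' w' : Ω → Fin (T + 1) → Fin d → ℝ} {ω : Ω} {N : ℝ}
    (t : Fin (T + 1))
    (hne : ∀ s, s ≠ t → x' ω s = x ω s ∧ w' ω s = w ω s)
    (ht : fenchelTerm (K t) (v ω t) (y ω t) (x ω t) (w ω t) ω + N ≤
      fenchelTerm (K t) (v ω t) (y ω t) (x' ω t) (w' ω t) ω) :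
    fenchelSum K v y x w ω + N ≤ fenchelSum K v y x' w' ω := by
  unfold fenchelSum
  rw [← Finset.add_sum_erase _ _ (Finset.mem_univ t),
    ← Finset.add_sum_erase (a := t) _
      (fun t => fenchelTerm (K t) (v ω t) (y ω t) (x' ω t) (w' ω t) ω)
      (Finset.mem_univ t)]
  have : ∀ s ∈ Finset.univ.erase t, fenchelTerm (K s) (v ω s) (y ω s) (x ω s) (w ω s) ω =
      fenchelTerm (K s) (v ω s) (y ω s) (x' ω s) (w' ω s) ω := by
    intro s hs
    rw [(hne s (Finset.ne_of_mem_erase hs)).1, (hne s (Finset.ne_of_mem_erase hs)).2]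
  rw [Finset.sum_congr rfl this]
  linarith

theorem EReal.lt_top_and_toReal_le {a : EReal} {b : ℝ} (h : a ≤ b) (hbot : a ≠ ⊥) :
    a < ⊤ ∧ a.toReal ≤ b := by
  have hlt : a < ⊤ := lt_of_le_of_lt h (EReal.coe_lt_top _)
  refine ⟨hlt, ?_⟩
  rwa [← EReal.coe_toReal hlt.ne hbot, EReal.coe_le_coe_iff] at h

/-- A finite bound on the dual objective forces the partial suprema over `w` at a fixed bounded
strategy to be finite. -/
theorem FenchelBound.bddAbove_section [IsProbabilityMeasure P] {C : ℝ}
    (hB : FenchelBound P K ℱ 𝓤 v y C) (hK : ∀ t, IsConvexNormalIntegrand (ℱ t) (K t))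
    (h𝓤 : IsDecomposableB P 𝓤) (hdom : SegmentCondition P K ℱ 𝓤) (hx : x ∈ NBolzaInf d ℱ P)
    (hw : Measurable w) (hfin : StageFinite P K x w)
    (hint : Integrable (fenchelSum K v y x w) P) (t : Fin (T + 1))
    {u : ℕ → Ω → Fin d → ℝ} {α : ℕ → Ω → ℝ} (hu : ∀ n, Measurable (u n))
    (hα : ∀ n, Measurable (α n))
    (hle : ∀ ω, (∃ b, K t (x ω t) b ω < ⊤) → ∀ n, K t (x ω t) (u n ω) ω ≤ α n ω) :
    ∀ᵐ ω ∂P, BddAbove (Set.range fun n => dotd (u n ω) (y ω t) - α n ω) := by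
  classical
  have hxm := NBolza.measurable hx.1
  have hyt : Measurable fun ω => y ω t := (measurable_pi_apply t).comp hB.measurable_y
  have hxt : Measurable fun ω => x ω t := (measurable_pi_apply t).comp hxm
  have hwt : Measurable fun ω => w ω t := (measurable_pi_apply t).comp hw
  have hβ : ∀ n, Measurable fun ω => dotd (u n ω) (y ω t) - α n ω :=
    fun n => ((hu n).dotd hyt).sub (hα n)
  let G := {ω | BddAbove (Set.range fun n => dotd (u n ω) (y ω t) - α n ω)}ᶜ
  have hG : MeasurableSet G := (measurableSet_bddAbove_range hβ).compl
  suffices h : P G = 0 by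
    rw [ae_iff]
    exact h
  refine measure_eq_zero_of_forall_nat hG hint (C := C) fun N => ?_
  have hτ : Measurable fun ω => dotd (w ω t) (y ω t) - (K t (x ω t) (w ω t) ω).toReal + N :=
    ((hwt.dotd hyt).sub ((hK t).measurable_comp (ℱ.le t) hxt hwt).ereal_toReal).add_const _
  obtain ⟨J, hJ, hJlt⟩ := exists_measurable_index hβ hτ
  let w' : Ω → Fin (T + 1) → Fin d → ℝ := fun ω =>
    if ω ∈ G then Function.update (w ω) t (u (J ω) ω) else w ω
  have hupd : Measurable fun ω => Function.update (w ω) t (u (J ω) ω) := by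
    refine measurable_pi_iff.2 fun s => ?_
    by_cases h : s = t
    · subst h
      simpa using Measurable.comp_index hu hJ
    · simp only [Function.update_of_ne h]
      exact (measurable_pi_apply s).comp hw
  have hw' : Measurable w' := Measurable.ite hG hupd hw
  have hval : ∀ ω, ω ∈ G → K t (x ω t) (w ω t) ω < ⊤ →
      K t (x ω t) (u (J ω) ω) ω < ⊤ ∧
      fenchelTerm (K t) (v ω t) (y ω t) (x ω t) (w ω t) ω + N ≤
        fenchelTerm (K t) (v ω t) (y ω t) (x ω t) (u (J ω) ω) ω := by
    intro ω hω hf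
    have hex : ∃ n, dotd (w ω t) (y ω t) - (K t (x ω t) (w ω t) ω).toReal + N <
        dotd (u n ω) (y ω t) - α n ω := by
      have : ¬ BddAbove (Set.range fun n => dotd (u n ω) (y ω t) - α n ω) := hω
      obtain ⟨_, ⟨n, rfl⟩, hn⟩ := not_bddAbove_iff.1 this
        (dotd (w ω t) (y ω t) - (K t (x ω t) (w ω t) ω).toReal + N)
      exact ⟨n, hn⟩
    have h1 := hJlt ω hex
    have h2 := EReal.lt_top_and_toReal_le (hle ω ⟨_, hf⟩ (J ω)) ((hK t).ne_bot _ _ _)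
    refine ⟨h2.1, ?_⟩
    unfold fenchelTerm
    linarith [h2.2]
  have hw1 : ∀ ω ∈ G, w' ω = Function.update (w ω) t (u (J ω) ω) := fun ω h => if_pos h
  have hw2 : ∀ ω, ω ∉ G → w' ω = w ω := fun ω h => if_neg h
  have hfin' : StageFinite P K x w' := by
    intro s
    filter_upwards [hfin s] with ω hω
    by_cases h : ω ∈ G
    · rw [hw1 ω h]
      by_cases hs : s = t
      · subst hs
        simpa using (hval ω h hω).1
      · simpa [hs] using hω
    · rwa [hw2 ω h]
  have hmono : ∀ᵐ ω ∂P, fenchelSum K v y x w ω + G.indicator (fun _ => (N : ℝ)) ω ≤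
      fenchelSum K v y x w' ω := by
    filter_upwards [hfin t] with ω hω
    by_cases h : ω ∈ G
    · rw [Set.indicator_of_mem h]
      refine fenchelSum_update_le t (fun s hs => ⟨rfl, by simp [hw1 ω h, hs]⟩) ?_
      rw [hw1 ω h, Function.update_self]
      exact (hval ω h hω).2
    · rw [Set.indicator_of_notMem h, add_zero]
      simp only [fenchelSum, hw2 ω h, le_refl]
  have hb := hB.bound_of_segmentCondition hK h𝓤 hdom hx hw' hfin' ⟨_, hint, by
    filter_upwards [hmono] with ω hω
    refine le_trans (le_add_of_nonneg_right ?_) hω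
    exact Set.indicator_nonneg (fun _ _ => Nat.cast_nonneg N) ω⟩
  exact ⟨_, hb.1, hb.2, hmono⟩

/-- At a fixed bounded strategy, the control `w` can be replaced by an adapted one without
decreasing (up to `ε`) any Fenchel term for the adapted projection of `y`. -/
theorem FenchelBound.exists_adapted [IsProbabilityMeasure P] {C : ℝ}
    (hB : FenchelBound P K ℱ 𝓤 v y C) (hK : ∀ t, IsConvexNormalIntegrand (ℱ t) (K t))
    (h𝓤 : IsDecomposableB P 𝓤) (hdom : SegmentCondition P K ℱ 𝓤)
    (hyi : ∀ t, Integrable (fun ω => y ω t) P) (hx : x ∈ NBolzaInf d ℱ P)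
    (hw : Measurable w) (hfin : StageFinite P K x w)
    (hint : Integrable (fenchelSum K v y x w) P) {ε : ℝ} (hε : 0 < ε) :
    ∃ w' ∈ NBolza d ℱ, StageFinite P K x w' ∧ ∀ t, ∀ᵐ ω ∂P,
      fenchelTerm (K t) (v ω t) (aProj P ℱ y ω t) (x ω t) (w ω t) ω - ε ≤
        fenchelTerm (K t) (v ω t) (aProj P ℱ y ω t) (x ω t) (w' ω t) ω := by
  have hstep : ∀ t, ∃ w' : Ω → Fin d → ℝ, Measurable[ℱ t] w' ∧
      (∀ᵐ ω ∂P, K t (x ω t) (w' ω) ω < ⊤) ∧ ∀ᵐ ω ∂P,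
      fenchelTerm (K t) (v ω t) (aProj P ℱ y ω t) (x ω t) (w ω t) ω - ε ≤
        fenchelTerm (K t) (v ω t) (aProj P ℱ y ω t) (x ω t) (w' ω) ω := by
    intro t
    obtain ⟨u, α, hu, hα, hsec⟩ := (hK t).exists_section_seq (hx.1 t)
    have hbdd := hB.bddAbove_section hK h𝓤 hdom hx hw hfin hint t
      (fun n => (hu n).mono (ℱ.le t) le_rfl) (fun n => (hα n).mono (ℱ.le t) le_rfl)
      (fun ω h => (hsec ω h).1)
    have hbdd' := bddAbove_condExp (ℱ.le t) hu hα
      ((measurable_pi_apply t).comp hB.measurable_y) (hyi t) hbdd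
    have hy' : Measurable[ℱ t] fun ω => aProj P ℱ y ω t :=
      (stronglyMeasurable_condExp (m := ℱ t)).measurable
    have hβ : ∀ n, Measurable[ℱ t] fun ω => dotd (u n ω) (aProj P ℱ y ω t) - α n ω :=
      fun n => ((hu n).dotd hy').sub (hα n)
    have hs : Measurable[ℱ t] fun ω => (⨆ n, (dotd (u n ω) (aProj P ℱ y ω t) - α n ω)) - ε :=
      (Measurable.iSup hβ).sub_const _
    obtain ⟨J, hJ, hJlt⟩ := @exists_measurable_index _ (ℱ t) _ hβ _ hs
    refine ⟨fun ω => u (J ω) ω, @Measurable.comp_index _ _ (ℱ t) _ _ hu _ hJ, ?_, ?_⟩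
    · filter_upwards [hfin t] with ω h1
      exact (EReal.lt_top_and_toReal_le ((hsec ω ⟨_, h1⟩).1 (J ω)) ((hK t).ne_bot _ _ _)).1
    · filter_upwards [hfin t, hbdd'] with ω h1 h2
      have hc := (EReal.lt_top_and_toReal_le ((hsec ω ⟨_, h1⟩).1 (J ω)) ((hK t).ne_bot _ _ _)).2
      have h2' : BddAbove (Set.range fun n => dotd (u n ω) (aProj P ℱ y ω t) - α n ω) := h2
      have h3 := hJlt ω (exists_lt_of_lt_ciSup (sub_lt_self _ hε))
      have h4 : dotd (w ω t) (aProj P ℱ y ω t) - (K t (x ω t) (w ω t) ω).toReal ≤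
          ⨆ n, (dotd (u n ω) (aProj P ℱ y ω t) - α n ω) := by
        refine le_of_forall_lt fun τ hτ => ?_
        obtain ⟨n, hn⟩ := (hsec ω ⟨_, h1⟩).2 _ _ _ h1 hτ
        exact hn.trans_le (le_ciSup h2' n)
      unfold fenchelTerm
      linarith
  choose w' h1 h2 h3 using hstep
  exact ⟨fun ω t => w' t ω, h1, h2, h3⟩

end Improvement

section Conjugate

variable {Ω : Type*} {d : ℕ}

theorem Kconj_eq_iSup {k : (Fin d → ℝ) → (Fin d → ℝ) → Ω → EReal} {ω : Ω}
    (hbot : ∀ a b, k a b ω ≠ ⊥) {x u : ℕ → Fin d → ℝ} {α : ℕ → ℝ} {v y : Fin d → ℝ}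
    (hle : ∀ n, k (x n) (u n) ω ≤ α n)
    (hdense : ∀ a b τ, k a b ω < ⊤ → τ < dotd a v + dotd b y - (k a b ω).toReal →
      ∃ n, τ < dotd (x n) v + dotd (u n) y - α n) :
    Kconj k v y ω = ⨆ n, ((dotd (x n) v + dotd (u n) y - α n : ℝ) : EReal) := by
  refine le_antisymm (iSup₂_le fun a b => ?_) (iSup_le fun n => ?_)
  · rcases eq_or_ne (k a b ω) ⊤ with h | h
    · rw [h]
      simp
    · rw [← EReal.coe_toReal h (hbot a b), ← EReal.coe_sub]
      refine le_of_forall_lt fun τ hτ => ?_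
      obtain ⟨q, hτq, hq⟩ := EReal.lt_iff_exists_real_btwn.1 hτ
      obtain ⟨n, hn⟩ := hdense a b q (lt_top_iff_ne_top.2 h) (EReal.coe_lt_coe_iff.1 hq)
      exact (hτq.trans (EReal.coe_lt_coe_iff.2 hn)).trans_le
        (le_iSup (fun n => ((dotd (x n) v + dotd (u n) y - α n : ℝ) : EReal)) n)
  · refine le_trans ?_ (le_iSup₂ (f := fun a b => ((dotd a v + dotd b y : ℝ) : EReal) - k a b ω)
      (x n) (u n))
    rw [EReal.coe_sub]
    exact EReal.sub_le_sub le_rfl (hle n)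

theorem EReal.iSup_coe_eq {β : ℕ → ℝ} (h : BddAbove (Set.range β)) :
    ⨆ n, (β n : EReal) = ((⨆ n, β n : ℝ) : EReal) := by
  refine le_antisymm (iSup_le fun n => EReal.coe_le_coe_iff.2 (le_ciSup h n)) ?_
  have hbot : (⨆ n, (β n : EReal)) ≠ ⊥ :=
    (lt_of_lt_of_le (EReal.bot_lt_coe (β 0)) (le_iSup (fun n => (β n : EReal)) 0)).ne'
  have htop : (⨆ n, (β n : EReal)) ≠ ⊤ :=
    (lt_of_le_of_lt (iSup_le fun n => EReal.coe_le_coe_iff.2 (le_ciSup h n))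
      (EReal.coe_lt_top (⨆ n, β n))).ne
  rw [← EReal.coe_toReal htop hbot, EReal.coe_le_coe_iff]
  refine ciSup_le fun n => ?_
  rw [← EReal.coe_le_coe_iff, EReal.coe_toReal htop hbot]
  exact le_iSup (fun n => (β n : EReal)) n

theorem fenchelTerm_le_iSup {k : (Fin d → ℝ) → (Fin d → ℝ) → Ω → EReal} {ω : Ω}
    {x u : ℕ → Fin d → ℝ} {α : ℕ → ℝ} {v y a b : Fin d → ℝ}
    (hdense : ∀ a b τ, k a b ω < ⊤ → τ < dotd a v + dotd b y - (k a b ω).toReal →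
      ∃ n, τ < dotd (x n) v + dotd (u n) y - α n)
    (hb : BddAbove (Set.range fun n => dotd (x n) v + dotd (u n) y - α n)) (hab : k a b ω < ⊤) :
    fenchelTerm k v y a b ω ≤ ⨆ n, (dotd (x n) v + dotd (u n) y - α n) := by
  refine le_of_forall_lt fun τ hτ => ?_
  obtain ⟨n, hn⟩ := hdense a b τ hab hτ
  exact hn.trans_le (le_ciSup hb n)

end Conjugate

section LowerBound

variable {Ω : Type*} {mΩ : MeasurableSpace Ω} {P : Measure Ω} {T d : ℕ}
  {ℱ : Filtration (Fin (T + 1)) mΩ}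
  {K : Fin (T + 1) → (Fin d → ℝ) → (Fin d → ℝ) → Ω → EReal}
  {𝓤 : Submodule ℝ (Ω → Fin (T + 1) → Fin d → ℝ)}
  {v y x w : Ω → Fin (T + 1) → Fin d → ℝ}

theorem FenchelBound.bound_of_adapted {C : ℝ}
    (hB : FenchelBound P K ℱ 𝓤 v y C) (hK : ∀ t, IsConvexNormalIntegrand (ℱ t) (K t))
    (h𝓤 : IsDecomposableB P 𝓤) (hdom : SegmentCondition P K ℱ 𝓤)
    {x₀ w₀ : Ω → Fin (T + 1) → Fin d → ℝ} (hx₀ : x₀ ∈ NBolzaInf d ℱ P) (hw₀ : w₀ ∈ NBolza d ℱ)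
    (hfin₀ : StageFinite P K x₀ w₀) (hint₀ : Integrable (fenchelSum K v y x₀ w₀) P)
    (hx : x ∈ NBolza d ℱ) (hw : w ∈ NBolza d ℱ) (hfin : StageFinite P K x w) {ε : ℝ} (hε : 0 ≤ ε)
    [IsFiniteMeasure P]
    (hle : ∀ t, ∀ᵐ ω ∂P, fenchelTerm (K t) (v ω t) (y ω t) (x₀ ω t) (w₀ ω t) ω - ε ≤
      fenchelTerm (K t) (v ω t) (y ω t) (x ω t) (w ω t) ω) :
    Integrable (fenchelSum K v y x w) P ∧ ∫ ω, fenchelSum K v y x w ω ∂P ≤ C := by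
  classical
  let X : ℕ → Ω → Fin (T + 1) → Fin d → ℝ := fun n ω t => if ‖x ω t‖ ≤ n then x ω t else x₀ ω t
  let W : ℕ → Ω → Fin (T + 1) → Fin d → ℝ := fun n ω t => if ‖x ω t‖ ≤ n then w ω t else w₀ ω t
  have hset : ∀ (n : ℕ) t, MeasurableSet[ℱ t] {ω | ‖x ω t‖ ≤ n} := fun n t =>
    measurableSet_le (measurable_norm.comp (hx t)) measurable_const
  have hX : ∀ n, X n ∈ NBolzaInf d ℱ P := by
    intro n
    obtain ⟨M, hM⟩ := hx₀.2
    refine ⟨fun t => Measurable.ite (hset n t) (hx t) (hx₀.1 t), max n M, ?_⟩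
    filter_upwards [hM] with ω hω t
    simp only [X]
    split_ifs with h
    · exact h.trans (le_max_left _ _)
    · exact (hω t).trans (le_max_right _ _)
  have hW : ∀ n, W n ∈ NBolza d ℱ := fun n t => Measurable.ite (hset n t) (hw t) (hw₀ t)
  have hXfin : ∀ n, StageFinite P K (X n) (W n) := by
    intro n t
    filter_upwards [hfin t, hfin₀ t] with ω h1 h2
    simp only [X, W]
    split_ifs
    · exact h1
    · exact h2
  have hgi : Integrable (fun ω => fenchelSum K v y x₀ w₀ ω - (T + 1) * ε) P :=
    hint₀.sub (integrable_const _)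
  have hlow : ∀ n, ∀ᵐ ω ∂P, fenchelSum K v y x₀ w₀ ω - (T + 1) * ε ≤
      fenchelSum K v y (X n) (W n) ω := by
    intro n
    filter_upwards [ae_all_iff.2 hle] with ω hω
    have hs : fenchelSum K v y x₀ w₀ ω - (T + 1) * ε =
        ∑ t, (fenchelTerm (K t) (v ω t) (y ω t) (x₀ ω t) (w₀ ω t) ω - ε) := by
      simp [fenchelSum, Finset.sum_sub_distrib]
    rw [hs]
    refine Finset.sum_le_sum fun t _ => ?_
    simp only [X, W]
    split_ifs
    · exact hω t
    · linarith
  have hb := fun n => hB.bound_of_segmentCondition hK h𝓤 hdom (hX n)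
    (NBolza.measurable (hW n)) (hXfin n) ⟨_, hgi, hlow n⟩
  refine integrable_and_integral_le_of_tendsto hgi (fun n => (hb n).1) hlow (fun n => (hb n).2)
    (.of_forall fun ω => ?_)
  obtain ⟨n, hn⟩ := exists_nat_ge ‖x ω‖
  refine tendsto_const_nhds.congr' ?_
  filter_upwards [Filter.eventually_ge_atTop n] with k hk
  have hk' : ∀ t, ‖x ω t‖ ≤ k := fun t =>
    (norm_le_pi_norm (x ω) t).trans (hn.trans (by exact_mod_cast hk))
  simp only [fenchelSum, X, W, hk', if_true]

/-- The expected conjugate of the stage costs is dominated by every finite bound on the dual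
objective, for adapted dual processes. -/
theorem FenchelBound.EE_Kconj_le [IsProbabilityMeasure P] {C : ℝ}
    (hB : FenchelBound P K ℱ 𝓤 v y C) (hK : ∀ t, IsConvexNormalIntegrand (ℱ t) (K t))
    (h𝓤 : IsDecomposableB P 𝓤) (hdom : SegmentCondition P K ℱ 𝓤)
    (hv : v ∈ NBolza d ℱ) (hy : y ∈ NBolza d ℱ)
    {x₀ w₀ : Ω → Fin (T + 1) → Fin d → ℝ} (hx₀ : x₀ ∈ NBolzaInf d ℱ P) (hw₀ : w₀ ∈ NBolza d ℱ)
    (hfin₀ : StageFinite P K x₀ w₀) (hint₀ : Integrable (fenchelSum K v y x₀ w₀) P) :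
    EE P (fun ω => ∑ t, Kconj (K t) (v ω t) (y ω t) ω) ≤ C := by
  classical
  choose X U α hX hU hα hdata using fun t => (hK t).exists_seq
  let β : Fin (T + 1) → ℕ → Ω → ℝ := fun t n ω =>
    dotd (X t n ω) (v ω t) + dotd (U t n ω) (y ω t) - α t n ω
  have hβ : ∀ t n, Measurable[ℱ t] (β t n) := fun t n =>
    (((hX t n).dotd (hv t)).add ((hU t n).dotd (hy t))).sub (hα t n)
  have hterm₀ : ∀ t, Measurable[ℱ t]
      fun ω => fenchelTerm (K t) (v ω t) (y ω t) (x₀ ω t) (w₀ ω t) ω := fun t =>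
    (hK t).measurable_fenchelTerm le_rfl (hv t) (hy t) (hx₀.1 t) (hw₀ t)
  have hval : ∀ t ω n, K t (x₀ ω t) (w₀ ω t) ω < ⊤ → K t (X t n ω) (U t n ω) ω < ⊤ ∧
      β t n ω ≤ fenchelTerm (K t) (v ω t) (y ω t) (X t n ω) (U t n ω) ω := by
    intro t ω n h
    have := EReal.lt_top_and_toReal_le ((hdata t ω ⟨_, _, h⟩).1 n) ((hK t).ne_bot _ _ _)
    refine ⟨this.1, ?_⟩
    simp only [β, fenchelTerm]
    linarith [this.2]
  have hbdd : ∀ t, ∀ᵐ ω ∂P, BddAbove (Set.range fun n => β t n ω) := by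
    intro t
    let G := {ω | BddAbove (Set.range fun n => β t n ω)}ᶜ
    have hG : MeasurableSet[ℱ t] G := (measurableSet_bddAbove_range (hβ t)).compl
    suffices h : P G = 0 by
      rw [ae_iff]
      exact h
    refine measure_eq_zero_of_forall_nat (ℱ.le t _ hG) hint₀ (C := C) fun N => ?_
    obtain ⟨J, hJ, hJlt⟩ := @exists_measurable_index _ (ℱ t) _ (hβ t) _
      ((hterm₀ t).add_const (N : ℝ))
    let x' : Ω → Fin (T + 1) → Fin d → ℝ := fun ω s =>
      if s = t ∧ ω ∈ G then X t (J ω) ω else x₀ ω s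
    let w' : Ω → Fin (T + 1) → Fin d → ℝ := fun ω s =>
      if s = t ∧ ω ∈ G then U t (J ω) ω else w₀ ω s
    have hx' : x' ∈ NBolza d ℱ := by
      intro s
      by_cases h : s = t
      · subst h
        simp only [x', true_and]
        exact Measurable.ite hG (@Measurable.comp_index _ _ (ℱ s) _ _ (hX s) _ hJ) (hx₀.1 s)
      · simp only [x', h, false_and, if_false]
        exact hx₀.1 s
    have hw' : w' ∈ NBolza d ℱ := by
      intro s
      by_cases h : s = t
      · subst h
        simp only [w', true_and]
        exact Measurable.ite hG (@Measurable.comp_index _ _ (ℱ s) _ _ (hU s) _ hJ) (hw₀ s)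
      · simp only [w', h, false_and, if_false]
        exact hw₀ s
    have hJval : ∀ ω ∈ G, fenchelTerm (K t) (v ω t) (y ω t) (x₀ ω t) (w₀ ω t) ω + N <
        β t (J ω) ω := by
      intro ω hω
      refine hJlt ω ?_
      have : ¬ BddAbove (Set.range fun n => β t n ω) := hω
      obtain ⟨_, ⟨n, rfl⟩, hn⟩ := not_bddAbove_iff.1 this
        (fenchelTerm (K t) (v ω t) (y ω t) (x₀ ω t) (w₀ ω t) ω + N)
      exact ⟨n, hn⟩
    have hfin' : StageFinite P K x' w' := by
      intro s
      filter_upwards [hfin₀ s] with ω hω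
      by_cases h : s = t ∧ ω ∈ G
      · obtain ⟨rfl, h⟩ := h
        simpa only [x', w', h, true_and, if_true] using (hval s ω (J ω) hω).1
      · simpa only [x', w', h, if_false] using hω
    have hone : ∀ᵐ ω ∂P, fenchelTerm (K t) (v ω t) (y ω t) (x₀ ω t) (w₀ ω t) ω +
        G.indicator (fun _ => (N : ℝ)) ω ≤
        fenchelTerm (K t) (v ω t) (y ω t) (x' ω t) (w' ω t) ω := by
      filter_upwards [hfin₀ t] with ω hω
      by_cases h : ω ∈ G
      · simp only [x', w', h, true_and, if_true, Set.indicator_of_mem]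
        exact (hJval ω h).le.trans (hval t ω (J ω) hω).2
      · simp [x', w', h]
    have hother : ∀ ω s, s ≠ t → x' ω s = x₀ ω s ∧ w' ω s = w₀ ω s := by
      intro ω s hs
      simp [x', w', hs]
    have hb := hB.bound_of_adapted hK h𝓤 hdom hx₀ hw₀ hfin₀ hint₀ hx' hw' hfin' le_rfl (by
      intro s
      by_cases hs : s = t
      · subst hs
        filter_upwards [hone] with ω hω
        have : 0 ≤ G.indicator (fun _ => (N : ℝ)) ω :=
          Set.indicator_nonneg (fun _ _ => Nat.cast_nonneg N) ω
        linarith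
      · refine .of_forall fun ω => ?_
        rw [(hother ω s hs).1, (hother ω s hs).2, sub_zero])
    refine ⟨_, hb.1, hb.2, ?_⟩
    filter_upwards [hone] with ω hω
    exact fenchelSum_update_le t (hother ω) hω
  let S : Fin (T + 1) → Ω → ℝ := fun t ω => ⨆ n, β t n ω
  have hSm : ∀ t, Measurable[ℱ t] (S t) := fun t => Measurable.iSup (hβ t)
  have hle₀ : ∀ t, ∀ᵐ ω ∂P, fenchelTerm (K t) (v ω t) (y ω t) (x₀ ω t) (w₀ ω t) ω ≤ S t ω := by
    intro t
    filter_upwards [hfin₀ t, hbdd t] with ω h1 h2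
    exact fenchelTerm_le_iSup (fun a b τ => (hdata t ω ⟨_, _, h1⟩).2 a b _ _ τ) h2 h1
  have hconj : ∀ᵐ ω ∂P, ∑ t, Kconj (K t) (v ω t) (y ω t) ω = ((∑ t, S t ω : ℝ) : EReal) := by
    filter_upwards [ae_all_iff.2 hfin₀, ae_all_iff.2 hbdd] with ω h1 h2
    have : ∀ t, Kconj (K t) (v ω t) (y ω t) ω = (S t ω : EReal) := fun t =>
      (Kconj_eq_iSup (fun a b => (hK t).ne_bot a b ω) (hdata t ω ⟨_, _, h1 t⟩).1
        (fun a b τ => (hdata t ω ⟨_, _, h1 t⟩).2 a b _ _ τ)).trans (EReal.iSup_coe_eq (h2 t))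
    simp only [this]
    rw [EReal.sum_eq_coe_sum_toReal _ (fun t _ => EReal.coe_ne_bot _)
      (fun t _ => EReal.coe_ne_top _)]
    simp
  have happrox : ∀ ε : ℝ, 0 < ε → ∃ H : Ω → ℝ, Integrable H P ∧ ∫ ω, H ω ∂P ≤ C ∧
      ∀ᵐ ω ∂P, ∑ t, S t ω ≤ H ω + (T + 1) * ε := by
    intro ε hε
    choose J hJ hJlt using fun t => @exists_measurable_index _ (ℱ t) _ (hβ t) _
      ((hSm t).sub_const ε)
    let x' : Ω → Fin (T + 1) → Fin d → ℝ := fun ω t => X t (J t ω) ω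
    let w' : Ω → Fin (T + 1) → Fin d → ℝ := fun ω t => U t (J t ω) ω
    have hle : ∀ t, ∀ᵐ ω ∂P, S t ω - ε ≤
        fenchelTerm (K t) (v ω t) (y ω t) (x' ω t) (w' ω t) ω := by
      intro t
      filter_upwards [hfin₀ t] with ω h1
      exact (hJlt t ω (exists_lt_of_lt_ciSup (sub_lt_self _ hε))).le.trans
        (hval t ω (J t ω) h1).2
    have hb := hB.bound_of_adapted hK h𝓤 hdom hx₀ hw₀ hfin₀ hint₀ (x := x') (w := w')
      (fun t => @Measurable.comp_index _ _ (ℱ t) _ _ (hX t) _ (hJ t))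
      (fun t => @Measurable.comp_index _ _ (ℱ t) _ _ (hU t) _ (hJ t))
      (fun t => by
        filter_upwards [hfin₀ t] with ω h1
        exact (hval t ω (J t ω) h1).1) hε.le (fun t => by
        filter_upwards [hle t, hle₀ t] with ω h1 h2
        linarith)
    refine ⟨_, hb.1, hb.2, ?_⟩
    filter_upwards [ae_all_iff.2 hle] with ω h1
    have h2 : ∑ t, (S t ω - ε) ≤ fenchelSum K v y x' w' ω := Finset.sum_le_sum fun t _ => h1 t
    have h3 : ∑ t, (S t ω - ε) = ∑ t, S t ω - (T + 1) * ε := by simp [Finset.sum_sub_distrib]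
    linarith
  have hSi : Integrable (fun ω => ∑ t, S t ω) P := by
    obtain ⟨H, hH, -, hle⟩ := happrox 1 one_pos
    refine integrable_of_ae_le_of_ae_le (Finset.measurable_fun_sum _ fun t _ =>
      (hSm t).mono (ℱ.le t) le_rfl).aemeasurable hint₀ (hH.add (integrable_const _)) ?_ hle
    filter_upwards [ae_all_iff.2 hle₀] with ω h
    exact Finset.sum_le_sum fun t _ => h t
  rw [EE_of_integrable hconj hSi, EReal.coe_le_coe_iff]
  refine le_of_forall_pos_le_add fun δ hδ => ?_
  obtain ⟨H, hH, hHC, hle⟩ := happrox (δ / (T + 1)) (by positivity)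
  have h1 := integral_mono_ae hSi (hH.add (integrable_const _)) hle
  simp only [Pi.add_apply] at h1
  rw [integral_add hH (integrable_const _)] at h1
  have h2 : ((T : ℝ) + 1) * (δ / (T + 1)) = δ := by field_simp
  rw [h2] at h1
  simp only [integral_const, probReal_univ, one_smul] at h1
  linarith

end LowerBound

section Pairing

variable {Ω : Type*} {mΩ : MeasurableSpace Ω} {P : Measure Ω} {T d : ℕ}
  {ℱ : Filtration (Fin (T + 1)) mΩ}
  {K : Fin (T + 1) → (Fin d → ℝ) → (Fin d → ℝ) → Ω → EReal}
  {𝓤 𝓨 : Submodule ℝ (Ω → Fin (T + 1) → Fin d → ℝ)}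
  {v y x w u : Ω → Fin (T + 1) → Fin d → ℝ}

theorem dotB_add_left (a b c : Fin (T + 1) → Fin d → ℝ) :
    dotB (a + b) c = dotB a c + dotB b c := by
  simp [dotB, dotd_add_left, Finset.sum_add_distrib]

/-- Elements paired integrably with all of a decomposable space are integrable. -/
theorem IsDecomposableB.integrable_of_pairing (h𝓤 : IsDecomposableB P 𝓤)
    (hy : ∀ u ∈ 𝓤, Integrable (fun ω => dotB (u ω) (y ω)) P) (t : Fin (T + 1)) :
    Integrable (fun ω => y ω t) P := by
  classical
  refine Integrable.of_eval fun i => ?_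
  let e : Fin (T + 1) → Fin d → ℝ := Pi.single t (Pi.single i 1)
  have he : (fun _ : Ω => e) ∈ 𝓤 :=
    h𝓤.mem_of_bounded measurable_const ⟨‖e‖, .of_forall fun _ => le_rfl⟩
  refine (hy _ he).congr (.of_forall fun ω => ?_)
  change dotB e (y ω) = y ω t i
  unfold dotB
  rw [Finset.sum_eq_single t]
  · simp [e, dotd, Pi.single_apply]
  · intro s _ hs
    simp [e, hs, dotd]
  · simp

theorem integrable_dotB_of_bounded (hx : x ∈ NBolzaInf d ℱ P)
    (hv : ∀ t, Integrable (fun ω => v ω t) P) : Integrable (fun ω => dotB (x ω) (v ω)) P := by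
  obtain ⟨M, hM⟩ := hx.2
  refine integrable_finsetSum _ fun t _ => integrable_finsetSum _ fun i _ => ?_
  refine ((hv t).eval i).bdd_mul (c := M) ?_ ?_
  · exact ((measurable_pi_apply i).comp ((hx.1 t).mono (ℱ.le t) le_rfl)).aestronglyMeasurable
  · filter_upwards [hM] with ω hω
    exact (norm_le_pi_norm (x ω t) i).trans (hω t)

theorem integral_dotd_condExp_sub_eq_zero [IsProbabilityMeasure P] {m : MeasurableSpace Ω}
    (hm : m ≤ mΩ) {ξ η : Ω → Fin d → ℝ} (hξ : Measurable[m] ξ) (hη : Integrable η P) {c : ℝ}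
    (hc : ∀ᵐ ω ∂P, ‖ξ ω‖ ≤ c) :
    Integrable (fun ω => dotd (ξ ω) ((P[η | m]) ω - η ω)) P ∧
      ∫ ω, dotd (ξ ω) ((P[η | m]) ω - η ω) ∂P = 0 := by
  have hB : MeasurableSet[m] {ω | ‖ξ ω‖ ≤ c} :=
    measurableSet_le (measurable_norm.comp hξ) measurable_const
  have h := integrableOn_dotd_condExp_sub hm hξ hη hB (c := c) fun ω hω => hω
  rwa [IntegrableOn, Measure.restrict_eq_self_of_ae_mem (s := {ω | ‖ξ ω‖ ≤ c}) hc] at h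

theorem integrable_deltaNext (hy : ∀ t, Integrable (fun ω => y ω t) P) (t : Fin (T + 1)) :
    Integrable (fun ω => deltaNext (y ω) t) P := by
  unfold deltaNext
  refine Integrable.sub ?_ (hy t)
  split_ifs
  · exact integrable_zero _ _ _
  · exact hy _

theorem dotB_add_dotB_deltaX (a v y : Fin (T + 1) → Fin d → ℝ) :
    dotB a v + dotB (fun t => deltaX a t) y = ∑ t, dotd (a t) (v t - deltaNext y t) := by
  have h : dotB (fun t => deltaX a t) y = -∑ t, dotd (a t) (deltaNext y t) := sum_dotd_deltaX a y
  rw [h]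
  simp only [dotB, dotd_sub_right, Finset.sum_sub_distrib]
  ring

/-- The process `E_t Δy_{t+1}`. -/
noncomputable def condDeltaProcess (P : Measure Ω) (ℱ : Filtration (Fin (T + 1)) mΩ)
    (y : Ω → Fin (T + 1) → Fin d → ℝ) : Ω → Fin (T + 1) → Fin d → ℝ :=
  fun ω t => condDelta P ℱ y t ω

theorem condDeltaProcess_adapted : condDeltaProcess P ℱ y ∈ NBolza d ℱ := fun t =>
  (stronglyMeasurable_condExp (m := ℱ t)).measurable

theorem integral_dotB_condDelta [IsProbabilityMeasure P] (hx : x ∈ NBolzaInf d ℱ P)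
    (hy : ∀ t, Integrable (fun ω => y ω t) P) :
    Integrable (fun ω => dotB (x ω) (condDeltaProcess P ℱ y ω) +
        dotB (fun t => deltaX (x ω) t) (y ω)) P ∧
      ∫ ω, (dotB (x ω) (condDeltaProcess P ℱ y ω) +
        dotB (fun t => deltaX (x ω) t) (y ω)) ∂P = 0 := by
  obtain ⟨M, hM⟩ := hx.2
  have key := fun t => integral_dotd_condExp_sub_eq_zero (ℱ.le t) (hx.1 t)
    (integrable_deltaNext hy t) (hM.mono fun ω h => h t)
  simp only [dotB_add_dotB_deltaX]
  refine ⟨integrable_finsetSum _ fun t _ => (key t).1, ?_⟩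
  refine (integral_finsetSum _ fun t _ => (key t).1).trans ?_
  exact Finset.sum_eq_zero fun t _ => (key t).2

theorem EReal.coe_sub_le_iff {p : ℝ} {a R : EReal} : (p : EReal) - a ≤ R ↔ (p : EReal) - R ≤ a := by
  induction a with
  | bot => induction R with
    | bot => simp
    | top => simp
    | coe r => simp [← EReal.coe_sub]
  | top => simp
  | coe a => induction R with
    | bot => simp [← EReal.coe_sub]
    | top => simp
    | coe r =>
      rw [← EReal.coe_sub, ← EReal.coe_sub, EReal.coe_le_coe_iff, EReal.coe_le_coe_iff]
      constructor <;> intro h <;> linarith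

theorem conjB_iInf_le {S : Set (Ω → Fin (T + 1) → Fin d → ℝ)}
    {F : (Ω → Fin (T + 1) → Fin d → ℝ) → (Ω → Fin (T + 1) → Fin d → ℝ) → EReal} {R : EReal}
    (h : ∀ u ∈ 𝓤, ∀ x ∈ S, ((pairB P u y : ℝ) : EReal) - F x u ≤ R) :
    conjB P 𝓤 (fun u => ⨅ x ∈ S, F x u) y ≤ R :=
  iSup₂_le fun u hu => EReal.coe_sub_le_iff.2 (le_iInf₂ fun x hx =>
    EReal.coe_sub_le_iff.1 (h u hu x hx))

theorem le_conjB_phiBInf (hu : u ∈ 𝓤) (hx : x ∈ NBolzaInf d ℱ P) :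
    ((pairB P u y : ℝ) : EReal) - intFB P K x u ≤ conjB P 𝓤 (phiBInf P K ℱ) y :=
  (EReal.sub_le_sub le_rfl (iInf₂_le x hx)).trans
    (le_iSup₂ (f := fun u (_ : u ∈ 𝓤) => ((pairB P u y : ℝ) : EReal) - phiBInf P K ℱ u) u hu)

theorem conjB_phiBInf_le_conjB_phiB :
    conjB P 𝓤 (phiBInf P K ℱ) y ≤ conjB P 𝓤 (phiB P K ℱ) y :=
  iSup₂_mono fun _ _ => EReal.sub_le_sub le_rfl
    (le_iInf₂ fun x hx => iInf₂_le (f := fun x (_ : x ∈ NBolza d ℱ) => intFB P K x _) x hx.1)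

/-- A finite upper bound for `φ̃*(y)` is a bound for the Fenchel expressions. -/
theorem fenchelBound_of_conjB_le [IsProbabilityMeasure P]
    (hK : ∀ t, IsConvexNormalIntegrand (ℱ t) (K t)) (h𝓤 : IsDecomposableB P 𝓤)
    (hym : Measurable y) (hpair : ∀ u ∈ 𝓤, Integrable (fun ω => dotB (u ω) (y ω)) P) {C : ℝ}
    (hC : conjB P 𝓤 (phiBInf P K ℱ) y ≤ C) :
    FenchelBound P K ℱ 𝓤 (condDeltaProcess P ℱ y) y C := by
  have hyi := h𝓤.integrable_of_pairing hpair
  have hvi : ∀ x ∈ NBolzaInf d ℱ P,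
      Integrable (fun ω => dotB (x ω) (condDeltaProcess P ℱ y ω)) P := fun x hx =>
    integrable_dotB_of_bounded hx fun t => integrable_condExp
  refine ⟨NBolza.measurable condDeltaProcess_adapted, hym, hvi, hpair, ?_⟩
  rintro x hx w hw hfin ⟨g, hg, hgle⟩
  have hΔ := deltaX_mem h𝓤 hx
  have hu : w - (fun ω t => deltaX (x ω) t) ∈ 𝓤 := 𝓤.sub_mem hw hΔ
  let r : Ω → ℝ := fun ω => ∑ t, (K t (x ω t) (w ω t) ω).toReal
  have hr : AEMeasurable r P :=
    (measurable_sum_toReal hK (NBolza.measurable hx.1) (h𝓤.measurable _ hw)).aemeasurable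
  have hint_eq : intFB P K x (w - (fun ω t => deltaX (x ω) t)) =
      EE P (fun ω => ∑ t, K t (x ω t) (w ω t) ω) := by
    unfold intFB fBolza
    simp
  have hsum := hfin.ae_sum_eq hK
  have htop : EE P (fun ω => ∑ t, K t (x ω t) (w ω t) ω) < ⊤ := by
    rw [EE_lt_top_iff_exists_le hsum hr]
    refine ⟨_, ((hvi x hx).add (hpair w hw)).sub hg, ?_⟩
    filter_upwards [hgle] with ω hω
    rw [fenchelSum_eq] at hω
    simp only [Pi.sub_apply, Pi.add_apply]
    linarith
  have hle := (le_conjB_phiBInf (K := K) hu hx).trans hC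
  rw [hint_eq] at hle
  have hbot : EE P (fun ω => ∑ t, K t (x ω t) (w ω t) ω) ≠ ⊥ := by
    intro h
    rw [h] at hle
    simp at hle
  have hri : Integrable r P := integrable_of_EE_ne hsum hr htop hbot
  rw [EE_of_integrable hsum hri, ← EReal.coe_sub, EReal.coe_le_coe_iff] at hle
  have hfi : Integrable (fun ω => dotB (x ω) (condDeltaProcess P ℱ y ω) + dotB (w ω) (y ω)) P :=
    (hvi x hx).add (hpair w hw)
  have hfeq : fenchelSum K (condDeltaProcess P ℱ y) y x w =
      fun ω => dotB (x ω) (condDeltaProcess P ℱ y ω) + dotB (w ω) (y ω) - r ω :=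
    funext fun ω => fenchelSum_eq K _ _ _ _ ω
  rw [hfeq]
  refine ⟨hfi.sub hri, ?_⟩
  rw [integral_sub hfi hri]
  have hz := integral_dotB_condDelta hx hyi
  have hsplit : ∀ ω, dotB (x ω) (condDeltaProcess P ℱ y ω) + dotB (w ω) (y ω) =
      (dotB (x ω) (condDeltaProcess P ℱ y ω) + dotB (fun t => deltaX (x ω) t) (y ω)) +
        dotB ((w - (fun ω t => deltaX (x ω) t)) ω) (y ω) := by
    intro ω
    have : w ω = (fun t => deltaX (x ω) t) + (w - (fun ω t => deltaX (x ω) t)) ω := by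
      ext; simp
    conv_lhs => rw [this, dotB_add_left]
    ring
  simp only [hsplit]
  rw [integral_add hz.1 (hpair _ hu), hz.2, zero_add]
  exact hle

/-- Fenchel's inequality for the whole problem: `φ*(y) ≤ E Σ_t K_t*(E_tΔy_{t+1}, y_t)`. -/
theorem conjB_phiB_le_EE_Kconj [IsProbabilityMeasure P]
    (hK : ∀ t, IsConvexNormalIntegrand (ℱ t) (K t)) (h𝓤 : IsDecomposableB P 𝓤)
    (hym : Measurable y) (hpair : ∀ u ∈ 𝓤, Integrable (fun ω => dotB (u ω) (y ω)) P) :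
    conjB P 𝓤 (phiB P K ℱ) y ≤
      EE P (fun ω => ∑ t, Kconj (K t) (condDelta P ℱ y t ω) (y ω t) ω) := by
  have hyi := h𝓤.integrable_of_pairing hpair
  refine conjB_iInf_le fun u hu x hx => ?_
  rcases eq_or_ne (intFB P K x u) ⊤ with htop | htop
  · rw [htop]
    simp
  rcases eq_or_ne (EE P (fun ω => ∑ t, Kconj (K t) (condDelta P ℱ y t ω) (y ω t) ω)) ⊤ with
    hctop | hctop
  · rw [hctop]
    exact le_top
  have hxm := NBolza.measurable hx
  let w : Ω → Fin (T + 1) → Fin d → ℝ := (fun ω t => deltaX (x ω) t) + u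
  have hwm : Measurable w := (measurable_deltaX hxm).add (h𝓤.measurable u hu)
  have hEE : EE P (fun ω => ∑ t, K t (x ω t) (w ω t) ω) < ⊤ := lt_top_iff_ne_top.2 htop
  have hfin : StageFinite P K x w := StageFinite.of_EE_lt_top hK hxm hwm hEE
  have hsum := hfin.ae_sum_eq hK
  let r : Ω → ℝ := fun ω => ∑ t, (K t (x ω t) (w ω t) ω).toReal
  have hr : AEMeasurable r P := (measurable_sum_toReal hK hxm hwm).aemeasurable
  obtain ⟨g₁, hg₁, hle₁⟩ := (EE_lt_top_iff_exists_le hsum hr).1 hEE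
  -- measurability and finiteness of the conjugates
  have hcm : ∀ t, AEMeasurable (fun ω => Kconj (K t) (condDelta P ℱ y t ω) (y ω t) ω) P := by
    intro t
    obtain ⟨X, U, α, hX, hU, hα, hdata⟩ := (hK t).exists_seq
    have hv : Measurable (condDelta P ℱ y t) :=
      (condDeltaProcess_adapted (P := P) (y := y) t).mono (ℱ.le t) le_rfl
    have hyt : Measurable fun ω => y ω t := (measurable_pi_apply t).comp hym
    refine ⟨fun ω => ⨆ n, ((dotd (X n ω) (condDelta P ℱ y t ω) + dotd (U n ω) (y ω t) - α n ω : ℝ) :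
      EReal), Measurable.iSup fun n => (((((hX n).mono (ℱ.le t) le_rfl).dotd hv).add
        (((hU n).mono (ℱ.le t) le_rfl).dotd hyt)).sub
          ((hα n).mono (ℱ.le t) le_rfl)).coe_real_ereal, ?_⟩
    filter_upwards [hfin t] with ω h
    exact Kconj_eq_iSup (fun a b => (hK t).ne_bot a b ω) (hdata ω ⟨_, _, h⟩).1
      (fun a b τ => (hdata ω ⟨_, _, h⟩).2 a b _ _ τ)
  have hcge : ∀ᵐ ω ∂P, ∀ t,
      ((fenchelTerm (K t) (condDelta P ℱ y t ω) (y ω t) (x ω t) (w ω t) ω : ℝ) :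
      EReal) ≤ Kconj (K t) (condDelta P ℱ y t ω) (y ω t) ω := by
    filter_upwards [ae_all_iff.2 hfin] with ω h t
    refine le_trans (le_of_eq ?_) (le_iSup₂ (f := fun a b => ((dotd a (condDelta P ℱ y t ω) +
      dotd b (y ω t) : ℝ) : EReal) - K t a b ω) (x ω t) (w ω t))
    rw [fenchelTerm, EReal.coe_sub, EReal.coe_toReal (h t).ne ((hK t).ne_bot _ _ _)]
  let c : Fin (T + 1) → Ω → ℝ := fun t ω => (Kconj (K t) (condDelta P ℱ y t ω) (y ω t) ω).toReal
  have hclt := ae_lt_top_of_EE_lt_top (Finset.aemeasurable_fun_sum _ fun t _ => hcm t)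
    (lt_top_iff_ne_top.2 hctop)
  have hcne : ∀ᵐ ω ∂P, ∀ t, Kconj (K t) (condDelta P ℱ y t ω) (y ω t) ω ≠ ⊥ ∧
      Kconj (K t) (condDelta P ℱ y t ω) (y ω t) ω < ⊤ := by
    filter_upwards [hcge, hclt] with ω h1 h2 t
    have hb : ∀ t, Kconj (K t) (condDelta P ℱ y t ω) (y ω t) ω ≠ ⊥ := fun t =>
      ((EReal.bot_lt_coe _).trans_le (h1 t)).ne'
    exact ⟨hb t, EReal.ne_top_of_sum_lt_top _ (fun t _ => hb t) h2 t (Finset.mem_univ t)⟩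
  have hcsum : ∀ᵐ ω ∂P, ∑ t, Kconj (K t) (condDelta P ℱ y t ω) (y ω t) ω =
      ((∑ t, c t ω : ℝ) : EReal) := by
    filter_upwards [hcne] with ω h
    exact EReal.sum_eq_coe_sum_toReal _ (fun t _ => (h t).1) fun t _ => (h t).2.ne
  have hcmeas : AEMeasurable (fun ω => ∑ t, c t ω) P :=
    Finset.aemeasurable_fun_sum _ fun t _ => (hcm t).ereal_toReal
  obtain ⟨g₂, hg₂, hle₂⟩ := (EE_lt_top_iff_exists_le hcsum hcmeas).1 (lt_top_iff_ne_top.2 hctop)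
  -- the pointwise Fenchel inequality
  let Z : Ω → ℝ := fun ω => ∑ t, dotd (x ω t) ((P[fun ω => deltaNext (y ω) t | ℱ t]) ω -
    deltaNext (y ω) t)
  have hfen : ∀ᵐ ω ∂P, Z ω + dotB (u ω) (y ω) ≤ ∑ t, c t ω + r ω := by
    filter_upwards [hcge, hcne] with ω h1 h2
    have h3 : fenchelSum K (condDeltaProcess P ℱ y) y x w ω ≤ ∑ t, c t ω := by
      refine Finset.sum_le_sum fun t _ => ?_
      have := h1 t
      rwa [← EReal.coe_toReal (h2 t).2.ne (h2 t).1, EReal.coe_le_coe_iff] at this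
    rw [fenchelSum_eq] at h3
    have h4 : Z ω = dotB (x ω) (condDeltaProcess P ℱ y ω) +
        dotB (fun t => deltaX (x ω) t) (y ω) := (dotB_add_dotB_deltaX _ _ _).symm
    have h5 : dotB (w ω) (y ω) = dotB (fun t => deltaX (x ω) t) (y ω) + dotB (u ω) (y ω) :=
      dotB_add_left _ _ _
    rw [h4]
    rw [h5] at h3
    simp only [r]
    linarith
  have hpi := hpair u hu
  obtain ⟨hZi, hZ0⟩ := integrable_sum_dotd_condExp_sub ℱ hx (integrable_deltaNext hyi)
    ((hg₁.add hg₂).sub hpi) (by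
      filter_upwards [hfen, hle₁, hle₂] with ω h1 h2 h3
      have h1' : Z ω + dotB (u ω) (y ω) ≤ ∑ t, c t ω + r ω := h1
      have h2' : r ω ≤ g₁ ω := h2
      change Z ω ≤ g₁ ω + g₂ ω - dotB (u ω) (y ω)
      linarith)
  have hZi' : Integrable Z P := hZi
  have hri : Integrable r P := by
    refine integrable_of_ae_le_of_ae_le hr ((hZi'.add hpi).sub hg₂) hg₁ ?_ hle₁
    filter_upwards [hfen, hle₂] with ω h1 h2
    simp only [Pi.sub_apply, Pi.add_apply]
    linarith
  have hci : Integrable (fun ω => ∑ t, c t ω) P := by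
    refine integrable_of_ae_le_of_ae_le hcmeas ((hZi'.add hpi).sub hg₁) hg₂ ?_ hle₂
    filter_upwards [hfen, hle₁] with ω h1 h2
    have h2' : r ω ≤ g₁ ω := h2
    simp only [Pi.sub_apply, Pi.add_apply]
    linarith
  have hfinal := integral_mono_ae (hZi'.add hpi) (hci.add hri) hfen
  simp only [Pi.add_apply] at hfinal
  rw [integral_add hZi' hpi, integral_add hci hri] at hfinal
  have hZ0' : 0 ≤ ∫ ω, Z ω ∂P := hZ0
  have hintFB : intFB P K x u = ((∫ ω, r ω ∂P : ℝ) : EReal) := EE_of_integrable hsum hri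
  rw [hintFB, EE_of_integrable hcsum hci, ← EReal.coe_sub, EReal.coe_le_coe_iff]
  unfold pairB
  linarith

theorem EReal.le_of_forall_real {a b : EReal} (h : ∀ C : ℝ, b ≤ C → a ≤ C) : a ≤ b := by
  induction b with
  | bot =>
    rw [le_bot_iff, EReal.eq_bot_iff_forall_lt]
    intro r
    exact (h (r - 1) bot_le).trans_lt (EReal.coe_lt_coe_iff.2 (by linarith))
  | top => exact le_top
  | coe r => exact h r le_rfl

/-- `φ̃*` does not increase under the adapted projection. -/
theorem conjB_phiBInf_aProj_le [IsProbabilityMeasure P]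
    (hK : ∀ t, IsConvexNormalIntegrand (ℱ t) (K t)) (h𝓤 : IsDecomposableB P 𝓤)
    (hdom : SegmentCondition P K ℱ 𝓤) (hym : Measurable y)
    (hpair : ∀ u ∈ 𝓤, Integrable (fun ω => dotB (u ω) (y ω)) P)
    (hpair' : ∀ u ∈ 𝓤, Integrable (fun ω => dotB (u ω) (aProj P ℱ y ω)) P) :
    conjB P 𝓤 (phiBInf P K ℱ) (aProj P ℱ y) ≤ conjB P 𝓤 (phiBInf P K ℱ) y := by
  classical
  refine EReal.le_of_forall_real fun C hC => ?_
  have hB := fenchelBound_of_conjB_le hK h𝓤 hym hpair hC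
  have hyi := h𝓤.integrable_of_pairing hpair
  set v := condDeltaProcess P ℱ y with hv
  set y' := aProj P ℱ y with hy'
  refine conjB_iInf_le fun u hu x hx => ?_
  rcases eq_or_ne (intFB P K x u) ⊤ with htop | htop
  · rw [htop]
    simp
  have hxm := NBolza.measurable hx.1
  have hΔ := deltaX_mem h𝓤 hx
  let w : Ω → Fin (T + 1) → Fin d → ℝ := (fun ω t => deltaX (x ω) t) + u
  have hw : w ∈ 𝓤 := 𝓤.add_mem hΔ hu
  have hwm : Measurable w := h𝓤.measurable w hw
  have hEE : EE P (fun ω => ∑ t, K t (x ω t) (w ω t) ω) < ⊤ := lt_top_iff_ne_top.2 htop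
  have hfin : StageFinite P K x w := StageFinite.of_EE_lt_top hK hxm hwm hEE
  have hsum := hfin.ae_sum_eq hK
  let r : Ω → ℝ := fun ω => ∑ t, (K t (x ω t) (w ω t) ω).toReal
  have hr : AEMeasurable r P := (measurable_sum_toReal hK hxm hwm).aemeasurable
  obtain ⟨g, hg, hgle⟩ := (EE_lt_top_iff_exists_le hsum hr).1 hEE
  have hvi := hB.integrable_v x hx
  have hHi : Integrable (fenchelSum K v y x w) P := (hB.bound x hx w hw hfin
    ⟨_, (hvi.add (hpair w hw)).sub hg, by
      filter_upwards [hgle] with ω hω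
      rw [fenchelSum_eq]
      simp only [Pi.sub_apply, Pi.add_apply]
      linarith⟩).1
  have hri : Integrable r P := by
    refine ((hvi.add (hpair w hw)).sub hHi).congr (.of_forall fun ω => ?_)
    simp only [Pi.sub_apply, Pi.add_apply, fenchelSum_eq, r]
    ring
  have hfi' : Integrable (fun ω => dotB (x ω) (v ω) + dotB (w ω) (y' ω)) P :=
    hvi.add (hpair' w hw)
  have hHeq' : fenchelSum K v y' x w = fun ω => dotB (x ω) (v ω) + dotB (w ω) (y' ω) - r ω :=
    funext fun ω => fenchelSum_eq K _ _ _ _ ω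
  have hHi' : Integrable (fenchelSum K v y' x w) P := by
    rw [hHeq']
    exact hfi'.sub hri
  have hHint' : ∫ ω, fenchelSum K v y' x w ω ∂P = pairB P u y' - ∫ ω, r ω ∂P := by
    have hz := integral_dotB_condDelta hx hyi
    obtain ⟨M, hM⟩ := (deltaX_bounded hx).2
    have key := fun t => integral_dotd_condExp_sub_eq_zero (ℱ.le t) (adapted_deltaX hx.1 t) (hyi t)
      (hM.mono fun ω h => h t)
    have hD : Integrable (fun ω => ∑ t, dotd (deltaX (x ω) t) (y' ω t - y ω t)) P :=
      integrable_finsetSum _ fun t _ => (key t).1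
    have hD0 : ∫ ω, ∑ t, dotd (deltaX (x ω) t) (y' ω t - y ω t) ∂P = 0 :=
      (integral_finsetSum _ fun t _ => (key t).1).trans
        (Finset.sum_eq_zero fun t _ => (key t).2)
    have hsplit : ∀ ω, fenchelSum K v y' x w ω = (dotB (x ω) (v ω) +
        dotB (fun t => deltaX (x ω) t) (y ω)) +
        ∑ t, dotd (deltaX (x ω) t) (y' ω t - y ω t) + dotB (u ω) (y' ω) - r ω := by
      intro ω
      have h1 : dotB (w ω) (y' ω) = dotB (fun t => deltaX (x ω) t) (y' ω) + dotB (u ω) (y' ω) :=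
        dotB_add_left _ _ _
      rw [fenchelSum_eq, h1]
      simp only [dotB, dotd_sub_right, Finset.sum_sub_distrib, r]
      ring
    simp only [hsplit]
    have hi1 := hz.1.add hD
    have hi2 := hi1.add (hpair' u hu)
    have e1 := integral_sub hi2 hri
    have e2 := integral_add hi1 (hpair' u hu)
    have e3 := integral_add hz.1 hD
    simp only [Pi.add_apply] at e1 e2 e3
    rw [e1, e2, e3, hD0, hz.2, zero_add, zero_add]
    rfl
  have hintFB : intFB P K x u = ((∫ ω, r ω ∂P : ℝ) : EReal) := EE_of_integrable hsum hri
  rw [hintFB, ← EReal.coe_sub, EReal.coe_le_coe_iff, ← hHint']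
  refine le_of_forall_pos_le_add fun δ hδ => ?_
  obtain ⟨w', hw', hfin', hle'⟩ := hB.exists_adapted hK h𝓤 hdom hyi hx hwm hfin hHi
    (ε := δ / (T + 1)) (by positivity)
  -- choose, for `y`, the better of the two controls
  let H : (Ω → Fin (T + 1) → Fin d → ℝ) → Fin (T + 1) → Ω → ℝ := fun w t ω =>
    fenchelTerm (K t) (v ω t) (y ω t) (x ω t) (w ω t) ω
  have hHm : ∀ w : Ω → Fin (T + 1) → Fin d → ℝ, Measurable w → ∀ t, Measurable (H w t) :=
    fun w hw t => (hK t).measurable_fenchelTerm (ℱ.le t)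
      ((measurable_pi_apply t).comp hB.measurable_v) ((measurable_pi_apply t).comp hym)
      ((measurable_pi_apply t).comp hxm) ((measurable_pi_apply t).comp hw)
  have hw'm := NBolza.measurable hw'
  let wm : Ω → Fin (T + 1) → Fin d → ℝ := fun ω t => if H w t ω ≤ H w' t ω then w' ω t else w ω t
  have hwmm : Measurable wm := measurable_pi_iff.2 fun t =>
    Measurable.ite (measurableSet_le (hHm w hwm t) (hHm w' hw'm t))
      ((measurable_pi_apply t).comp hw'm) ((measurable_pi_apply t).comp hwm)
  have hwm_ge : ∀ ω t, H w t ω ≤ H wm t ω ∧ H w' t ω ≤ H wm t ω := by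
    intro ω t
    by_cases h : H w t ω ≤ H w' t ω
    · have : H wm t ω = H w' t ω := by simp only [H, wm]; rw [if_pos h]
      rw [this]
      exact ⟨h, le_rfl⟩
    · have : H wm t ω = H w t ω := by simp only [H, wm]; rw [if_neg h]
      rw [this]
      exact ⟨le_rfl, (not_le.1 h).le⟩
  have hwmfin : StageFinite P K x wm := by
    intro t
    filter_upwards [hfin t, hfin' t] with ω h1 h2
    simp only [wm]
    split_ifs
    · exact h2
    · exact h1
  obtain ⟨hmi, hmC⟩ := hB.bound_of_segmentCondition hK h𝓤 hdom hx hwmm hwmfin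
    ⟨_, hHi, .of_forall fun ω => Finset.sum_le_sum fun t _ => (hwm_ge ω t).1⟩
  let Z : Ω → ℝ := fun ω => ∑ t, dotd (-w' ω t) ((P[fun ω => y ω t | ℱ t]) ω - y ω t)
  have hpt : ∀ᵐ ω ∂P, fenchelSum K v y' x w ω - δ ≤ fenchelSum K v y x wm ω - Z ω := by
    filter_upwards [ae_all_iff.2 hle'] with ω h
    have h1 : fenchelSum K v y' x w ω - δ ≤ fenchelSum K v y' x w' ω := by
      have : fenchelSum K v y' x w ω - δ = ∑ t,
          (fenchelTerm (K t) (v ω t) (y' ω t) (x ω t) (w ω t) ω - δ / (T + 1)) := by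
        simp only [fenchelSum, Finset.sum_sub_distrib, Finset.sum_const, Finset.card_univ,
          Fintype.card_fin, nsmul_eq_mul]
        push_cast
        field_simp
      rw [this]
      exact Finset.sum_le_sum fun t _ => h t
    have h2 : fenchelSum K v y' x w' ω = ∑ t, H w' t ω - Z ω := by
      simp only [fenchelSum, Z, ← Finset.sum_sub_distrib]
      refine Finset.sum_congr rfl fun t _ => ?_
      have : y' ω t = (P[fun ω => y ω t | ℱ t]) ω := rfl
      rw [← this]
      have hneg : dotd (-w' ω t) (y' ω t - y ω t) =
          -(dotd (w' ω t) (y' ω t) - dotd (w' ω t) (y ω t)) := by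
        rw [← neg_one_smul ℝ, dotd_smul_left, dotd_sub_right]
        ring
      rw [hneg]
      simp only [H, fenchelTerm]
      ring
    have h3 : ∑ t, H w' t ω ≤ fenchelSum K v y x wm ω :=
      Finset.sum_le_sum fun t _ => (hwm_ge ω t).2
    linarith
  obtain ⟨hZi, hZ0⟩ := integrable_sum_dotd_condExp_sub ℱ (x := fun t ω => -w' ω t)
    (fun t => (hw' t).neg) hyi ((hmi.sub hHi').add (integrable_const δ)) (by
      filter_upwards [hpt] with ω h
      simp only [Pi.add_apply, Pi.sub_apply]
      change Z ω ≤ _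
      linarith)
  have hZi' : Integrable Z P := hZi
  have hZ0' : 0 ≤ ∫ ω, Z ω ∂P := hZ0
  have hfinal := integral_mono_ae (hHi'.sub (integrable_const δ)) (hmi.sub hZi') hpt
  simp only [Pi.sub_apply] at hfinal
  rw [integral_sub hHi' (integrable_const δ), integral_sub hmi hZi'] at hfinal
  simp only [integral_const, probReal_univ, one_smul] at hfinal
  linarith

end Pairing

/-- For adapted `y ∈ 𝓨∩𝓝`, `φ̃*(y) = φ*(y) = E Σ_t K_t*(E_tΔy_{t+1}, y_t)`,
and `φ̃*(ᵃy) ≤ φ̃*(y)` for every `y ∈ 𝓨`. -/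
theorem stmt_10
    {Ω : Type*} {mΩ : MeasurableSpace Ω} (P : Measure Ω) [IsProbabilityMeasure P] [P.IsComplete]
    {T d : ℕ} (ℱ : Filtration (Fin (T + 1)) mΩ)
    (hℱ : ∀ t, (P.trim (ℱ.le t)).IsComplete)
    (K : Fin (T + 1) → (Fin d → ℝ) → (Fin d → ℝ) → Ω → EReal)
    (hK : ∀ t, IsConvexNormalIntegrand (ℱ t) (K t))
    -- `𝓤` and `𝓨` are decomposable subspaces in separating duality
    (𝓤 𝓨 : Submodule ℝ (Ω → Fin (T + 1) → Fin d → ℝ))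
    (h𝓤 : IsDecomposableB P 𝓤) (h𝓨 : IsDecomposableB P 𝓨)
    (hpair : ∀ u ∈ 𝓤, ∀ y ∈ 𝓨, Integrable (fun ω => dotB (u ω) (y ω)) P)
    (hsep𝓤 : ∀ u ∈ 𝓤, (∀ y ∈ 𝓨, pairB P u y = 0) → u =ᵐ[P] 0)
    (hsep𝓨 : ∀ y ∈ 𝓨, (∀ u ∈ 𝓤, pairB P u y = 0) → y =ᵐ[P] 0)
    -- assumption (i) is about at least one strategy
    (hne : ∃ x ∈ NBolzaInf d ℱ P, ∀ t, ∀ᵐ ω ∂P, x ω t ∈ closure (dom1K (K t) ω))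
    -- assumption (i): the relative-interior domain condition
    (hdom : ∀ x ∈ NBolzaInf d ℱ P,
      (∀ t, ∀ᵐ ω ∂P, x ω t ∈ closure (dom1K (K t) ω)) →
      ∃ xbar ∈ NBolzaInf d ℱ P,
        (∀ t, ∀ᵐ ω ∂P, xbar ω t ∈ intrinsicInterior ℝ (dom1K (K t) ω)) ∧
        ∀ lam : ℝ, 0 < lam → lam ≤ 1 → (1 - lam) • x + lam • xbar ∈ dom1B P K ℱ 𝓤)
    -- assumption (ii): adapted projections stay in `𝓤` and `𝓨`
    (hproj𝓤 : ∀ u ∈ 𝓤, aProj P ℱ u ∈ 𝓤)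
    (hproj𝓨 : ∀ y ∈ 𝓨, aProj P ℱ y ∈ 𝓨) :
    (∀ y ∈ 𝓨, y ∈ NBolza d ℱ →
        conjB P 𝓤 (phiBInf P K ℱ) y = conjB P 𝓤 (phiB P K ℱ) y ∧
        conjB P 𝓤 (phiB P K ℱ) y =
          EE P (fun ω => ∑ t, Kconj (K t) (condDelta P ℱ y t ω) (y ω t) ω)) ∧
      (∀ y ∈ 𝓨, conjB P 𝓤 (phiBInf P K ℱ) (aProj P ℱ y) ≤ conjB P 𝓤 (phiBInf P K ℱ) y) := by

  have hseg : SegmentCondition P K ℱ 𝓤 := fun x hx hcl => by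
    obtain ⟨xb, hxb, -, h⟩ := hdom x hx hcl
    exact ⟨xb, hxb, h⟩
  refine ⟨fun y hy hyN => ?_, fun y hy => ?_⟩
  · have hym := h𝓨.measurable y hy
    have hp : ∀ u ∈ 𝓤, Integrable (fun ω => dotB (u ω) (y ω)) P := fun u hu => hpair u hu y hy
    have hyi := h𝓤.integrable_of_pairing hp
    have hlow : EE P (fun ω => ∑ t, Kconj (K t) (condDelta P ℱ y t ω) (y ω t) ω) ≤
        conjB P 𝓤 (phiBInf P K ℱ) y := by
      refine EReal.le_of_forall_real fun C hC => ?_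
      have hB := fenchelBound_of_conjB_le hK h𝓤 hym hp hC
      obtain ⟨x, hx, hxcl⟩ := hne
      obtain ⟨xb, hxb, h⟩ := hseg x hx hxcl
      have hxbd : xb ∈ dom1B P K ℱ 𝓤 := by simpa using h 1 one_pos le_rfl
      obtain ⟨wb, hwb, hfinb, hintb⟩ := hB.exists_base hK h𝓤 hxb hxbd
      obtain ⟨w₀, hw₀, hfin₀, hle₀⟩ := hB.exists_adapted hK h𝓤 hseg hyi hxb
        (h𝓤.measurable wb hwb) hfinb hintb one_pos
      have hproj : aProj P ℱ y = y := by
        funext ω t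
        exact congrFun (condExp_of_stronglyMeasurable (ℱ.le t) (hyN t).stronglyMeasurable (hyi t)) ω
      rw [hproj] at hle₀
      obtain ⟨hint₀, -⟩ := hB.bound_of_segmentCondition hK h𝓤 hseg hxb (NBolza.measurable hw₀)
        hfin₀ ⟨_, hintb.sub (integrable_const ((T : ℝ) + 1)), by
          filter_upwards [ae_all_iff.2 hle₀] with ω hω
          have h1 : ∑ t, (fenchelTerm (K t) (condDeltaProcess P ℱ y ω t) (y ω t) (xb ω t)
              (wb ω t) ω - 1) ≤ fenchelSum K (condDeltaProcess P ℱ y) y xb w₀ ω :=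
            Finset.sum_le_sum fun t _ => hω t
          refine le_trans (le_of_eq ?_) h1
          simp [fenchelSum, Finset.sum_sub_distrib]⟩
      exact hB.EE_Kconj_le hK h𝓤 hseg condDeltaProcess_adapted hyN hxb hw₀ hfin₀ hint₀
    have hup := conjB_phiB_le_EE_Kconj (ℱ := ℱ) hK h𝓤 hym hp
    have hmid : conjB P 𝓤 (phiBInf P K ℱ) y ≤ conjB P 𝓤 (phiB P K ℱ) y :=
      conjB_phiBInf_le_conjB_phiB
    exact ⟨le_antisymm hmid (hup.trans hlow), le_antisymm hup (hlow.trans hmid)⟩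
  · exact conjB_phiBInf_aProj_le hK h𝓤 hseg (h𝓨.measurable y hy) (fun u hu => hpair u hu y hy)
      (fun u hu => hpair u hu _ (hproj𝓨 y hy))
end

section
/- Let $(\Omega,\mathcal F,P)$ be a complete probability space with a filtration $(\mathcal F_t)_{t=0}^T$ of complete sub-$\sigma$-algebras of $\mathcal F$. For given integers $n_t\ge 0$ put $n=n_0+\dots+n_T$, let $\mathcal N$ be the space of $x=(x_t)_{t=0}^T$ with $x_t\in L^0(\Omega,\mathcal F_t,P;\mathbb R^{n_t})$, and let $\mathcal N^\infty\subset\mathcal N$ be the subspace of essentially bounded elements. Let $f:\mathbb R^n\times\mathbb R^m\times\Omega\to[-\infty,+\infty]$ be $\mathcal B(\mathbb R^n\times\mathbb R^m)\otimes\mathcal F$-measurable with $f(\cdot,\cdot,\omega)$ proper, lower semicontinuous and convex for every $\omega$. Let $\mathcal U,\mathcal Y$ be linear subspaces of $L^0(\Omega,\mathcal F,P;\mathbb R^m)$ that are decomposable ($1_Au+1_{\Omega\setminus A}u'\in\mathcal U$ for all $A\in\mathcal F$, $u\in\mathcal U$, $u'\in L^\infty$, and likewise for $\mathcal Y$), such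 that $u\cdot y$ is integrable for all $u\in\mathcal U$, $y\in\mathcal Y$ and the bilinear form $\langle u,y\rangle=E(u\cdot y)$ places $\mathcal U$ and $\mathcal Y$ in separating duality. The expectation of an extended-real-valued function is defined as $+\infty$ unless its positive part is integrable. Define $$Ef(x,u)=\int f(x(\omega),u(\omega),\omega)\,dP(\omega),\qquad \tilde\varphi(u)=\inf_{x\in\mathcal N^\infty}Ef(x,u),\qquad \tilde\varphi^*(y)=\sup_{u\in\mathcal U}\{\langle u,y\rangle-\tilde\varphi(u)\},$$ $$l(x,y,\omega)=\inf_{u\in\mathbb R^m}\{f(x,u,\omega)-u\cdot y\},\qquad El(x,y)=\int l(x(\omega),y(\omega),\omega)\,dP(\omega),$$ and $\operatorname{dom}_1Ef=\{x\in\mathcal N : Ef(x,u)<+\infty\text{ for some }u\in\mathcal U\}$. For a set $C$ in a real vector space let $\operatorname{acl}C$ (the algebraic closure) be the set of points $x$ for which $\{(1-\lambda)x+\lambda z:\lambda\in(0,1]\}\subseteq C$ for some $z\in C$. Suppose that $P$ is integer-valued on $\mathcal F$, i.e. $P(A)\in\{0,1\}$ for every $A\in\mathcal F$ (the deterministic case).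 Then for every $y\in\mathcal Y$ the domain condition $$\{x\in\mathcal N^\infty : El(x,y)<+\infty\}\subseteq\operatorname{acl}(\operatorname{dom}_1Ef\cap\mathcal N^\infty)$$ holds, and $\tilde\varphi^*(y)=-\inf_{x\in\mathcal N^\infty}El(x,y)$. -/
open MeasureTheory
open scoped ENNReal

namespace StochDual

noncomputable section

/-- Expectation of an extended-real-valued function: it equals `+∞` unless the positive
part is integrable, in which case it is `E[φ⁺] - E[φ⁻]` (possibly `-∞`). Here
`EReal.toENNReal` is the positive part of an extended real number. -/
def expect {Ω : Type*} [MeasurableSpace Ω] (P : Measure Ω) (φ : Ω → EReal) : EReal :=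
  if ∫⁻ ω, (φ ω).toENNReal ∂P = ⊤ then ⊤
  else ((∫⁻ ω, (φ ω).toENNReal ∂P : ℝ≥0∞) : EReal)
    - ((∫⁻ ω, (-(φ ω)).toENNReal ∂P : ℝ≥0∞) : EReal)

/-- `ℝ^n` viewed as `ℝ^{n_0} × ⋯ × ℝ^{n_T}`. -/
abbrev Vec {T : ℕ} (nt : Fin (T + 1) → ℕ) : Type := (t : Fin (T + 1)) → Fin (nt t) → ℝ

/-- A convex normal integrand on `ℝ^n × ℝ^m × Ω`: jointly measurable and, for every `ω`,
proper, lower semicontinuous and convex in `(x, u)`. -/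
structure IsConvexNormalIntegrand {Ω : Type*} [MeasurableSpace Ω] {T : ℕ}
    {nt : Fin (T + 1) → ℕ} {m : ℕ} (f : Vec nt → (Fin m → ℝ) → Ω → EReal) : Prop where
  measurable : Measurable (fun p : (Vec nt × (Fin m → ℝ)) × Ω => f p.1.1 p.1.2 p.2)
  ne_bot : ∀ ω x u, f x u ω ≠ ⊥
  exists_ne_top : ∀ ω, ∃ x u, f x u ω ≠ ⊤
  lsc : ∀ ω, LowerSemicontinuous (fun p : Vec nt × (Fin m → ℝ) => f p.1 p.2 ω)
  convex : ∀ (ω : Ω) (a b : ℝ) (x₁ x₂ : Vec nt) (u₁ u₂ : Fin m → ℝ),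
    0 < a → 0 < b → a + b = 1 →
    f (a • x₁ + b • x₂) (a • u₁ + b • u₂) ω ≤
      (a : EReal) * f x₁ u₁ ω + (b : EReal) * f x₂ u₂ ω

/-- The space `𝓝` of adapted strategies (represented by measurable functions). -/
def Adapted {Ω : Type*} [mΩ : MeasurableSpace Ω] {T : ℕ} (nt : Fin (T + 1) → ℕ)
    (ℱ : Filtration (Fin (T + 1)) mΩ) : Set (Ω → Vec nt) :=
  {x | ∀ t, Measurable[ℱ t] (fun ω => x ω t)}

/-- The space `𝓝^∞` of essentially bounded adapted strategies. -/
def AdaptedBdd {Ω : Type*} [mΩ : MeasurableSpace Ω] (P : Measure Ω) {T : ℕ}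
    (nt : Fin (T + 1) → ℕ) (ℱ : Filtration (Fin (T + 1)) mΩ) : Set (Ω → Vec nt) :=
  {x | x ∈ Adapted nt ℱ ∧ ∃ M : ℝ, ∀ᵐ ω ∂P, ‖x ω‖ ≤ M}

/-- `Ef(x,u)`. -/
def Ef {Ω : Type*} [MeasurableSpace Ω] (P : Measure Ω) {T : ℕ} {nt : Fin (T + 1) → ℕ} {m : ℕ}
    (f : Vec nt → (Fin m → ℝ) → Ω → EReal) (x : Ω → Vec nt) (u : Ω → Fin m → ℝ) : EReal :=
  expect P (fun ω => f (x ω) (u ω) ω)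

/-- The bilinear form `⟨u,y⟩ = E(u·y)`. -/
def pairing {Ω : Type*} [MeasurableSpace Ω] (P : Measure Ω) {m : ℕ}
    (u y : Ω → Fin m → ℝ) : ℝ := ∫ ω, u ω ⬝ᵥ y ω ∂P

/-- The auxiliary value function `φ̃(u) = inf_{x∈𝓝^∞} Ef(x,u)`. -/
def valueBdd {Ω : Type*} [mΩ : MeasurableSpace Ω] (P : Measure Ω) {T : ℕ}
    {nt : Fin (T + 1) → ℕ} {m : ℕ} (ℱ : Filtration (Fin (T + 1)) mΩ)
    (f : Vec nt → (Fin m → ℝ) → Ω → EReal) (u : Ω → Fin m → ℝ) : EReal :=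
  ⨅ x ∈ AdaptedBdd P nt ℱ, Ef P f x u

/-- The conjugate `g*(y) = sup_{u∈𝓤} {⟨u,y⟩ - g(u)}` of a function `g` on `𝓤`. -/
def conjugate {Ω : Type*} [MeasurableSpace Ω] (P : Measure Ω) {m : ℕ}
    (𝓤 : Submodule ℝ (Ω → Fin m → ℝ)) (g : (Ω → Fin m → ℝ) → EReal)
    (y : Ω → Fin m → ℝ) : EReal :=
  ⨆ u ∈ 𝓤, ((pairing P u y : ℝ) : EReal) - g u

/-- The Lagrangian integrand `l(x,y,ω) = inf_u {f(x,u,ω) - u·y}`. -/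
def lagr {Ω : Type*} {T : ℕ} {nt : Fin (T + 1) → ℕ} {m : ℕ}
    (f : Vec nt → (Fin m → ℝ) → Ω → EReal) (x : Vec nt) (y : Fin m → ℝ) (ω : Ω) : EReal :=
  ⨅ u : Fin m → ℝ, f x u ω - ((u ⬝ᵥ y : ℝ) : EReal)

/-- `El(x,y)`. -/
def El {Ω : Type*} [MeasurableSpace Ω] (P : Measure Ω) {T : ℕ} {nt : Fin (T + 1) → ℕ} {m : ℕ}
    (f : Vec nt → (Fin m → ℝ) → Ω → EReal) (x : Ω → Vec nt) (y : Ω → Fin m → ℝ) : EReal :=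
  expect P (fun ω => lagr f (x ω) (y ω) ω)

/-- `dom₁ Ef = {x ∈ 𝓝 : Ef(x,u) < +∞ for some u ∈ 𝓤}`. -/
def domOne {Ω : Type*} [mΩ : MeasurableSpace Ω] (P : Measure Ω) {T : ℕ}
    {nt : Fin (T + 1) → ℕ} {m : ℕ} (ℱ : Filtration (Fin (T + 1)) mΩ)
    (𝓤 : Submodule ℝ (Ω → Fin m → ℝ)) (f : Vec nt → (Fin m → ℝ) → Ω → EReal) :
    Set (Ω → Vec nt) :=
  {x | x ∈ Adapted nt ℱ ∧ ∃ u ∈ 𝓤, Ef P f x u < ⊤}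

/-- The algebraic closure: points `x` with `(x, z] ⊆ C` for some `z ∈ C`. -/
def acl {A : Type*} [AddCommGroup A] [Module ℝ A] (C : Set A) : Set A :=
  {x | ∃ z ∈ C, ∀ lam : ℝ, 0 < lam → lam ≤ 1 → (1 - lam) • x + lam • z ∈ C}

/-- `𝓤` is a decomposable subspace of `L⁰(Ω,𝓕,P;ℝ^m)`: its elements are measurable and
`1_A u + 1_{Ω∖A} u' ∈ 𝓤` whenever `A ∈ 𝓕`, `u ∈ 𝓤` and `u' ∈ L^∞`. (Elements of `L⁰` are
represented by functions; such a `𝓤` contains with `u` every measurable function that is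
a.e. equal to `u`.) -/
structure IsDecomposable {Ω : Type*} [MeasurableSpace Ω] (P : Measure Ω) {m : ℕ}
    (𝓤 : Submodule ℝ (Ω → Fin m → ℝ)) : Prop where
  measurable : ∀ u ∈ 𝓤, Measurable u
  decomp : ∀ A : Set Ω, MeasurableSet A → ∀ u ∈ 𝓤, ∀ u' : Ω → Fin m → ℝ,
    Measurable u' → (∃ M : ℝ, ∀ᵐ ω ∂P, ‖u' ω‖ ≤ M) →
    A.indicator u + Aᶜ.indicator u' ∈ 𝓤

/-- `⟨u,y⟩ = E(u·y)` is well defined on `𝓤 × 𝓨` and separates points (up to a.e. equality). -/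
structure SeparatingDuality {Ω : Type*} [MeasurableSpace Ω] (P : Measure Ω) {m : ℕ}
    (𝓤 𝓨 : Submodule ℝ (Ω → Fin m → ℝ)) : Prop where
  integrable : ∀ u ∈ 𝓤, ∀ y ∈ 𝓨, Integrable (fun ω => u ω ⬝ᵥ y ω) P
  sep_left : ∀ u ∈ 𝓤, (∀ y ∈ 𝓨, pairing P u y = 0) → u =ᵐ[P] 0
  sep_right : ∀ y ∈ 𝓨, (∀ u ∈ 𝓤, pairing P u y = 0) → y =ᵐ[P] 0

end

end StochDual

namespace StochDual

section ZeroOne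

variable {Ω X β : Type*} [MeasurableSpace Ω] [MeasurableSpace X] [MeasurableSpace β]
  {P : Measure Ω} [IsProbabilityMeasure P]

/-- For a `0`-`1` measure, a product-measurable set has almost surely a constant section. -/
lemma exists_ae_section_eq (hdet : ∀ A : Set Ω, MeasurableSet A → P A = 0 ∨ P A = 1)
    {S : Set (X × Ω)} (hS : MeasurableSet S) :
    ∃ B : Set X, ∀ᵐ ω ∂P, ∀ p, (p, ω) ∈ S ↔ p ∈ B := by
  induction S, hS using MeasurableSpace.induction_on_inter
    (h_eq := generateFrom_prod.symm) (h_inter := isPiSystem_prod) with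
  | empty => exact ⟨∅, by simp⟩
  | basic S hS =>
    obtain ⟨A, -, C, hC, rfl⟩ := hS
    rcases hdet C hC with h | h
    · refine ⟨∅, ?_⟩
      filter_upwards [measure_eq_zero_iff_ae_notMem.1 h] with ω hω p
      simp [hω]
    · refine ⟨A, ?_⟩
      filter_upwards [(mem_ae_iff_prob_eq_one hC).2 h] with ω hω p
      simp [hω]
  | compl S _ ih =>
    obtain ⟨B, hB⟩ := ih
    refine ⟨Bᶜ, ?_⟩
    filter_upwards [hB] with ω hω p
    simp [hω]
  | iUnion S _ _ ih =>
    choose B hB using ih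
    refine ⟨⋃ i, B i, ?_⟩
    filter_upwards [ae_all_iff.2 hB] with ω hω p
    simp [hω]

/-- For a `0`-`1` measure, a jointly measurable function is almost surely independent of the
random parameter, with one exceptional null set for all arguments. -/
lemma exists_ae_forall_eq [MeasurableSpace.CountablySeparated β]
    (hdet : ∀ A : Set Ω, MeasurableSet A → P A = 0 ∨ P A = 1)
    {g : X × Ω → β} (hg : Measurable g) :
    ∃ G : X → β, ∀ᵐ ω ∂P, ∀ p, g (p, ω) = G p := by
  obtain ⟨e, he, hsep⟩ := exists_seq_separating β MeasurableSet.empty Set.univ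
  choose B hB using fun n => exists_ae_section_eq (P := P) hdet (hg (he n))
  have hall := ae_all_iff.2 hB
  obtain ⟨ω₀, hω₀⟩ := hall.exists
  refine ⟨fun p => g (p, ω₀), ?_⟩
  filter_upwards [hall] with ω hω p
  exact hsep _ trivial _ trivial fun n => (hω n p).trans (hω₀ n p).symm

lemma exists_ae_eq_const [MeasurableSpace.CountablySeparated β]
    (hdet : ∀ A : Set Ω, MeasurableSet A → P A = 0 ∨ P A = 1)
    {g : Ω → β} (hg : Measurable g) : ∃ c : β, ∀ᵐ ω ∂P, g ω = c := by
  obtain ⟨G, hG⟩ := exists_ae_forall_eq (X := Unit) hdet (hg.comp measurable_snd)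
  exact ⟨G (), hG.mono fun ω h => h ()⟩

end ZeroOne

lemma expect_eq_of_ae_eq_const {Ω : Type*} [MeasurableSpace Ω] {P : Measure Ω}
    [IsProbabilityMeasure P] {φ : Ω → EReal} {c : EReal} (h : ∀ᵐ ω ∂P, φ ω = c) :
    expect P φ = c := by
  have h₁ : ∫⁻ ω, (φ ω).toENNReal ∂P = c.toENNReal := by
    rw [lintegral_congr_ae (g := fun _ => c.toENNReal) (h.mono fun ω hω => by simp [hω])]
    simp
  have h₂ : ∫⁻ ω, (-(φ ω)).toENNReal ∂P = (-c).toENNReal := by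
    rw [lintegral_congr_ae (g := fun _ => (-c).toENNReal) (h.mono fun ω hω => by simp [hω])]
    simp
  rw [expect, h₁, h₂]
  by_cases hc : c = ⊤
  · simp [hc]
  rw [if_neg (by simpa using hc)]
  rcases le_total 0 c with h0 | h0
  · rw [EReal.coe_toENNReal h0, EReal.toENNReal_of_nonpos (x := -c) (by simpa using h0)]
    simp
  · rw [EReal.coe_toENNReal (x := -c) (by simpa using h0), EReal.toENNReal_of_nonpos h0]
    simp

lemma IsDecomposable.const_mem {Ω : Type*} [MeasurableSpace Ω] {P : Measure Ω} {m : ℕ}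
    {𝓤 : Submodule ℝ (Ω → Fin m → ℝ)} (h : IsDecomposable P 𝓤) (c : Fin m → ℝ) :
    (fun _ => c) ∈ 𝓤 := by
  simpa using h.decomp ∅ MeasurableSet.empty 0 𝓤.zero_mem (fun _ => c) measurable_const
    ⟨‖c‖, by simp⟩

section Strategies

variable {Ω : Type*} [mΩ : MeasurableSpace Ω] {T : ℕ} {nt : Fin (T + 1) → ℕ}
  {ℱ : Filtration (Fin (T + 1)) mΩ}

lemma Adapted.measurable {x : Ω → Vec nt} (hx : x ∈ Adapted nt ℱ) : Measurable x :=
  measurable_pi_iff.2 fun t => (hx t).mono (ℱ.le t) le_rfl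

end Strategies

section Values

variable {Ω : Type*} [MeasurableSpace Ω] {P : Measure Ω} [IsProbabilityMeasure P] {T : ℕ}
  {nt : Fin (T + 1) → ℕ} {m : ℕ} {f : Vec nt → (Fin m → ℝ) → Ω → EReal}
  {F : Vec nt → (Fin m → ℝ) → EReal}

lemma Ef_eq (hF : ∀ᵐ ω ∂P, ∀ x u, f x u ω = F x u) {x : Ω → Vec nt} {u : Ω → Fin m → ℝ}
    {a : Vec nt} {b : Fin m → ℝ} (hx : ∀ᵐ ω ∂P, x ω = a) (hu : ∀ᵐ ω ∂P, u ω = b) :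
    Ef P f x u = F a b := by
  refine expect_eq_of_ae_eq_const ?_
  filter_upwards [hF, hx, hu] with ω h₁ h₂ h₃
  rw [h₁, h₂, h₃]

lemma El_eq (hF : ∀ᵐ ω ∂P, ∀ x u, f x u ω = F x u) {x : Ω → Vec nt} {y : Ω → Fin m → ℝ}
    {a : Vec nt} {c : Fin m → ℝ} (hx : ∀ᵐ ω ∂P, x ω = a) (hy : ∀ᵐ ω ∂P, y ω = c) :
    El P f x y = ⨅ u, F a u - ((u ⬝ᵥ c : ℝ) : EReal) := by
  refine expect_eq_of_ae_eq_const ?_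
  filter_upwards [hF, hx, hy] with ω h₁ h₂ h₃
  simp only [lagr, h₁, h₂, h₃]

lemma pairing_eq {u y : Ω → Fin m → ℝ} {b c : Fin m → ℝ}
    (hu : ∀ᵐ ω ∂P, u ω = b) (hy : ∀ᵐ ω ∂P, y ω = c) : pairing P u y = b ⬝ᵥ c := by
  rw [pairing, integral_congr_ae (g := fun _ => b ⬝ᵥ c)]
  · simp
  · filter_upwards [hu, hy] with ω h₁ h₂
    rw [h₁, h₂]

end Values

end StochDual

theorem stmt_19
    {Ω : Type*} [mΩ : MeasurableSpace Ω] (P : Measure Ω) [IsProbabilityMeasure P]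
    (hP : P.IsComplete)
    {T : ℕ} (ℱ : Filtration (Fin (T + 1)) mΩ)
    (hℱ : ∀ t, (P.trim (ℱ.le t)).IsComplete)
    (nt : Fin (T + 1) → ℕ) {m : ℕ}
    (f : StochDual.Vec nt → (Fin m → ℝ) → Ω → EReal)
    (hf : StochDual.IsConvexNormalIntegrand f)
    (𝓤 𝓨 : Submodule ℝ (Ω → Fin m → ℝ))
    (h𝓤 : StochDual.IsDecomposable P 𝓤) (h𝓨 : StochDual.IsDecomposable P 𝓨)
    (hdual : StochDual.SeparatingDuality P 𝓤 𝓨)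
    (hdet : ∀ A : Set Ω, MeasurableSet A → P A = 0 ∨ P A = 1) :
    ∀ y ∈ 𝓨,
      {x | x ∈ StochDual.AdaptedBdd P nt ℱ ∧ StochDual.El P f x y < ⊤} ⊆
        StochDual.acl (StochDual.domOne P ℱ 𝓤 f ∩ StochDual.AdaptedBdd P nt ℱ) ∧
      StochDual.conjugate P 𝓤 (StochDual.valueBdd P ℱ f) y =
        -⨅ x ∈ StochDual.AdaptedBdd P nt ℱ, StochDual.El P f x y := by
  intro y hy
  obtain ⟨F, hF⟩ : ∃ F : StochDual.Vec nt → (Fin m → ℝ) → EReal,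
      ∀ᵐ ω ∂P, ∀ x u, f x u ω = F x u := by
    obtain ⟨G, hG⟩ := StochDual.exists_ae_forall_eq hdet hf.measurable
    exact ⟨fun x u => G (x, u), hG.mono fun ω h x u => h (x, u)⟩
  have hstrat : ∀ x ∈ StochDual.AdaptedBdd P nt ℱ, ∃ a, ∀ᵐ ω ∂P, x ω = a := fun x hx =>
    StochDual.exists_ae_eq_const hdet (StochDual.Adapted.measurable hx.1)
  obtain ⟨c, hc⟩ := StochDual.exists_ae_eq_const hdet (h𝓨.measurable y hy)
  refine ⟨?_, le_antisymm ?_ ?_⟩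
  · rintro x ⟨hx, hlt⟩
    obtain ⟨a, ha⟩ := hstrat x hx
    rw [StochDual.El_eq hF ha hc, iInf_lt_iff] at hlt
    obtain ⟨b, hb⟩ := hlt
    have hFb : F a b < ⊤ := by
      refine lt_top_iff_ne_top.2 fun h => hb.ne ?_
      rw [h, EReal.top_sub_coe]
    have hmem : x ∈ StochDual.domOne P ℱ 𝓤 f ∩ StochDual.AdaptedBdd P nt ℱ :=
      ⟨⟨hx.1, fun _ => b, h𝓤.const_mem b,
        by rwa [StochDual.Ef_eq hF ha (Filter.Eventually.of_forall fun _ => rfl)]⟩, hx⟩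
    refine ⟨x, hmem, fun lam _ _ => ?_⟩
    rwa [← add_smul, sub_add_cancel, one_smul]
  · refine iSup₂_le fun u hu => ?_
    obtain ⟨b, hb⟩ := StochDual.exists_ae_eq_const hdet (h𝓤.measurable u hu)
    rw [StochDual.pairing_eq hb hc, EReal.le_neg,
      EReal.neg_sub (Or.inl (EReal.coe_ne_bot _)) (Or.inl (EReal.coe_ne_top _)), add_comm,
      ← sub_eq_add_neg]
    refine EReal.le_sub_iff_add_le (Or.inl (EReal.coe_ne_bot _)) (Or.inl (EReal.coe_ne_top _)) |>.2
      (le_iInf₂ fun x hx => ?_)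
    obtain ⟨a, ha⟩ := hstrat x hx
    rw [StochDual.Ef_eq hF ha hb,
      ← EReal.le_sub_iff_add_le (Or.inl (EReal.coe_ne_bot _)) (Or.inl (EReal.coe_ne_top _))]
    refine (iInf₂_le x hx).trans ?_
    rw [StochDual.El_eq hF ha hc]
    exact iInf_le _ b
  · rw [EReal.neg_le]
    refine le_iInf₂ fun x hx => ?_
    obtain ⟨a, ha⟩ := hstrat x hx
    rw [StochDual.El_eq hF ha hc]
    refine le_iInf fun b => ?_
    have hb : ∀ᵐ ω ∂P, (fun _ : Ω => b) ω = b := Filter.Eventually.of_forall fun _ => rfl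
    rw [EReal.neg_le, EReal.neg_sub (Or.inr (EReal.coe_ne_bot _)) (Or.inr (EReal.coe_ne_top _)),
      add_comm, ← sub_eq_add_neg, ← StochDual.pairing_eq hb hc, ← StochDual.Ef_eq hF ha hb]
    have hval : StochDual.valueBdd P ℱ f (fun _ => b) ≤ StochDual.Ef P f x (fun _ => b) :=
      iInf₂_le x hx
    refine (EReal.sub_le_sub le_rfl hval).trans ?_
    exact le_iSup₂ (f := fun u (_ : u ∈ 𝓤) =>
      ((StochDual.pairing P u y : ℝ) : EReal) - StochDual.valueBdd P ℱ f u) _ (h𝓤.const_mem b)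
end
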